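/- Let n ≥ 4 and let (u, p) be a smooth solution of the steady Navier-Stokes equations on Ω = ℝⁿ \ {0}. If there is a constant C > 0 such that |u(x)| ≤ C/|x| for all x ∈ Ω, then u ≡ 0 on Ω. -/

import Mathlib

namespace SteadyNS

open MeasureTheory Metric Set Filter Topology
open scoped ContDiff

variable {n : ℕ}

/-- Euclidean space of dimension `n`. -/
abbrev E (n : ℕ) := EuclideanSpace ℝ (Fin n)

/-- The `i`-th partial derivative. -/
noncomputable def pd (i : Fin n) (f : E n → ℝ) (x : E n) : ℝ :=
  fderiv ℝ f x (EuclideanSpace.single i 1)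

/-- The Laplacian in coordinates. -/
noncomputable def lap (f : E n → ℝ) (x : E n) : ℝ := ∑ i, pd i (pd i f) x

section Calculus

variable {f g : E n → ℝ} {x : E n} {i j : Fin n}

lemma _root_.ContDiffAt.pd (hf : ContDiffAt ℝ ∞ f x) (i : Fin n) :
    ContDiffAt ℝ ∞ (SteadyNS.pd i f) x := by
  have h : ContDiffAt ℝ ∞ (fderiv ℝ f) x := hf.fderiv_right (by simp)
  exact h.clm_apply contDiffAt_const

lemma _root_.ContDiffAt.lap (hf : ContDiffAt ℝ ∞ f x) : ContDiffAt ℝ ∞ (SteadyNS.lap f) x := by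
  unfold SteadyNS.lap
  exact ContDiffAt.sum fun i _ => (hf.pd i).pd i

lemma diffAt (hf : ContDiffAt ℝ ∞ f x) : DifferentiableAt ℝ f x :=
  hf.differentiableAt (by simp)

lemma pd_congr (h : f =ᶠ[𝓝 x] g) : pd i f x = pd i g x := by
  unfold pd; rw [h.fderiv_eq]

lemma pd_add (hf : ContDiffAt ℝ ∞ f x) (hg : ContDiffAt ℝ ∞ g x) :
    pd i (fun y => f y + g y) x = pd i f x + pd i g x := by
  unfold pd; rw [fderiv_fun_add (diffAt hf) (diffAt hg)]; rfl

lemma pd_sub (hf : ContDiffAt ℝ ∞ f x) (hg : ContDiffAt ℝ ∞ g x) :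
    pd i (fun y => f y - g y) x = pd i f x - pd i g x := by
  unfold pd; rw [fderiv_fun_sub (diffAt hf) (diffAt hg)]; rfl

lemma pd_mul (hf : ContDiffAt ℝ ∞ f x) (hg : ContDiffAt ℝ ∞ g x) :
    pd i (fun y => f y * g y) x = pd i f x * g x + f x * pd i g x := by
  unfold pd; rw [fderiv_fun_mul (diffAt hf) (diffAt hg)]
  simp [mul_comm]; ring

lemma pd_const (c : ℝ) : pd i (fun _ => c) x = 0 := by
  unfold pd; simp

lemma pd_const_mul (c : ℝ) (hf : ContDiffAt ℝ ∞ f x) :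
    pd i (fun y => c * f y) x = c * pd i f x := by
  rw [pd_mul contDiffAt_const hf, pd_const]; ring

lemma pd_sum {ι : Type*} {s : Finset ι} {F : ι → E n → ℝ}
    (hF : ∀ k ∈ s, ContDiffAt ℝ ∞ (F k) x) :
    pd i (fun y => ∑ k ∈ s, F k y) x = ∑ k ∈ s, pd i (F k) x := by
  unfold pd; rw [fderiv_fun_sum fun k hk => diffAt (hF k hk)]; simp

lemma pd_comm_of_two (hf : ContDiffAt ℝ 2 f x) : pd i (pd j f) x = pd j (pd i f) x := by
  have hs : IsSymmSndFDerivAt ℝ f x := hf.isSymmSndFDerivAt (by simp)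
  have hd : DifferentiableAt ℝ (fderiv ℝ f) x :=
    (hf.fderiv_right (m := 1) (by norm_num)).differentiableAt (by simp)
  have key : ∀ v w : E n, fderiv ℝ (fun y => fderiv ℝ f y v) x w = fderiv ℝ (fderiv ℝ f) x w v := by
    intro v w
    rw [fderiv_clm_apply hd (differentiableAt_const _)]
    simp
  show fderiv ℝ (fun y => fderiv ℝ f y _) x _ = fderiv ℝ (fun y => fderiv ℝ f y _) x _
  rw [key, key, hs.eq]

lemma pd_comm (hf : ContDiffAt ℝ ∞ f x) : pd i (pd j f) x = pd j (pd i f) x :=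
  pd_comm_of_two (hf.of_le (by norm_cast))

lemma pd_comp {F : ℝ → ℝ} (hF : DifferentiableAt ℝ F (f x)) (hf : ContDiffAt ℝ ∞ f x) :
    pd i (fun y => F (f y)) x = deriv F (f x) * pd i f x := by
  unfold pd
  have := (hF.hasDerivAt.comp_hasFDerivAt x (diffAt hf).hasFDerivAt).fderiv
  rw [show (fun y => F (f y)) = F ∘ f from rfl, this]; simp

lemma pd_affine (s : ℝ) (y : E n) (hg : DifferentiableAt ℝ g (x + s • y)) :
    pd i (fun z => g (x + s • z)) y = s * pd i g (x + s • y) := by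
  unfold pd
  have h1 : HasFDerivAt (fun z : E n => x + s • z) (s • ContinuousLinearMap.id ℝ (E n)) y :=
    ((hasFDerivAt_id y).const_smul s).const_add x
  have := (hg.hasFDerivAt.comp y h1).fderiv
  rw [show (fun z => g (x + s • z)) = g ∘ (fun z => x + s • z) from rfl, this]; simp

lemma contDiff_coord (j : Fin n) : ContDiff ℝ ∞ (fun y : E n => y j) := by fun_prop

lemma pd_coord : pd i (fun y : E n => y j) x = if i = j then 1 else 0 := by
  unfold pd
  have : (fun y : E n => y j) = (EuclideanSpace.proj j : E n →L[ℝ] ℝ) := rfl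
  rw [this, ContinuousLinearMap.fderiv]
  simp [eq_comm]

lemma normsq_eq (x : E n) : ‖x‖ ^ 2 = ∑ i, x i * x i := by
  rw [EuclideanSpace.norm_sq_eq]; simp [sq]

lemma pd_normsq : pd i (fun y : E n => ‖y‖ ^ 2) x = 2 * x i := by
  simp_rw [normsq_eq]
  rw [pd_sum fun k _ => ((contDiff_coord k).mul (contDiff_coord k)).contDiffAt]
  simp_rw [pd_mul (contDiff_coord _).contDiffAt (contDiff_coord _).contDiffAt, pd_coord]
  simp [Finset.sum_add_distrib]; ring

lemma contDiff_normsq : ContDiff ℝ ∞ (fun y : E n => ‖y‖ ^ 2) := contDiff_norm_sq ℝ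

lemma _root_.ContDiff.pd (hf : ContDiff ℝ ∞ f) (i : Fin n) : ContDiff ℝ ∞ (SteadyNS.pd i f) :=
  contDiff_iff_contDiffAt.2 fun _ => hf.contDiffAt.pd i

lemma _root_.ContDiff.lap (hf : ContDiff ℝ ∞ f) : ContDiff ℝ ∞ (SteadyNS.lap f) :=
  contDiff_iff_contDiffAt.2 fun _ => hf.contDiffAt.lap

lemma pd_radial {b : ℝ → ℝ} (hb : ContDiff ℝ ∞ b) (x : E n) :
    pd i (fun y => b (‖y‖ ^ 2)) x = 2 * x i * deriv b (‖x‖ ^ 2) := by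
  rw [pd_comp (hb.differentiable (by simp) _) contDiff_normsq.contDiffAt, pd_normsq]; ring

lemma contDiff_deriv {b : ℝ → ℝ} (hb : ContDiff ℝ ∞ b) : ContDiff ℝ ∞ (deriv b) :=
  (contDiff_infty_iff_deriv.1 hb).2

lemma contDiff_radial {b : ℝ → ℝ} (hb : ContDiff ℝ ∞ b) :
    ContDiff ℝ ∞ (fun y : E n => b (‖y‖ ^ 2)) := hb.comp contDiff_normsq

lemma lap_radial {b : ℝ → ℝ} (hb : ContDiff ℝ ∞ b) (x : E n) :
    lap (fun y => b (‖y‖ ^ 2)) x =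
      2 * n * deriv b (‖x‖ ^ 2) + 4 * ‖x‖ ^ 2 * deriv (deriv b) (‖x‖ ^ 2) := by
  unfold lap
  have h : ∀ i : Fin n, pd i (fun y : E n => b (‖y‖ ^ 2)) =
      fun y => 2 * (y i * deriv b (‖y‖ ^ 2)) := fun i => by
    ext y; rw [pd_radial hb]; ring
  have hb' := contDiff_deriv hb
  have h2 : ∀ i : Fin n, pd i (pd i (fun y : E n => b (‖y‖ ^ 2))) x =
      2 * deriv b (‖x‖ ^ 2) + 4 * deriv (deriv b) (‖x‖ ^ 2) * (x i * x i) := fun i => by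
    have h3 := (contDiff_radial (n := n) hb')
    rw [h, pd_const_mul _ ((contDiff_coord i).mul h3).contDiffAt,
      pd_mul (contDiff_coord i).contDiffAt h3.contDiffAt, pd_coord, pd_radial hb']
    simp; ring
  simp_rw [h2, Finset.sum_add_distrib, ← Finset.mul_sum, ← normsq_eq]
  simp; ring

lemma lap_congr (h : f =ᶠ[𝓝 x] g) : lap f x = lap g x := by
  unfold lap
  refine Finset.sum_congr rfl fun i _ => pd_congr ?_
  filter_upwards [h.eventuallyEq_nhds] with y hy using pd_congr hy

lemma pd_mul_self_half (hf : ContDiffAt ℝ ∞ f x) :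
    pd i (fun y => f y * f y) x = 2 * (f x * pd i f x) := by
  rw [pd_mul hf hf]; ring

end Calculus

section IntegrationByParts

lemma pd_eq_zero_of_notMem {φ : E n → ℝ} {x : E n} (i : Fin n) (h : x ∉ tsupport φ) :
    pd i φ x = 0 := by
  have : φ =ᶠ[𝓝 x] fun _ => 0 := notMem_tsupport_iff_eventuallyEq.1 h
  rw [pd_congr this, pd_const]

lemma tsupport_pd (φ : E n → ℝ) (i : Fin n) : tsupport (pd i φ) ⊆ tsupport φ := by
  refine closure_minimal (fun x hx => ?_) (isClosed_tsupport φ)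
  by_contra h
  exact hx (pd_eq_zero_of_notMem i h)

lemma _root_.HasCompactSupport.pd {φ : E n → ℝ} (h : HasCompactSupport φ) (i : Fin n) :
    HasCompactSupport (SteadyNS.pd i φ) :=
  h.of_isClosed_subset (isClosed_tsupport _) (tsupport_pd φ i)

lemma tsupport_lap (φ : E n → ℝ) : tsupport (lap φ) ⊆ tsupport φ := by
  refine closure_minimal (fun x hx => ?_) (isClosed_tsupport φ)
  by_contra h
  refine hx (Finset.sum_eq_zero fun i _ => ?_)
  exact pd_eq_zero_of_notMem i fun h' => h (tsupport_pd φ i h')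

lemma integrable_mul_of_tsupport {φ g : E n → ℝ} (hφ : Continuous φ) (hc : HasCompactSupport φ)
    (hg : ∀ x ∈ tsupport φ, ContinuousAt g x) : Integrable (fun x => φ x * g x) := by
  refine Continuous.integrable_of_hasCompactSupport ?_ hc.mul_right
  refine continuous_of_tsupport fun x hx => ?_
  exact hφ.continuousAt.mul (hg x (tsupport_mul_subset_left hx))

lemma ibp {φ g : E n → ℝ} (hφ : ContDiff ℝ ∞ φ) (hc : HasCompactSupport φ)
    (hg : ∀ x ∈ tsupport φ, ContDiffAt ℝ ∞ g x) (i : Fin n) :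
    ∫ x, φ x * pd i g x = -∫ x, pd i φ x * g x := by
  refine integral_mul_fderiv_eq_neg_fderiv_mul_of_integrable
    (integrable_mul_of_tsupport (hφ.pd i).continuous (hc.pd i)
      fun x hx => (hg x (tsupport_pd φ i hx)).continuousAt)
    (integrable_mul_of_tsupport hφ.continuous hc fun x hx => ((hg x hx).pd i).continuousAt)
    (integrable_mul_of_tsupport hφ.continuous hc fun x hx => (hg x hx).continuousAt)
    (fun x _ => diffAt hφ.contDiffAt) fun x hx => diffAt (hg x hx)

end IntegrationByParts

/-- The derivative of `f` along the vector field `u`. -/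
noncomputable def adv (u : Fin n → E n → ℝ) (f : E n → ℝ) (x : E n) : ℝ :=
  ∑ i, u i x * pd i f x

/-- Smooth solutions of the steady Navier-Stokes equations on an open set, in components. -/
structure IsSol (u : Fin n → E n → ℝ) (p : E n → ℝ) (Ω : Set (E n)) : Prop where
  isOpen : IsOpen Ω
  smooth : ∀ x ∈ Ω, ∀ j, ContDiffAt ℝ ∞ (u j) x
  smooth_p : ∀ x ∈ Ω, ContDiffAt ℝ ∞ p x
  momentum : ∀ x ∈ Ω, ∀ j, -lap (u j) x + adv u (u j) x + pd j p x = 0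
  div : ∀ x ∈ Ω, ∑ i, pd i (u i) x = 0

section Pointwise

variable {f g : E n → ℝ} {x : E n}

lemma pd_lap (hf : ContDiffAt ℝ ∞ f x) (j : Fin n) : pd j (lap f) x = lap (pd j f) x := by
  unfold lap
  rw [pd_sum fun i _ => (hf.pd i).pd i]
  refine Finset.sum_congr rfl fun i _ => ?_
  rw [pd_comm (hf.pd i)]
  have h : ∀ᶠ y in 𝓝 x, pd j (pd i f) y = pd i (pd j f) y := by
    have h1 : ∀ᶠ y in 𝓝 x, ContDiffAt ℝ 2 f y :=
      (hf.of_le (by norm_cast)).eventually (by simp)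
    filter_upwards [h1] with y hy
    exact pd_comm_of_two hy
  exact pd_congr h

lemma lap_sum {ι : Type*} {s : Finset ι} {F : ι → E n → ℝ} {Ω : Set (E n)} (hΩ : IsOpen Ω)
    (hF : ∀ y ∈ Ω, ∀ k ∈ s, ContDiffAt ℝ ∞ (F k) y) (hx : x ∈ Ω) :
    lap (fun y => ∑ k ∈ s, F k y) x = ∑ k ∈ s, lap (F k) x := by
  unfold lap
  rw [Finset.sum_comm]
  refine Finset.sum_congr rfl fun i _ => ?_
  rw [← pd_sum fun k hk => (hF x hx k hk).pd i]
  refine pd_congr ?_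
  filter_upwards [hΩ.mem_nhds hx] with y hy using pd_sum fun k hk => hF y hy k hk

lemma lap_add {Ω : Set (E n)} (hΩ : IsOpen Ω) (hf : ∀ y ∈ Ω, ContDiffAt ℝ ∞ f y)
    (hg : ∀ y ∈ Ω, ContDiffAt ℝ ∞ g y) (hx : x ∈ Ω) :
    lap (fun y => f y + g y) x = lap f x + lap g x := by
  unfold lap
  rw [← Finset.sum_add_distrib]
  refine Finset.sum_congr rfl fun i _ => ?_
  rw [← pd_add ((hf x hx).pd i) ((hg x hx).pd i)]
  refine pd_congr ?_
  filter_upwards [hΩ.mem_nhds hx] with y hy using pd_add (hf y hy) (hg y hy)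

lemma lap_mul {Ω : Set (E n)} (hΩ : IsOpen Ω) (hf : ∀ y ∈ Ω, ContDiffAt ℝ ∞ f y)
    (hg : ∀ y ∈ Ω, ContDiffAt ℝ ∞ g y) (hx : x ∈ Ω) :
    lap (fun y => f y * g y) x =
      lap f x * g x + 2 * ∑ i, pd i f x * pd i g x + f x * lap g x := by
  unfold lap
  rw [Finset.sum_mul, Finset.mul_sum, Finset.mul_sum, ← Finset.sum_add_distrib,
    ← Finset.sum_add_distrib]
  refine Finset.sum_congr rfl fun i _ => ?_
  have h : pd i (fun y => f y * g y) =ᶠ[𝓝 x] fun y => pd i f y * g y + f y * pd i g y := by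
    filter_upwards [hΩ.mem_nhds hx] with y hy using pd_mul (hf y hy) (hg y hy)
  have fx := hf x hx
  have gx := hg x hx
  rw [pd_congr h, pd_add ((fx.pd i).mul gx) (fx.mul (gx.pd i)), pd_mul (fx.pd i) gx,
    pd_mul fx (gx.pd i)]
  ring

/-- Half the squared speed. -/
noncomputable def kin (u : Fin n → E n → ℝ) (x : E n) : ℝ := ∑ j, 2⁻¹ * (u j x * u j x)

/-- The total head pressure. -/
noncomputable def head (u : Fin n → E n → ℝ) (p : E n → ℝ) (x : E n) : ℝ := kin u x + p x

namespace IsSol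

variable {u : Fin n → E n → ℝ} {p : E n → ℝ} {Ω : Set (E n)}

lemma smooth_adv (h : IsSol u p Ω) (hx : x ∈ Ω) (hf : ContDiffAt ℝ ∞ f x) :
    ContDiffAt ℝ ∞ (adv u f) x := by
  unfold adv
  exact ContDiffAt.sum fun i _ => (h.smooth x hx i).mul (hf.pd i)

lemma smooth_kin (h : IsSol u p Ω) (hx : x ∈ Ω) : ContDiffAt ℝ ∞ (kin u) x := by
  unfold kin
  exact ContDiffAt.sum fun i _ => contDiffAt_const.mul ((h.smooth x hx i).mul (h.smooth x hx i))

lemma smooth_head (h : IsSol u p Ω) (hx : x ∈ Ω) : ContDiffAt ℝ ∞ (head u p) x :=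
  (h.smooth_kin hx).add (h.smooth_p x hx)

lemma pd_p (h : IsSol u p Ω) (hx : x ∈ Ω) (j : Fin n) :
    pd j p x = lap (u j) x - adv u (u j) x := by
  have := h.momentum x hx j; linarith

lemma sum_pd_lap (h : IsSol u p Ω) (hx : x ∈ Ω) : ∑ j, pd j (lap (u j)) x = 0 := by
  simp_rw [pd_lap (h.smooth x hx _)]
  rw [← lap_sum h.isOpen (fun y hy k _ => (h.smooth y hy k).pd k) hx]
  have : (fun y => ∑ k, pd k (u k) y) =ᶠ[𝓝 x] fun _ => 0 := by
    filter_upwards [h.isOpen.mem_nhds hx] with y hy using h.div y hy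
  rw [lap_congr this]
  unfold lap
  refine Finset.sum_eq_zero fun i _ => ?_
  rw [show pd i (fun _ : E n => (0 : ℝ)) = fun _ => 0 from funext fun y => pd_const 0, pd_const]

lemma lap_p (h : IsSol u p Ω) (hx : x ∈ Ω) :
    lap p x = -∑ j, ∑ i, pd j (u i) x * pd i (u j) x := by
  have hux := h.smooth x hx
  have h1 : ∀ j, pd j (pd j p) x = pd j (lap (u j)) x -
      ∑ i, (pd j (u i) x * pd i (u j) x + u i x * pd i (pd j (u j)) x) := by
    intro j
    have : pd j p =ᶠ[𝓝 x] fun y => lap (u j) y - adv u (u j) y := by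
      filter_upwards [h.isOpen.mem_nhds hx] with y hy using h.pd_p hy j
    rw [pd_congr this, pd_sub (hux j).lap (h.smooth_adv hx (hux j))]
    unfold adv
    rw [pd_sum fun i _ => (hux i).mul ((hux j).pd i)]
    congr 1
    refine Finset.sum_congr rfl fun i _ => ?_
    rw [pd_mul (hux i) ((hux j).pd i), pd_comm (hux j)]
  have h2 : ∀ i, ∑ j, pd i (pd j (u j)) x = 0 := by
    intro i
    rw [← pd_sum fun j _ => (hux j).pd j]
    have : (fun y => ∑ k, pd k (u k) y) =ᶠ[𝓝 x] fun _ => 0 := by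
      filter_upwards [h.isOpen.mem_nhds hx] with y hy using h.div y hy
    rw [pd_congr this, pd_const]
  unfold lap at h1 ⊢
  simp_rw [h1, Finset.sum_sub_distrib, Finset.sum_add_distrib]
  have h3 := h.sum_pd_lap hx
  unfold lap at h3
  have h4 : ∑ j, ∑ i, u i x * pd i (pd j (u j)) x = 0 := by
    rw [Finset.sum_comm]
    simp_rw [← Finset.mul_sum, h2]; simp
  rw [h3, h4]; ring

lemma pd_kin (h : IsSol u p Ω) (hx : x ∈ Ω) (i : Fin n) :
    pd i (kin u) x = ∑ j, u j x * pd i (u j) x := by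
  have hux := h.smooth x hx
  unfold kin
  rw [pd_sum fun j _ => contDiffAt_const.mul ((hux j).mul (hux j))]
  refine Finset.sum_congr rfl fun j _ => ?_
  rw [pd_const_mul _ ((hux j).mul (hux j)), pd_mul_self_half (hux j)]; ring

lemma pd_head (h : IsSol u p Ω) (hx : x ∈ Ω) (i : Fin n) :
    pd i (head u p) x = ∑ j, u j x * pd i (u j) x + pd i p x := by
  rw [← h.pd_kin hx]; exact pd_add (h.smooth_kin hx) (h.smooth_p x hx)

/-- Along the flow, the head pressure changes by `u · Δu`. -/
lemma adv_head (h : IsSol u p Ω) (hx : x ∈ Ω) :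
    adv u (head u p) x = ∑ j, u j x * lap (u j) x := by
  have h1 : ∀ j, lap (u j) x = adv u (u j) x + pd j p x := fun j => by
    have := h.momentum x hx j; linarith
  simp_rw [h1]
  unfold adv
  simp_rw [h.pd_head hx, mul_add, Finset.sum_add_distrib]
  congr 1
  simp_rw [Finset.mul_sum]
  rw [Finset.sum_comm]
  exact Finset.sum_congr rfl fun i _ => Finset.sum_congr rfl fun j _ => by ring

lemma lap_kin (h : IsSol u p Ω) (hx : x ∈ Ω) :
    lap (kin u) x = ∑ j, ∑ i, pd i (u j) x * pd i (u j) x + ∑ j, u j x * lap (u j) x := by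
  have h1 : lap (kin u) x = ∑ j, lap (fun y => (2⁻¹ * u j y) * u j y) x := by
    rw [← lap_sum h.isOpen
      (fun y hy j _ => (contDiffAt_const.mul (h.smooth y hy j)).mul (h.smooth y hy j)) hx]
    congr 1; ext y; unfold kin
    exact Finset.sum_congr rfl fun _ _ => by ring
  have h2 : ∀ j, lap (fun y => (2⁻¹ * u j y) * u j y) x =
      ∑ i, pd i (u j) x * pd i (u j) x + u j x * lap (u j) x := by
    intro j
    rw [lap_mul h.isOpen (fun y hy => contDiffAt_const.mul (h.smooth y hy j))
      (fun y hy => h.smooth y hy j) hx]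
    have h3 : ∀ y ∈ Ω, ∀ i, pd i (fun y => 2⁻¹ * u j y) y = 2⁻¹ * pd i (u j) y :=
      fun y hy i => pd_const_mul _ (h.smooth y hy j)
    have h4 : lap (fun y => 2⁻¹ * u j y) x = 2⁻¹ * lap (u j) x := by
      unfold lap
      rw [Finset.mul_sum]
      refine Finset.sum_congr rfl fun i _ => ?_
      rw [← pd_const_mul _ ((h.smooth x hx j).pd i)]
      refine pd_congr ?_
      filter_upwards [h.isOpen.mem_nhds hx] with y hy using h3 y hy i
    simp_rw [h3 x hx, h4, mul_assoc, ← Finset.mul_sum]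
    ring
  rw [h1]
  simp_rw [h2, Finset.sum_add_distrib]

/-- The head pressure is a subsolution of the advection-diffusion equation. -/
lemma adv_head_le_lap_head (h : IsSol u p Ω) (hx : x ∈ Ω) :
    adv u (head u p) x ≤ lap (head u p) x := by
  have h1 : lap (head u p) x = lap (kin u) x + lap p x :=
    lap_add h.isOpen (fun y hy => h.smooth_kin hy) h.smooth_p hx
  rw [h1, h.adv_head hx, h.lap_kin hx, h.lap_p hx]
  have h2 : 0 ≤ ∑ j, ∑ i, (pd i (u j) x - pd j (u i) x) ^ 2 := by positivity
  have h3 : ∑ j, ∑ i, (pd i (u j) x - pd j (u i) x) ^ 2 =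
      ∑ j, ∑ i, pd i (u j) x * pd i (u j) x + ∑ j, ∑ i, pd j (u i) x * pd j (u i) x -
        2 * ∑ j, ∑ i, pd j (u i) x * pd i (u j) x := by
    simp_rw [Finset.mul_sum, ← Finset.sum_add_distrib, ← Finset.sum_sub_distrib]
    exact Finset.sum_congr rfl fun _ _ => Finset.sum_congr rfl fun _ _ => by ring
  have h4 : ∑ j, ∑ i, pd j (u i) x * pd j (u i) x = ∑ j, ∑ i, pd i (u j) x * pd i (u j) x :=
    Finset.sum_comm
  linarith

end IsSol

end Pointwise

section Weak

variable {φ g : E n → ℝ} {Ω : Set (E n)}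

lemma integral_mul_lap (hφ : ContDiff ℝ ∞ φ) (hc : HasCompactSupport φ)
    (hg : ∀ x ∈ tsupport φ, ContDiffAt ℝ ∞ g x) :
    ∫ x, φ x * lap g x = ∫ x, lap φ x * g x := by
  unfold lap
  simp_rw [Finset.mul_sum, Finset.sum_mul]
  have hg1 : ∀ i, ∀ x ∈ tsupport (pd i φ), ContDiffAt ℝ ∞ g x :=
    fun i x hx => hg x (tsupport_pd φ i hx)
  rw [integral_finsetSum _ fun i _ => integrable_mul_of_tsupport hφ.continuous hc
      fun x hx => (((hg x hx).pd i).pd i).continuousAt,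
    integral_finsetSum _ fun i _ => integrable_mul_of_tsupport ((hφ.pd i).pd i).continuous
      ((hc.pd i).pd i) fun x hx => (hg1 i x (tsupport_pd _ i hx)).continuousAt]
  refine Finset.sum_congr rfl fun i _ => ?_
  rw [ibp hφ hc (fun x hx => (hg x hx).pd i), ibp (hφ.pd i) (hc.pd i) (hg1 i), neg_neg]

lemma IsSol.integral_mul_adv {u : Fin n → E n → ℝ} {p : E n → ℝ} (h : IsSol u p Ω)
    (hφ : ContDiff ℝ ∞ φ) (hc : HasCompactSupport φ) (hs : tsupport φ ⊆ Ω)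
    (hg : ∀ x ∈ tsupport φ, ContDiffAt ℝ ∞ g x) :
    ∫ x, φ x * adv u g x = -∫ x, adv u φ x * g x := by
  have hi : ∀ i, ∀ x ∈ tsupport φ, ContDiffAt ℝ ∞ (u i) x := fun i x hx => h.smooth x (hs hx) i
  have h1 : ∀ i, ∫ x, φ x * pd i (fun y => u i y * g y) x = -∫ x, pd i φ x * (u i x * g x) :=
    fun i => ibp hφ hc (fun x hx => (hi i x hx).mul (hg x hx)) i
  have h2 : ∑ i, ∫ x, φ x * pd i (fun y => u i y * g y) x = ∫ x, φ x * adv u g x := by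
    rw [← integral_finsetSum _ fun i _ => integrable_mul_of_tsupport hφ.continuous hc
      fun x hx => (((hi i x hx).mul (hg x hx)).pd i).continuousAt]
    refine integral_congr_ae (ae_of_all _ fun x => ?_)
    by_cases hx : x ∈ tsupport φ
    · simp only [pd_mul (hi _ x hx) (hg x hx)]
      rw [← Finset.mul_sum, Finset.sum_add_distrib, ← Finset.sum_mul, h.div x (hs hx)]
      simp [adv]
    · simp [image_eq_zero_of_notMem_tsupport hx]
  have h3 : ∑ i, ∫ x, pd i φ x * (u i x * g x) = ∫ x, adv u φ x * g x := by
    rw [← integral_finsetSum _ fun i _ => integrable_mul_of_tsupport (hφ.pd i).continuous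
      (hc.pd i) fun x hx => ((hi i x (tsupport_pd _ i hx)).mul
        (hg x (tsupport_pd _ i hx))).continuousAt]
    refine integral_congr_ae (ae_of_all _ fun x => ?_)
    simp only [adv, Finset.sum_mul]
    exact Finset.sum_congr rfl fun _ _ => by ring
  rw [← h2, ← h3, ← Finset.sum_neg_distrib]
  exact Finset.sum_congr rfl fun i _ => h1 i

end Weak

lemma fderiv_eq_sum_pd (f : E n → ℝ) (x v : E n) : fderiv ℝ f x v = ∑ i, v i * pd i f x := by
  have hv : v = ∑ i, v i • (EuclideanSpace.single i (1 : ℝ) : E n) := by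
    ext j; simp [Finset.sum_apply, Pi.single_apply]
  conv_lhs => rw [hv]
  simp [pd]

lemma abs_fderiv_le (f : E n → ℝ) (x v : E n) :
    |fderiv ℝ f x v| ≤ ‖v‖ * ∑ i, |pd i f x| := by
  rw [fderiv_eq_sum_pd, Finset.mul_sum]
  refine (Finset.abs_sum_le_sum_abs _ _).trans (Finset.sum_le_sum fun i _ => ?_)
  rw [abs_mul]
  gcongr
  simpa using PiLp.norm_apply_le v i

lemma exists_antideriv {g : ℝ → ℝ} (hg : ContDiff ℝ ∞ g) (a : ℝ) :
    ∃ A : ℝ → ℝ, ContDiff ℝ ∞ A ∧ deriv A = g ∧ A a = 0 := by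
  have hd : ∀ x, HasDerivAt (fun x => ∫ t in a..x, g t) (g x) x := fun x =>
    intervalIntegral.integral_hasDerivAt_right (hg.continuous.intervalIntegrable _ _)
      hg.continuous.stronglyMeasurable.stronglyMeasurableAtFilter hg.continuous.continuousAt
  have hd' : deriv (fun x => ∫ t in a..x, g t) = g := funext fun x => (hd x).deriv
  refine ⟨_, contDiff_infty_iff_deriv.2 ⟨fun x => (hd x).differentiableAt, ?_⟩, hd', by simp⟩
  rw [hd']; exact hg

lemma eq_zero_of_deriv_eq_zero {A : ℝ → ℝ} (hA : Differentiable ℝ A) {a : ℝ}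
    (h : ∀ q, a ≤ q → deriv A q = 0) (ha : A a = 0) : ∀ q, a ≤ q → A q = 0 := by
  intro q hq
  rw [← ha]
  refine constant_of_derivWithin_zero (b := q) hA.differentiableOn (fun x hx => ?_) q ⟨hq, le_rfl⟩
  rw [(hA x).derivWithin (uniqueDiffOn_Icc (hx.1.trans_lt hx.2) x ⟨hx.1, hx.2.le⟩), h x hx.1]

lemma tsupport_subset_of_eq_zero {f : E n → ℝ} (h : ∀ x, 1 ≤ ‖x‖ → f x = 0) :
    tsupport f ⊆ closedBall 0 1 := by
  refine closure_minimal (fun x hx => ?_) isClosed_closedBall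
  by_contra hx'
  simp only [mem_closedBall, dist_zero_right, not_le] at hx'
  exact hx (h x hx'.le)

lemma hasCompactSupport_of_closedBall {f : E n → ℝ} (h : tsupport f ⊆ closedBall 0 1) :
    HasCompactSupport f :=
  (isCompact_closedBall (0 : E n) 1).of_isClosed_subset (isClosed_tsupport f) h

/-- `η` is a smooth kernel of mass one whose first moment field is the gradient of `-ΔΨ`. -/
structure IsKernel (Ψ η : E n → ℝ) : Prop where
  smooth : ContDiff ℝ ∞ Ψ
  smooth_mean : ContDiff ℝ ∞ η
  supp : tsupport Ψ ⊆ closedBall 0 1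
  supp_mean : tsupport η ⊆ closedBall 0 1
  mass : ∫ y, η y = 1
  moment : ∀ i y, y i * η y = -pd i (lap Ψ) y

lemma exists_kernel (hn : 0 < n) : ∃ Ψ η : E n → ℝ, IsKernel Ψ η := by
  let β₀ : ContDiffBump (1 / 2 : ℝ) := ⟨1 / 8, 1 / 4, by norm_num, by norm_num⟩
  have hβ₀ : ContDiff ℝ ∞ β₀ := β₀.contDiff
  have hz₀ : ∀ q, 1 ≤ q → β₀ q = 0 := fun q hq => β₀.zero_of_le_dist (by
    rw [Real.dist_eq, abs_of_nonneg (by linarith)]; show (1 / 4 : ℝ) ≤ _; linarith)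
  have hr : ∀ {b : ℝ → ℝ}, (∀ q, 1 ≤ q → b q = 0) → tsupport (fun y : E n => b (‖y‖ ^ 2)) ⊆
      closedBall 0 1 := fun hb => tsupport_subset_of_eq_zero fun x hx => hb _ (by nlinarith)
  have hpos : 0 < ∫ y : E n, β₀ (‖y‖ ^ 2) := by
    have hx : ‖(EuclideanSpace.single ⟨0, hn⟩ (Real.sqrt (1 / 2)) : E n)‖ ^ 2 = 1 / 2 := by
      simp
    refine (contDiff_radial hβ₀).continuous.integral_pos_of_hasCompactSupport_nonneg_nonzero
      (hasCompactSupport_of_closedBall (hr hz₀)) (fun x => β₀.nonneg)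
      (x := EuclideanSpace.single ⟨0, hn⟩ (Real.sqrt (1 / 2))) ?_
    rw [hx]
    exact (β₀.pos_of_mem_ball (by simp [β₀])).ne'
  set I := ∫ y : E n, β₀ (‖y‖ ^ 2)
  obtain ⟨β, hβ, hz, hI⟩ : ∃ β : ℝ → ℝ, ContDiff ℝ ∞ β ∧ (∀ q, 1 ≤ q → β q = 0) ∧
      ∫ y : E n, β (‖y‖ ^ 2) = -1 / 8 := by
    refine ⟨fun q => -1 / (8 * I) * β₀ q, contDiff_const.mul hβ₀,
      fun q hq => by simp [hz₀ q hq], ?_⟩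
    rw [integral_const_mul]
    field_simp
    rfl
  obtain ⟨B₁, hB₁, hd₁, ha₁⟩ := exists_antideriv hβ 1
  obtain ⟨B, hB, hd, ha⟩ := exists_antideriv hB₁ 1
  have hz₁ := eq_zero_of_deriv_eq_zero (hB₁.differentiable (by simp)) (by rwa [hd₁]) ha₁
  have hzB := eq_zero_of_deriv_eq_zero (hB.differentiable (by simp)) (by rwa [hd]) ha
  have hβ' := contDiff_deriv hβ
  have hzd : ∀ q, 1 ≤ q → deriv β q = 0 := by
    have h1 : ∀ q ∈ Ioi (1 : ℝ), deriv β q = 0 := by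
      intro q hq
      have : β =ᶠ[𝓝 q] fun _ => 0 := by
        filter_upwards [isOpen_Ioi.mem_nhds hq] with y hy using hz y (le_of_lt hy)
      rw [this.deriv_eq]; simp
    intro q hq
    have h2 : closure (Ioi (1 : ℝ)) ⊆ {q | deriv β q = 0} :=
      closure_minimal h1 (isClosed_eq hβ'.continuous continuous_const)
    exact h2 (by rw [closure_Ioi]; exact hq)
  let G : ℝ → ℝ := fun q => 2 * n * B₁ q + 4 * q * β q
  have hG : ContDiff ℝ ∞ G :=
    (contDiff_const.mul hB₁).add ((contDiff_const.mul contDiff_id).mul hβ)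
  have hG' : ∀ q, deriv G q = (2 * n + 4) * β q + 4 * q * deriv β q := by
    intro q
    have e1 : HasDerivAt B₁ (β q) q := by
      rw [← hd₁]; exact (hB₁.differentiable (by simp) q).hasDerivAt
    have e2 : HasDerivAt β (deriv β q) q := (hβ.differentiable (by simp) q).hasDerivAt
    have := ((e1.const_mul (2 * (n : ℝ))).add (((hasDerivAt_id q).const_mul 4).mul e2)).deriv
    refine Eq.trans this ?_
    simp; ring
  have hlap : lap (fun y : E n => B (‖y‖ ^ 2)) = fun y => G (‖y‖ ^ 2) := by
    ext y; rw [lap_radial hB, hd, hd₁]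
  have hc := hasCompactSupport_of_closedBall (hr hz)
  have hcd := hasCompactSupport_of_closedBall (hr hzd)
  have hmom : ∀ i : Fin n, ∫ y : E n, y i * y i * deriv β (‖y‖ ^ 2) = 1 / 16 := by
    intro i
    have := ibp (contDiff_radial hβ) hc (fun x _ => (contDiff_coord i).contDiffAt) i
    simp only [pd_coord, pd_radial hβ, if_true, mul_one, hI] at this
    have h2 : ∫ y : E n, 2 * y i * deriv β (‖y‖ ^ 2) * y i =
        2 * ∫ y : E n, y i * y i * deriv β (‖y‖ ^ 2) := by
      rw [← integral_const_mul]; congr 1; ext y; ring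
    linarith
  refine ⟨fun y => B (‖y‖ ^ 2), fun y => -2 * deriv G (‖y‖ ^ 2), contDiff_radial hB,
    contDiff_const.mul (contDiff_radial (contDiff_deriv hG)), hr hzB, ?_, ?_, ?_⟩
  · refine tsupport_subset_of_eq_zero fun x hx => ?_
    have : (1 : ℝ) ≤ ‖x‖ ^ 2 := by nlinarith
    simp [hG', hz _ this, hzd _ this]
  · have e : ∀ y : E n, -2 * deriv G (‖y‖ ^ 2) =
        -2 * (2 * n + 4) * β (‖y‖ ^ 2) + -8 * ∑ i, y i * y i * deriv β (‖y‖ ^ 2) := by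
      intro y; rw [hG', ← Finset.sum_mul, ← normsq_eq]; ring
    have hint : ∀ i : Fin n, Integrable fun y : E n => y i * y i * deriv β (‖y‖ ^ 2) := by
      intro i
      have := integrable_mul_of_tsupport (contDiff_radial hβ').continuous hcd
        (g := fun y : E n => y i * y i) (fun x _ => by fun_prop)
      exact this.congr (ae_of_all _ fun y => by ring)
    simp_rw [e]
    rw [integral_add
      (((contDiff_radial hβ).continuous.integrable_of_hasCompactSupport hc).const_mul _)
      ((integrable_finsetSum _ fun i _ => hint i).const_mul _), integral_const_mul,
      integral_const_mul, integral_finsetSum _ fun i _ => hint i, hI]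
    simp_rw [hmom]
    simp; ring
  · intro i y
    rw [hlap, pd_radial hG]; ring

section Scaled

variable {g : E n → ℝ} {x : E n} {R s : ℝ} {φ : E n → ℝ}

lemma add_smul_mem_ball (hs : |s| < R) {y : E n} (hy : y ∈ closedBall (0 : E n) 1) :
    x + s • y ∈ ball x R := by
  simp only [mem_closedBall, dist_zero_right, mem_ball, dist_self_add_left, norm_smul,
    Real.norm_eq_abs] at hy ⊢
  nlinarith [abs_nonneg s]

lemma contDiffAt_affine (hg : ∀ y ∈ ball x R, ContDiffAt ℝ ∞ g y) (hs : |s| < R)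
    {y : E n} (hy : y ∈ closedBall (0 : E n) 1) : ContDiffAt ℝ ∞ (fun z => g (x + s • z)) y :=
  (hg _ (add_smul_mem_ball hs hy)).comp y (by fun_prop)

lemma scaled_ibp (hφ : ContDiff ℝ ∞ φ) (hφs : tsupport φ ⊆ closedBall 0 1)
    (hg : ∀ y ∈ ball x R, ContDiffAt ℝ ∞ g y) (hs : |s| < R) (i : Fin n) :
    s * ∫ y, φ y * pd i g (x + s • y) = -∫ y, pd i φ y * g (x + s • y) := by
  rw [← ibp hφ (hasCompactSupport_of_closedBall hφs)
    (fun y hy => contDiffAt_affine hg hs (hφs hy)) i, ← integral_const_mul]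
  refine integral_congr_ae (ae_of_all _ fun y => ?_)
  by_cases hy : y ∈ tsupport φ
  · simp only
    rw [pd_affine s y (diffAt (hg _ (add_smul_mem_ball hs (hφs hy))))]; ring
  · simp [image_eq_zero_of_notMem_tsupport hy]

lemma scaled_integrable (hφ : Continuous φ) (hφs : tsupport φ ⊆ closedBall 0 1)
    (hg : ∀ y ∈ ball x R, ContDiffAt ℝ ∞ g y) (hs : |s| < R) :
    Integrable fun y => φ y * g (x + s • y) :=
  integrable_mul_of_tsupport hφ (hasCompactSupport_of_closedBall hφs)
    fun _ hy => (contDiffAt_affine hg hs (hφs hy)).continuousAt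

lemma scaled_green (hφ : ContDiff ℝ ∞ φ) (hφs : tsupport φ ⊆ closedBall 0 1)
    (hg : ∀ y ∈ ball x R, ContDiffAt ℝ ∞ g y) (hs : |s| < R) :
    s ^ 2 * ∫ y, φ y * lap g (x + s • y) = ∫ y, lap φ y * g (x + s • y) := by
  unfold lap
  simp_rw [Finset.mul_sum, Finset.sum_mul]
  rw [integral_finsetSum _ fun i _ => scaled_integrable hφ.continuous hφs
      (fun y hy => ((hg y hy).pd i).pd i) hs,
    integral_finsetSum _ fun i _ => scaled_integrable ((hφ.pd i).pd i).continuous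
      ((tsupport_pd _ i).trans ((tsupport_pd _ i).trans hφs)) hg hs, Finset.mul_sum]
  refine Finset.sum_congr rfl fun i _ => ?_
  rw [sq, mul_assoc, scaled_ibp hφ hφs (fun y hy => (hg y hy).pd i) hs, mul_neg,
    scaled_ibp (hφ.pd i) ((tsupport_pd _ i).trans hφs) hg hs, neg_neg]

lemma abs_scaled_integral_le (hφ : Continuous φ) (hφs : tsupport φ ⊆ closedBall 0 1)
    (hs : |s| < R) {K : ℝ} (hK : ∀ y ∈ ball x R, |g y| ≤ K) :
    |∫ y, φ y * g (x + s • y)| ≤ (∫ y, |φ y|) * K := by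
  rw [← integral_mul_const]
  have hi : Integrable φ :=
    hφ.integrable_of_hasCompactSupport (hasCompactSupport_of_closedBall hφs)
  refine (Real.norm_eq_abs _).symm.trans_le <|
    norm_integral_le_of_norm_le (hi.norm.mul_const K) (ae_of_all _ fun y => ?_)
  rw [Real.norm_eq_abs, abs_mul]
  by_cases hy : y ∈ tsupport φ
  · exact mul_le_mul_of_nonneg_left (hK _ (add_smul_mem_ball hs (hφs hy))) (abs_nonneg _)
  · simp [image_eq_zero_of_notMem_tsupport hy]

lemma hasDerivAt_scaled_mean (hφ : ContDiff ℝ ∞ φ) (hφs : tsupport φ ⊆ closedBall 0 1)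
    (hg : ∀ y ∈ ball x R, ContDiffAt ℝ ∞ g y) (hs : |s| < R) :
    HasDerivAt (fun s => ∫ y, φ y * g (x + s • y))
      (∫ y, ∑ i, (y i * φ y) * pd i g (x + s • y)) s := by
  obtain ⟨R', hsR', hR'⟩ := exists_between hs
  have hsub : closedBall x R' ⊆ ball x R := closedBall_subset_ball hR'
  have hcont : ContinuousOn (fun y => ∑ i, |pd i g y|) (closedBall x R') :=
    fun y hy => (tendsto_finsetSum _ fun i _ =>
      ((hg y (hsub hy)).pd i).continuousAt.abs).mono_left nhdsWithin_le_nhds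
  obtain ⟨K, hK⟩ := (isCompact_closedBall x R').bddAbove_image hcont
  have hK' : ∀ y ∈ closedBall x R', ∑ i, |pd i g y| ≤ K := fun y hy =>
    hK (mem_image_of_mem _ hy)
  have hφc := hasCompactSupport_of_closedBall hφs
  have hnhds : {t : ℝ | |t| < R'} ∈ 𝓝 s :=
    (isOpen_lt continuous_abs continuous_const).mem_nhds hsR'
  refine (hasDerivAt_integral_of_dominated_loc_of_deriv_le
    (F' := fun s y => ∑ i, (y i * φ y) * pd i g (x + s • y))
    (bound := fun y => |φ y| * K) hnhds ?_ (scaled_integrable hφ.continuous hφs hg hs) ?_ ?_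
    ((hφ.continuous.integrable_of_hasCompactSupport hφc).abs.mul_const K) ?_).2
  · filter_upwards [hnhds] with t ht
    exact (scaled_integrable hφ.continuous hφs hg (lt_trans ht hR')).aestronglyMeasurable
  · refine (integrable_finsetSum _ fun i _ => ?_).aestronglyMeasurable
    refine scaled_integrable (φ := fun y => y i * φ y) (by fun_prop)
      ((tsupport_mul_subset_right).trans hφs) (fun y hy => (hg y hy).pd i) hs
  · refine ae_of_all _ fun y t ht => ?_
    by_cases hy : y ∈ tsupport φ
    · have hmem : x + t • y ∈ closedBall x R' := ball_subset_closedBall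
        (add_smul_mem_ball ht (hφs hy))
      have hy1 : ‖y‖ ≤ 1 := by simpa using hφs hy
      have e : ∑ i, (y i * φ y) * pd i g (x + t • y) =
          φ y * ∑ i, y i * pd i g (x + t • y) := by
        rw [Finset.mul_sum]; exact Finset.sum_congr rfl fun _ _ => by ring
      rw [e, ← fderiv_eq_sum_pd, Real.norm_eq_abs, abs_mul]
      refine mul_le_mul_of_nonneg_left ((abs_fderiv_le _ _ _).trans ?_) (abs_nonneg _)
      calc ‖y‖ * ∑ i, |pd i g (x + t • y)| ≤ 1 * ∑ i, |pd i g (x + t • y)| := by gcongr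
        _ ≤ K := by rw [one_mul]; exact hK' _ hmem
    · simp [image_eq_zero_of_notMem_tsupport hy]
  · refine ae_of_all _ fun y t ht => ?_
    by_cases hy : y ∈ tsupport φ
    · have e : ∑ i, (y i * φ y) * pd i g (x + t • y) =
          φ y * fderiv ℝ g (x + t • y) y := by
        rw [fderiv_eq_sum_pd, Finset.mul_sum]; exact Finset.sum_congr rfl fun _ _ => by ring
      rw [e]
      have hmem : x + t • y ∈ ball x R := add_smul_mem_ball (lt_trans ht hR') (hφs hy)
      have h1 : HasDerivAt (fun t : ℝ => x + t • y) y t := by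
        simpa using ((hasDerivAt_id t).smul_const y).const_add x
      exact ((diffAt (hg _ hmem)).hasFDerivAt.comp_hasDerivAt t h1).const_mul _
    · simpa [image_eq_zero_of_notMem_tsupport hy] using hasDerivAt_const t (0 : ℝ)

/-- Comparison of a function with its smooth mean at scale `ρ`. -/
lemma IsKernel.abs_le_abs_mean_add {Ψ η : E n → ℝ} (h : IsKernel Ψ η)
    (hg : ∀ y ∈ ball x R, ContDiffAt ℝ ∞ g y) {ρ K : ℝ} (hρ : 0 < ρ) (hρR : ρ < R)
    (hK : ∀ s, 0 < s → s < ρ → |s * ∫ y, lap Ψ y * lap g (x + s • y)| ≤ K) :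
    |g x| ≤ |∫ y, η y * g (x + ρ • y)| + K * ρ := by
  have hΨ := h.smooth
  set m : ℝ → ℝ := fun s => ∫ y, η y * g (x + s • y)
  have hls : tsupport (lap Ψ) ⊆ closedBall 0 1 := (tsupport_lap Ψ).trans h.supp
  have hd : ∀ s, |s| < R → HasDerivAt m (s * ∫ y, lap Ψ y * lap g (x + s • y)) s := by
    intro s hs
    convert hasDerivAt_scaled_mean h.smooth_mean h.supp_mean hg hs using 1
    simp_rw [h.moment]
    rw [integral_finsetSum _ fun i _ => scaled_integrable (φ := fun y => -pd i (lap Ψ) y)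
      ((hΨ.lap.pd i).continuous.neg)
      (by rw [show (fun y => -pd i (lap Ψ) y) = -pd i (lap Ψ) from rfl, tsupport_neg]
          exact (tsupport_pd _ i).trans hls) (fun y hy => (hg y hy).pd i) hs]
    simp_rw [neg_mul, integral_neg]
    have : ∀ i, -∫ y, pd i (lap Ψ) y * pd i g (x + s • y) =
        s * ∫ y, lap Ψ y * pd i (pd i g) (x + s • y) := fun i =>
      (scaled_ibp hΨ.lap hls (fun y hy => (hg y hy).pd i) hs i).symm
    simp_rw [this]
    rw [← Finset.mul_sum, ← integral_finsetSum _ fun i _ => scaled_integrable hΨ.lap.continuous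
      hls (fun y hy => ((hg y hy).pd i).pd i) hs]
    simp_rw [← Finset.mul_sum]; rfl
  have hm0 : m 0 = g x := by
    simp [m, integral_mul_const, h.mass]
  have hmv : ‖m ρ - m 0‖ ≤ K * (ρ - 0) := by
    have hcont : ContinuousOn m (Icc 0 ρ) := fun s hs =>
      (hd s (by rw [abs_of_nonneg hs.1]; linarith [hs.2])).continuousAt.continuousWithinAt
    obtain ⟨c, hc, hc'⟩ := exists_hasDerivAt_eq_slope m _ hρ hcont fun s hs =>
      hd s (by rw [abs_of_pos hs.1]; linarith [hs.2])
    have := hK c hc.1 hc.2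
    rw [hc', abs_div, div_le_iff₀ (by rw [sub_zero]; exact abs_pos.2 hρ.ne')] at this
    rw [sub_zero ρ, abs_of_pos hρ] at this
    simpa using this
  rw [hm0, sub_zero, Real.norm_eq_abs] at hmv
  have := abs_sub_abs_le_abs_sub (g x) (m ρ)
  rw [abs_sub_comm] at this
  linarith

end Scaled

section Interior

variable {u : Fin n → E n → ℝ} {p : E n → ℝ} {Ω : Set (E n)} {x : E n} {R s : ℝ}

/-- Testing the momentum equation with a divergence free field removes the pressure. -/
lemma IsSol.scaled_integral_lap (h : IsSol u p Ω) (hB : ball x R ⊆ Ω) {Φ : E n → ℝ}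
    (hΦ : ContDiff ℝ ∞ Φ) (hΦs : tsupport Φ ⊆ closedBall 0 1) (hs0 : s ≠ 0) (hs : |s| < R)
    (j : Fin n) :
    ∫ y, lap Φ y * lap (u j) (x + s • y) = (∫ y, lap Φ y * adv u (u j) (x + s • y)) -
      ∑ i, ∫ y, pd j (pd i Φ) y * adv u (u i) (x + s • y) := by
  have hu : ∀ i, ∀ y ∈ ball x R, ContDiffAt ℝ ∞ (u i) y := fun i y hy => h.smooth y (hB hy) i
  have hp : ∀ y ∈ ball x R, ContDiffAt ℝ ∞ p y := fun y hy => h.smooth_p y (hB hy)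
  have ha : ∀ i, ∀ y ∈ ball x R, ContDiffAt ℝ ∞ (adv u (u i)) y := fun i y hy =>
    h.smooth_adv (hB hy) (hu i y hy)
  have hl : ∀ i, ∀ y ∈ ball x R, ContDiffAt ℝ ∞ (lap (u i)) y := fun i y hy => (hu i y hy).lap
  have hls : tsupport (lap Φ) ⊆ closedBall 0 1 := (tsupport_lap Φ).trans hΦs
  have hds : ∀ i, tsupport (pd j (pd i Φ)) ⊆ closedBall 0 1 := fun i =>
    (tsupport_pd _ j).trans ((tsupport_pd _ i).trans hΦs)
  have split : ∀ (φ : E n → ℝ), Continuous φ → tsupport φ ⊆ closedBall 0 1 → ∀ i,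
      ∫ y, φ y * pd i p (x + s • y) =
        (∫ y, φ y * lap (u i) (x + s • y)) - ∫ y, φ y * adv u (u i) (x + s • y) := by
    intro φ hφ hφs i
    rw [← integral_sub (scaled_integrable hφ hφs (hl i) hs) (scaled_integrable hφ hφs (ha i) hs)]
    refine integral_congr_ae (ae_of_all _ fun y => ?_)
    by_cases hy : y ∈ tsupport φ
    · simp only
      rw [h.pd_p (hB (add_smul_mem_ball hs (hφs hy)))]; ring
    · simp [image_eq_zero_of_notMem_tsupport hy]
  have press : ∫ y, lap Φ y * pd j p (x + s • y) =
      ∑ i, ∫ y, pd j (pd i Φ) y * pd i p (x + s • y) := by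
    refine mul_left_cancel₀ hs0 ?_
    rw [scaled_ibp hΦ.lap hls hp hs, Finset.mul_sum]
    have e1 : ∀ i, s * ∫ y, pd j (pd i Φ) y * pd i p (x + s • y) =
        -∫ y, pd i (pd j (pd i Φ)) y * p (x + s • y) := fun i =>
      scaled_ibp ((hΦ.pd i).pd j) (hds i) hp hs i
    simp_rw [e1]
    rw [Finset.sum_neg_distrib, ← integral_finsetSum _ fun i _ => scaled_integrable
      (((hΦ.pd i).pd j).pd i).continuous ((tsupport_pd _ i).trans (hds i)) hp hs]
    congr 2
    ext y
    rw [← Finset.sum_mul]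
    congr 1
    unfold lap
    rw [pd_sum fun i _ => ((hΦ.pd i).pd i).contDiffAt]
    exact Finset.sum_congr rfl fun i _ => pd_comm (hΦ.pd i).contDiffAt
  have solen : ∑ i, ∫ y, pd j (pd i Φ) y * lap (u i) (x + s • y) = 0 := by
    have e1 : ∀ i, ∫ y, pd j (pd i Φ) y * lap (u i) (x + s • y) =
        -(s * ∫ y, pd j Φ y * pd i (lap (u i)) (x + s • y)) := by
      intro i
      rw [scaled_ibp (hΦ.pd j) ((tsupport_pd _ j).trans hΦs) (hl i) hs, neg_neg]
      congr 1; ext y; rw [pd_comm hΦ.contDiffAt]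
    simp_rw [e1]
    rw [Finset.sum_neg_distrib, ← Finset.mul_sum, ← integral_finsetSum _ fun i _ =>
      scaled_integrable (hΦ.pd j).continuous ((tsupport_pd _ j).trans hΦs)
        (fun y hy => (hl i y hy).pd i) hs]
    rw [neg_eq_zero]
    refine mul_eq_zero_of_right _ (integral_eq_zero_of_ae (ae_of_all _ fun y => ?_))
    by_cases hy : y ∈ tsupport (pd j Φ)
    · simp only
      rw [← Finset.mul_sum,
        h.sum_pd_lap (hB (add_smul_mem_ball hs (hΦs (tsupport_pd _ j hy))))]
      simp
    · simp [image_eq_zero_of_notMem_tsupport hy]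
  have e1 := split _ hΦ.lap.continuous hls j
  have e2 : ∑ i, ∫ y, pd j (pd i Φ) y * pd i p (x + s • y) =
      (∑ i, ∫ y, pd j (pd i Φ) y * lap (u i) (x + s • y)) -
        ∑ i, ∫ y, pd j (pd i Φ) y * adv u (u i) (x + s • y) := by
    rw [← Finset.sum_sub_distrib]
    exact Finset.sum_congr rfl fun i _ => split _ ((hΦ.pd i).pd j).continuous (hds i) i
  linarith

/-- The sum of the absolute values of all first derivatives of `u`. -/
noncomputable def gradSum (u : Fin n → E n → ℝ) (x : E n) : ℝ := ∑ j, ∑ i, |pd i (u j) x|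

lemma gradSum_nonneg (u : Fin n → E n → ℝ) (x : E n) : 0 ≤ gradSum u x := by
  unfold gradSum; positivity

lemma abs_adv_le {U N : ℝ} (hU : ∀ i, |u i x| ≤ U) (hN : gradSum u x ≤ N) (hU0 : 0 ≤ U)
    (j : Fin n) : |adv u (u j) x| ≤ U * N := by
  unfold adv
  calc |∑ i, u i x * pd i (u j) x| ≤ ∑ i, |u i x| * |pd i (u j) x| := by
        simp_rw [← abs_mul]; exact Finset.abs_sum_le_sum_abs _ _
    _ ≤ ∑ i, U * |pd i (u j) x| := Finset.sum_le_sum fun i _ => by gcongr; exact hU i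
    _ = U * ∑ i, |pd i (u j) x| := by rw [Finset.mul_sum]
    _ ≤ U * gradSum u x := by
        gcongr
        exact Finset.single_le_sum (f := fun j => ∑ i, |pd i (u j) x|)
          (fun j _ => by positivity) (Finset.mem_univ j)
    _ ≤ U * N := by gcongr

lemma IsSol.abs_lap_p_le (h : IsSol u p Ω) (hx : x ∈ Ω) : |lap p x| ≤ gradSum u x ^ 2 := by
  have hle : ∀ i j, |pd j (u i) x| ≤ gradSum u x := fun i j =>
    (Finset.single_le_sum (f := fun j => |pd j (u i) x|) (fun j _ => by positivity)
      (Finset.mem_univ j)).trans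
      (Finset.single_le_sum (f := fun i => ∑ j, |pd j (u i) x|) (fun j _ => by positivity)
      (Finset.mem_univ i))
  rw [h.lap_p hx, abs_neg]
  calc |∑ j, ∑ i, pd j (u i) x * pd i (u j) x| ≤ ∑ j, ∑ i, |pd j (u i) x| * |pd i (u j) x| := by
        simp_rw [← abs_mul]
        exact (Finset.abs_sum_le_sum_abs _ _).trans
          (Finset.sum_le_sum fun j _ => Finset.abs_sum_le_sum_abs _ _)
    _ ≤ ∑ j, ∑ i, gradSum u x * |pd i (u j) x| := by
        gcongr with j _ i _; exact hle i j
    _ = gradSum u x ^ 2 := by simp_rw [← Finset.mul_sum]; rw [sq]; rfl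

lemma IsSol.continuousOn_gradSum (h : IsSol u p Ω) : ContinuousOn (gradSum u) Ω := by
  unfold gradSum
  exact fun y hy => (tendsto_finsetSum _ fun j _ => tendsto_finsetSum _ fun i _ =>
      ((h.smooth y hy j).pd i).continuousAt.abs).mono_left nhdsWithin_le_nhds

end Interior

lemma IsKernel.exists_abs_pd_le {Ψ η : E n → ℝ} (hk : IsKernel Ψ η) : ∃ A : ℝ, 0 ≤ A ∧
    ∀ (u : Fin n → E n → ℝ) (p : E n → ℝ) (Ω : Set (E n)) (x : E n) (R U N ρ : ℝ),
      IsSol u p Ω → ball x R ⊆ Ω → 0 < ρ → ρ < R → 0 ≤ U →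
      (∀ y ∈ ball x R, ∀ j, |u j y| ≤ U) → (∀ y ∈ ball x R, gradSum u y ≤ N) →
      ∀ k j, |pd k (u j) x| ≤ A * (U / ρ + ρ * U * N) := by
  set A₁ := ∑ k, ∫ y, |pd k η y|
  set A₂ := ∑ k, ∫ y, |lap (pd k Ψ) y|
  set A₃ := ∑ k, ∑ j, ∑ i, ∫ y, |pd j (pd i (pd k Ψ)) y|
  have h1 : ∀ k, ∫ y, |pd k η y| ≤ A₁ := fun k => Finset.single_le_sum
    (f := fun k => ∫ y, |pd k η y|) (fun k _ => by positivity) (Finset.mem_univ k)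
  have h2 : ∀ k, ∫ y, |lap (pd k Ψ) y| ≤ A₂ := fun k => Finset.single_le_sum
    (f := fun k => ∫ y, |lap (pd k Ψ) y|) (fun k _ => by positivity) (Finset.mem_univ k)
  have h3 : ∀ k j, ∑ i, ∫ y, |pd j (pd i (pd k Ψ)) y| ≤ A₃ := fun k j =>
    (Finset.single_le_sum (f := fun j => ∑ i, ∫ y, |pd j (pd i (pd k Ψ)) y|)
      (fun j _ => by positivity) (Finset.mem_univ j)).trans
    (Finset.single_le_sum (f := fun k => ∑ j, ∑ i, ∫ y, |pd j (pd i (pd k Ψ)) y|)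
      (fun j _ => by positivity) (Finset.mem_univ k))
  have p1 : 0 ≤ A₁ := by positivity
  have p2 : 0 ≤ A₂ := by positivity
  have p3 : 0 ≤ A₃ := by positivity
  refine ⟨A₁ + A₂ + A₃, by positivity, fun u p Ω x R U N ρ h hB hρ hρR hU hbu hbN k j => ?_⟩
  have hN : 0 ≤ N := (gradSum_nonneg u x).trans (hbN x (mem_ball_self (hρ.trans hρR)))
  have hsm : ∀ y ∈ ball x R, ContDiffAt ℝ ∞ (u j) y := fun y hy => h.smooth y (hB hy) j
  have hadv : ∀ i, ∀ y ∈ ball x R, |adv u (u i) y| ≤ U * N := fun i y hy =>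
    abs_adv_le (hbu y hy) (hbN y hy) hU i
  have habs : |ρ| < R := by rwa [abs_of_pos hρ]
  have hΦs : tsupport (pd k Ψ) ⊆ closedBall 0 1 := (tsupport_pd _ k).trans hk.supp
  have hls : tsupport (lap Ψ) ⊆ closedBall 0 1 := (tsupport_lap Ψ).trans hk.supp
  have key := hk.abs_le_abs_mean_add (g := pd k (u j)) (fun y hy => (hsm y hy).pd k) hρ hρR
    (K := (A₂ + A₃) * (U * N)) ?_
  · have e1 := scaled_ibp hk.smooth_mean hk.supp_mean hsm habs k
    have e2 := abs_scaled_integral_le (φ := pd k η) (hk.smooth_mean.pd k).continuous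
      ((tsupport_pd _ k).trans hk.supp_mean) habs (fun y hy => hbu y hy j)
    have e3 : |∫ y, η y * pd k (u j) (x + ρ • y)| ≤ A₁ * (U / ρ) := by
      have : ρ * |∫ y, η y * pd k (u j) (x + ρ • y)| ≤ A₁ * U := by
        rw [← abs_of_pos hρ, ← abs_mul, abs_of_pos hρ, e1, abs_neg]
        exact e2.trans (mul_le_mul_of_nonneg_right (h1 k) hU)
      rw [← mul_div_assoc, le_div_iff₀ hρ]; linarith
    calc |pd k (u j) x| ≤ A₁ * (U / ρ) + (A₂ + A₃) * (U * N) * ρ := by linarith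
      _ ≤ (A₁ + A₂ + A₃) * (U / ρ) + (A₁ + A₂ + A₃) * (U * N) * ρ := by
          gcongr <;> linarith
      _ = _ := by ring
  · intro s hs hsρ
    have hs' : |s| < R := by rw [abs_of_pos hs]; linarith
    have e0 : ∫ y, lap Ψ y * lap (pd k (u j)) (x + s • y) =
        ∫ y, lap Ψ y * pd k (lap (u j)) (x + s • y) := by
      refine integral_congr_ae (ae_of_all _ fun y => ?_)
      by_cases hy : y ∈ tsupport (lap Ψ)
      · simp only
        rw [pd_lap (hsm _ (add_smul_mem_ball hs' (hls hy)))]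
      · simp [image_eq_zero_of_notMem_tsupport hy]
    have e1 : ∀ y, pd k (lap Ψ) y = lap (pd k Ψ) y := fun y => pd_lap hk.smooth.contDiffAt k
    rw [e0, scaled_ibp hk.smooth.lap hls (fun y hy => (hsm y hy).lap) hs']
    simp_rw [e1]
    rw [h.scaled_integral_lap hB (hk.smooth.pd k) hΦs hs.ne' hs', abs_neg]
    have b1 := abs_scaled_integral_le (hk.smooth.pd k).lap.continuous
      ((tsupport_lap _).trans hΦs) hs' (hadv j)
    have b2 : |∑ i, ∫ y, pd j (pd i (pd k Ψ)) y * adv u (u i) (x + s • y)| ≤ A₃ * (U * N) := by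
      refine (Finset.abs_sum_le_sum_abs _ _).trans ?_
      calc ∑ i, |∫ y, pd j (pd i (pd k Ψ)) y * adv u (u i) (x + s • y)|
          ≤ ∑ i, (∫ y, |pd j (pd i (pd k Ψ)) y|) * (U * N) :=
            Finset.sum_le_sum fun i _ => abs_scaled_integral_le
              (((hk.smooth.pd k).pd i).pd j).continuous
              ((tsupport_pd _ j).trans ((tsupport_pd _ i).trans hΦs)) hs' (hadv i)
        _ = (∑ i, ∫ y, |pd j (pd i (pd k Ψ)) y|) * (U * N) := by rw [Finset.sum_mul]
        _ ≤ _ := by gcongr; exact h3 k j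
    have b3 : (∫ y, |lap (pd k Ψ) y|) * (U * N) ≤ A₂ * (U * N) := by gcongr; exact h2 k
    refine (abs_sub _ _).trans ?_
    linarith

lemma exists_gradSum_le (hn : 0 < n) : ∃ A : ℝ, 0 ≤ A ∧
    ∀ (u : Fin n → E n → ℝ) (p : E n → ℝ) (Ω : Set (E n)) (x : E n) (R U : ℝ),
      IsSol u p Ω → closedBall x R ⊆ Ω → 0 < R → 0 < U →
      (∀ y ∈ closedBall x R, ∀ j, |u j y| ≤ U) →
      gradSum u x ≤ A * (U / R + U ^ 2) := by
  obtain ⟨Ψ, η, hk⟩ := exists_kernel hn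
  obtain ⟨A₀, hA₀, hloc⟩ := hk.exists_abs_pd_le
  set A := n * n * A₀ + 1
  have hA : 0 < A := by positivity
  refine ⟨4 * A + 16 * A ^ 2, by positivity, fun u p Ω x R U h hB hR hU hbu => ?_⟩
  have hcont : ContinuousOn (fun y => (R - dist y x) * gradSum u y) (closedBall x R) :=
    (by fun_prop : Continuous fun y => R - dist y x).continuousOn.mul
      (h.continuousOn_gradSum.mono hB)
  obtain ⟨x₁, hx₁, hmax⟩ := (isCompact_closedBall x R).exists_isMaxOn
    (nonempty_closedBall.2 hR.le) hcont
  have hmax' : ∀ y ∈ closedBall x R, (R - dist y x) * gradSum u y ≤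
      (R - dist x₁ x) * gradSum u x₁ := fun y hy => hmax hy
  have hx0 := hmax' x (mem_closedBall_self hR.le)
  rw [dist_self, sub_zero] at hx0
  set d := R - dist x₁ x with hd
  have hd0 : 0 ≤ d := by have := mem_closedBall.1 hx₁; linarith
  have hdR : d ≤ R := by have := dist_nonneg (x := x₁) (y := x); linarith
  rcases hd0.eq_or_lt with hd0 | hdpos
  · rw [← hd0, zero_mul] at hx0
    have : gradSum u x ≤ 0 := by
      by_contra hc
      push Not at hc
      nlinarith
    exact this.trans (by positivity)
  set N := 2 * gradSum u x₁
  have hsub : ∀ y ∈ ball x₁ (d / 2), y ∈ closedBall x R ∧ d / 2 ≤ R - dist y x := by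
    intro y hy
    have h1 := mem_ball.1 hy
    have h2 := dist_triangle y x₁ x
    exact ⟨mem_closedBall.2 (by linarith), by linarith⟩
  have hbN : ∀ y ∈ ball x₁ (d / 2), gradSum u y ≤ N := by
    intro y hy
    obtain ⟨h1, h2⟩ := hsub y hy
    have h3 := hmax' y h1
    have h4 := mul_le_mul_of_nonneg_right h2 (gradSum_nonneg u y)
    show gradSum u y ≤ 2 * gradSum u x₁
    have : d / 2 * gradSum u y ≤ d / 2 * (2 * gradSum u x₁) := by linarith
    exact le_of_mul_le_mul_left this (by linarith)
  have hN0 : 0 ≤ N := mul_nonneg zero_le_two (gradSum_nonneg _ _)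
  set ρ := 1 / (4 / d + 4 * A * U)
  have hρ0 : 0 < ρ := by positivity
  have hρd : ρ < d / 2 := by
    rw [div_lt_iff₀ (by positivity)]
    have : d / 2 * (4 / d) = 2 := by field_simp; norm_num
    have : 0 ≤ d / 2 * (4 * A * U) := by positivity
    nlinarith
  have hρU : A * ρ * U ≤ 1 / 4 := by
    show A * (1 / (4 / d + 4 * A * U)) * U ≤ 1 / 4
    rw [mul_one_div, div_mul_eq_mul_div, div_le_iff₀ (by positivity)]
    have : 0 ≤ 4 / d := by positivity
    linarith
  have hpt := hloc u p Ω x₁ (d / 2) U N ρ h (fun y hy => hB (hsub y hy).1) hρ0 hρd hU.le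
    (fun y hy => hbu y (hsub y hy).1) hbN
  have hsum : gradSum u x₁ ≤ A * (U / ρ + ρ * U * N) := by
    calc gradSum u x₁ ≤ ∑ j : Fin n, ∑ i : Fin n, A₀ * (U / ρ + ρ * U * N) :=
          Finset.sum_le_sum fun j _ => Finset.sum_le_sum fun i _ => hpt i j
      _ = (n * n * A₀) * (U / ρ + ρ * U * N) := by simp; ring
      _ ≤ A * (U / ρ + ρ * U * N) := by gcongr; simp [A]
  have hg : gradSum u x₁ ≤ 2 * A * (U / ρ) := by
    have : A * (ρ * U * N) ≤ 1 / 4 * N := by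
      have := mul_le_mul_of_nonneg_right hρU hN0
      linarith
    have e : N = 2 * gradSum u x₁ := rfl
    linarith
  have hUρ : U / ρ = U * (4 / d + 4 * A * U) := by simp [ρ]
  rw [hUρ] at hg
  have h5 : R * gradSum u x ≤ 8 * A * U + 8 * A ^ 2 * U ^ 2 * R := by
    calc R * gradSum u x ≤ d * gradSum u x₁ := hx0
      _ ≤ d * (2 * A * (U * (4 / d + 4 * A * U))) := by gcongr
      _ = 8 * A * U + 8 * A ^ 2 * U ^ 2 * d := by field_simp; ring
      _ ≤ _ := by gcongr
  have hA1 : 1 ≤ A := by simp only [A]; nlinarith [mul_nonneg (mul_self_nonneg (n : ℝ)) hA₀]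
  have h6 : gradSum u x ≤ 8 * A * (U / R) + 8 * A ^ 2 * U ^ 2 := by
    have : 8 * A * (U / R) + 8 * A ^ 2 * U ^ 2 = (8 * A * U + 8 * A ^ 2 * U ^ 2 * R) / R := by
      field_simp
    rw [this, le_div_iff₀ hR]; linarith
  refine h6.trans ?_
  have : 0 ≤ U / R := by positivity
  nlinarith [mul_nonneg this hA.le, sq_nonneg A, sq_nonneg U, mul_nonneg hA.le (sq_nonneg U),
    mul_nonneg this (sq_nonneg A), mul_le_mul_of_nonneg_right hA1 hA.le,
    mul_nonneg (sub_nonneg.2 hA1) (mul_nonneg hA.le this), mul_nonneg (sq_nonneg A) (sq_nonneg U)]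

lemma IsKernel.exists_abs_pd_p_le {Ψ η : E n → ℝ} (hk : IsKernel Ψ η) : ∃ A : ℝ, 0 ≤ A ∧
    ∀ (u : Fin n → E n → ℝ) (p : E n → ℝ) (Ω : Set (E n)) (x : E n) (R U N ρ : ℝ),
      IsSol u p Ω → ball x R ⊆ Ω → 0 < ρ → ρ < R → 0 ≤ U →
      (∀ y ∈ ball x R, ∀ j, |u j y| ≤ U) → (∀ y ∈ ball x R, gradSum u y ≤ N) →
      ∀ k, |pd k p x| ≤ A * (U / ρ ^ 2 + U * N + N ^ 2 * ρ) := by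
  set A₁ := ∫ y, |lap η y|
  set A₂ := ∫ y, |η y|
  set A₃ := ∑ k, ∫ y, |pd k (lap Ψ) y|
  have h3 : ∀ k, ∫ y, |pd k (lap Ψ) y| ≤ A₃ := fun k => Finset.single_le_sum
    (f := fun k => ∫ y, |pd k (lap Ψ) y|) (fun k _ => by positivity) (Finset.mem_univ k)
  have p1 : 0 ≤ A₁ := by positivity
  have p2 : 0 ≤ A₂ := by positivity
  have p3 : 0 ≤ A₃ := by positivity
  refine ⟨A₁ + A₂ + A₃, by positivity, fun u p Ω x R U N ρ h hB hρ hρR hU hbu hbN k => ?_⟩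
  have hN : 0 ≤ N := (gradSum_nonneg u x).trans (hbN x (mem_ball_self (hρ.trans hρR)))
  have hsp : ∀ y ∈ ball x R, ContDiffAt ℝ ∞ p y := fun y hy => h.smooth_p y (hB hy)
  have hsm : ∀ y ∈ ball x R, ContDiffAt ℝ ∞ (u k) y := fun y hy => h.smooth y (hB hy) k
  have habs : |ρ| < R := by rwa [abs_of_pos hρ]
  have hls : tsupport (lap Ψ) ⊆ closedBall 0 1 := (tsupport_lap Ψ).trans hk.supp
  have key := hk.abs_le_abs_mean_add (g := pd k p) (fun y hy => (hsp y hy).pd k) hρ hρR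
    (K := A₃ * N ^ 2) ?_
  · have e0 : ∫ y, η y * pd k p (x + ρ • y) =
        (∫ y, η y * lap (u k) (x + ρ • y)) - ∫ y, η y * adv u (u k) (x + ρ • y) := by
      rw [← integral_sub (scaled_integrable hk.smooth_mean.continuous hk.supp_mean
        (fun y hy => (hsm y hy).lap) habs) (scaled_integrable hk.smooth_mean.continuous
        hk.supp_mean (fun y hy => h.smooth_adv (hB hy) (hsm y hy)) habs)]
      refine integral_congr_ae (ae_of_all _ fun y => ?_)
      by_cases hy : y ∈ tsupport η
      · simp only
        rw [h.pd_p (hB (add_smul_mem_ball habs (hk.supp_mean hy)))]; ring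
      · simp [image_eq_zero_of_notMem_tsupport hy]
    have e1 := scaled_green hk.smooth_mean hk.supp_mean hsm habs
    have e2 := abs_scaled_integral_le hk.smooth_mean.lap.continuous
      ((tsupport_lap _).trans hk.supp_mean) habs (fun y hy => hbu y hy k)
    have e3 : |∫ y, η y * lap (u k) (x + ρ • y)| ≤ A₁ * (U / ρ ^ 2) := by
      have hρ2 : 0 < ρ ^ 2 := by positivity
      have : ρ ^ 2 * |∫ y, η y * lap (u k) (x + ρ • y)| ≤ A₁ * U := by
        rwa [← e1, abs_mul, abs_of_pos hρ2] at e2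
      rw [← mul_div_assoc, le_div_iff₀ hρ2]; linarith
    have e4 : |∫ y, η y * adv u (u k) (x + ρ • y)| ≤ A₂ * (U * N) :=
      abs_scaled_integral_le hk.smooth_mean.continuous hk.supp_mean habs
        fun y hy => abs_adv_le (hbu y hy) (hbN y hy) hU k
    have e5 := abs_sub (∫ y, η y * lap (u k) (x + ρ • y)) (∫ y, η y * adv u (u k) (x + ρ • y))
    rw [← e0] at e5
    calc |pd k p x| ≤ A₁ * (U / ρ ^ 2) + A₂ * (U * N) + A₃ * N ^ 2 * ρ := by linarith
      _ ≤ (A₁ + A₂ + A₃) * (U / ρ ^ 2) + (A₁ + A₂ + A₃) * (U * N) +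
          (A₁ + A₂ + A₃) * N ^ 2 * ρ := by gcongr <;> linarith
      _ = _ := by ring
  · intro s hs hsρ
    have hs' : |s| < R := by rw [abs_of_pos hs]; linarith
    have e0 : ∫ y, lap Ψ y * lap (pd k p) (x + s • y) =
        ∫ y, lap Ψ y * pd k (lap p) (x + s • y) := by
      refine integral_congr_ae (ae_of_all _ fun y => ?_)
      by_cases hy : y ∈ tsupport (lap Ψ)
      · simp only
        rw [pd_lap (hsp _ (add_smul_mem_ball hs' (hls hy)))]
      · simp [image_eq_zero_of_notMem_tsupport hy]
    rw [e0, scaled_ibp hk.smooth.lap hls (fun y hy => (hsp y hy).lap) hs', abs_neg]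
    refine (abs_scaled_integral_le (hk.smooth.lap.pd k).continuous
      ((tsupport_pd _ k).trans hls) hs' (K := N ^ 2) fun y hy => ?_).trans ?_
    · refine (h.abs_lap_p_le (hB hy)).trans ?_
      have := hbN y hy
      have := gradSum_nonneg u y
      gcongr
    · gcongr; exact h3 k

section Decay

variable {u : Fin n → E n → ℝ} {p : E n → ℝ} {C K : ℝ}

lemma half_norm_lt_of_mem_closedBall {x y : E n} (hx : x ≠ 0) (hy : y ∈ closedBall x (‖x‖ / 2)) :
    y ≠ 0 ∧ ‖x‖ / 2 ≤ ‖y‖ := by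
  have hx' := norm_pos_iff.2 hx
  have h1 : ‖y - x‖ ≤ ‖x‖ / 2 := mem_closedBall_iff_norm.1 hy
  have h2 : ‖x‖ ≤ ‖y‖ + ‖y - x‖ := by
    simpa [norm_sub_rev] using norm_add_le y (x - y)
  exact ⟨norm_pos_iff.1 (by linarith), by linarith⟩

lemma IsSol.exists_gradSum_decay (hn : 0 < n) (h : IsSol u p {x | x ≠ 0}) (hC : 0 < C)
    (hb : ∀ x, x ≠ 0 → ∀ j, |u j x| ≤ C / ‖x‖) :
    ∃ K : ℝ, 0 ≤ K ∧ ∀ x, x ≠ 0 → gradSum u x ≤ K / ‖x‖ ^ 2 := by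
  obtain ⟨A, hA, hgrad⟩ := exists_gradSum_le hn
  refine ⟨A * (4 * C + 4 * C ^ 2), by positivity, fun x hx => ?_⟩
  have hr := norm_pos_iff.2 hx
  refine (hgrad u p _ x (‖x‖ / 2) (2 * C / ‖x‖) h
    (fun y hy => (half_norm_lt_of_mem_closedBall hx hy).1) (by positivity) (by positivity)
    fun y hy j => ?_).trans_eq (by field_simp; ring)
  obtain ⟨hy0, hy1⟩ := half_norm_lt_of_mem_closedBall hx hy
  refine (hb y hy0 j).trans ?_
  rw [div_le_div_iff₀ (norm_pos_iff.2 hy0) hr]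
  nlinarith

lemma IsSol.exists_pd_p_decay (hn : 0 < n) (h : IsSol u p {x | x ≠ 0}) (hC : 0 < C)
    (hb : ∀ x, x ≠ 0 → ∀ j, |u j x| ≤ C / ‖x‖) :
    ∃ K : ℝ, 0 ≤ K ∧ ∀ x, x ≠ 0 → ∀ k, |pd k p x| ≤ K / ‖x‖ ^ 3 := by
  obtain ⟨K, hK, hgrad⟩ := h.exists_gradSum_decay hn hC hb
  obtain ⟨Ψ, η, hk⟩ := exists_kernel hn
  obtain ⟨A, hA, hloc⟩ := hk.exists_abs_pd_p_le
  refine ⟨A * (32 * C + 8 * C * K + 4 * K ^ 2), by positivity, fun x hx k => ?_⟩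
  have hr := norm_pos_iff.2 hx
  refine (hloc u p _ x (‖x‖ / 2) (2 * C / ‖x‖) (4 * K / ‖x‖ ^ 2) (‖x‖ / 4) h
    (fun y hy => (half_norm_lt_of_mem_closedBall hx (ball_subset_closedBall hy)).1)
    (by positivity) (by linarith) (by positivity) (fun y hy j => ?_) (fun y hy => ?_) k).trans_eq
    (by field_simp; ring)
  · obtain ⟨hy0, hy1⟩ := half_norm_lt_of_mem_closedBall hx (ball_subset_closedBall hy)
    refine (hb y hy0 j).trans ?_
    rw [div_le_div_iff₀ (norm_pos_iff.2 hy0) hr]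
    nlinarith
  · obtain ⟨hy0, hy1⟩ := half_norm_lt_of_mem_closedBall hx (ball_subset_closedBall hy)
    have hy' := norm_pos_iff.2 hy0
    refine (hgrad y hy0).trans ?_
    rw [div_le_div_iff₀ (by positivity) (by positivity)]
    have : ‖x‖ ^ 2 ≤ 4 * ‖y‖ ^ 2 := by nlinarith
    nlinarith

lemma IsSol.sub_const {Ω : Set (E n)} (h : IsSol u p Ω) (c : ℝ) :
    IsSol u (fun x => p x - c) Ω where
  isOpen := h.isOpen
  smooth := h.smooth
  smooth_p x hx := (h.smooth_p x hx).sub contDiffAt_const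
  momentum x hx j := by
    rw [pd_sub (h.smooth_p x hx) contDiffAt_const, pd_const, sub_zero]
    exact h.momentum x hx j
  div := h.div

lemma norm_fderiv_le (f : E n → ℝ) (x : E n) : ‖fderiv ℝ f x‖ ≤ ∑ i, |pd i f x| :=
  ContinuousLinearMap.opNorm_le_bound _ (by positivity) fun v => by
    rw [Real.norm_eq_abs, mul_comm]; exact abs_fderiv_le f x v

lemma norm_fderiv_le_of_decay (hK : ∀ x, x ≠ 0 → ∀ k, |pd k p x| ≤ K / ‖x‖ ^ 3) {x : E n}
    (hx : x ≠ 0) : ‖fderiv ℝ p x‖ ≤ n * K / ‖x‖ ^ 3 := by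
  refine (norm_fderiv_le p x).trans ((Finset.sum_le_sum fun i _ => hK x hx i).trans_eq ?_)
  simp; ring

lemma exists_tendsto_along_ray (hp : ∀ x, x ≠ 0 → ContDiffAt ℝ ∞ p x)
    (hK : ∀ x, x ≠ 0 → ∀ k, |pd k p x| ≤ K / ‖x‖ ^ 3) {x : E n} (hx : x ≠ 0) :
    ∃ l : ℝ, Tendsto (fun t => p (Real.exp t • x)) atTop (𝓝 l) ∧
      |p x - l| ≤ n * K / ‖x‖ ^ 2 := by
  have hr := norm_pos_iff.2 hx
  have hK0 : 0 ≤ n * K := by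
    have := (norm_nonneg _).trans (norm_fderiv_le_of_decay hK hx)
    by_contra hc
    push Not at hc
    exact absurd (div_neg_of_neg_of_pos hc (by positivity : 0 < ‖x‖ ^ 3)) (by linarith)
  set κ := n * K / ‖x‖ ^ 2
  have hκ : 0 ≤ κ := by positivity
  have hne : ∀ t, Real.exp t • x ≠ 0 := fun t => smul_ne_zero (Real.exp_pos t).ne' hx
  have hd : ∀ t, HasDerivAt (fun t => p (Real.exp t • x))
      (fderiv ℝ p (Real.exp t • x) (Real.exp t • x)) t := fun t =>
    ((diffAt (hp _ (hne t))).hasFDerivAt).comp_hasDerivAt t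
      ((Real.hasDerivAt_exp t).smul_const x)
  have he : ∀ t, HasDerivAt (fun t => κ * Real.exp (-2 * t)) (-(2 * κ * Real.exp (-2 * t))) t :=
    fun t => ((((hasDerivAt_id' t).const_mul (-2)).exp).const_mul κ).congr_deriv (by ring)
  have hbd : ∀ t, |fderiv ℝ p (Real.exp t • x) (Real.exp t • x)| ≤ 2 * κ * Real.exp (-2 * t) := by
    intro t
    refine (((fderiv ℝ p _).le_opNorm _).trans
      (mul_le_mul_of_nonneg_right (norm_fderiv_le_of_decay hK (hne t)) (norm_nonneg _))).trans ?_
    have e1 : n * K / ‖Real.exp t • x‖ ^ 3 * ‖Real.exp t • x‖ = κ * Real.exp (-2 * t) := by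
      rw [norm_smul, Real.norm_eq_abs, Real.abs_exp, show -2 * t = -(t + t) by ring, Real.exp_neg,
        Real.exp_add]
      have := Real.exp_pos t
      simp only [κ]
      field_simp
    rw [e1]
    nlinarith [mul_nonneg hκ (Real.exp_pos (-2 * t)).le]
  set f₁ : ℝ → ℝ := fun t => p (Real.exp t • x) - κ * Real.exp (-2 * t)
  set f₂ : ℝ → ℝ := fun t => p (Real.exp t • x) + κ * Real.exp (-2 * t)
  have hd₁ : ∀ t, HasDerivAt f₁ _ t := fun t => (hd t).sub (he t)
  have hd₂ : ∀ t, HasDerivAt f₂ _ t := fun t => (hd t).add (he t)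
  have hm₁ : Monotone f₁ := monotone_of_deriv_nonneg (fun t => (hd₁ t).differentiableAt)
    fun t => by
      rw [(hd₁ t).deriv]; have := abs_le.1 (hbd t); linarith
  have hm₂ : Antitone f₂ := antitone_of_deriv_nonpos (fun t => (hd₂ t).differentiableAt)
    fun t => by
      rw [(hd₂ t).deriv]; have := abs_le.1 (hbd t); linarith
  have hle : ∀ t, f₁ t ≤ f₂ t := fun t => by
    have : 0 ≤ κ * Real.exp (-2 * t) := mul_nonneg hκ (Real.exp_pos _).le
    simp only [f₁, f₂]; linarith
  have hbdd : BddAbove (range f₁) := ⟨f₂ 0, by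
    rintro _ ⟨t, rfl⟩
    exact (hm₁ (le_max_left t 0)).trans ((hle _).trans (hm₂ (le_max_right t 0)))⟩
  have hl := tendsto_atTop_ciSup hm₁ hbdd
  have hexp : Tendsto (fun t => κ * Real.exp (-2 * t)) atTop (𝓝 0) := by
    have : Tendsto (fun t : ℝ => -2 * t) atTop atBot :=
      tendsto_id.const_mul_atTop_of_neg (by norm_num)
    simpa using (Real.tendsto_exp_atBot.comp this).const_mul κ
  have hlim : Tendsto (fun t => p (Real.exp t • x)) atTop (𝓝 (⨆ t, f₁ t)) := by
    simpa [f₁] using hl.add hexp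
  refine ⟨_, hlim, ?_⟩
  have hl₂ : Tendsto f₂ atTop (𝓝 (⨆ t, f₁ t)) := by simpa [f₂] using hlim.add hexp
  have h1 := hm₁.ge_of_tendsto hl 0
  have h2 := hm₂.le_of_tendsto hl₂ 0
  simp only [f₁, f₂, Real.exp_zero, one_smul, mul_zero, mul_one] at h1 h2
  exact abs_le.2 ⟨by linarith, by linarith⟩

lemma tendsto_sub_along_rays (hp : ∀ x, x ≠ 0 → ContDiffAt ℝ ∞ p x) (hK0 : 0 ≤ K)
    (hK : ∀ x, x ≠ 0 → ∀ k, |pd k p x| ≤ K / ‖x‖ ^ 3) {x z : E n} (hx : x ≠ 0)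
    (hz : z ∈ closedBall x (‖x‖ / 2)) :
    Tendsto (fun t => p (Real.exp t • z) - p (Real.exp t • x)) atTop (𝓝 0) := by
  have hr := norm_pos_iff.2 hx
  refine squeeze_zero_norm (a := fun t => 4 * n * K / ‖x‖ ^ 2 * Real.exp (-2 * t)) (fun t => ?_) ?_
  · have ht := Real.exp_pos t
    have hne : Real.exp t • x ≠ 0 := smul_ne_zero ht.ne' hx
    have hnorm : ‖Real.exp t • x‖ = Real.exp t * ‖x‖ := by
      rw [norm_smul, Real.norm_eq_abs, Real.abs_exp]
    have hzt : Real.exp t • z ∈ closedBall (Real.exp t • x) (‖Real.exp t • x‖ / 2) := by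
      rw [mem_closedBall_iff_norm, ← smul_sub, norm_smul, hnorm, Real.norm_eq_abs, Real.abs_exp]
      have := mem_closedBall_iff_norm.1 hz
      nlinarith
    have key := (convex_closedBall (Real.exp t • x)
      (‖Real.exp t • x‖ / 2)).norm_image_sub_le_of_norm_fderiv_le
      (f := p) (𝕜 := ℝ) (C := n * K / (‖Real.exp t • x‖ / 2) ^ 3)
      (fun y hy => diffAt (hp y (half_norm_lt_of_mem_closedBall hne hy).1)) (fun y hy => by
        obtain ⟨hy0, hy1⟩ := half_norm_lt_of_mem_closedBall hne hy
        have := norm_pos_iff.2 hne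
        refine (norm_fderiv_le_of_decay hK hy0).trans ?_
        gcongr)
      (mem_closedBall_self (by positivity)) hzt
    refine key.trans ?_
    have h1 := mem_closedBall_iff_norm.1 hzt
    calc _ ≤ n * K / (‖Real.exp t • x‖ / 2) ^ 3 * (‖Real.exp t • x‖ / 2) := by gcongr
      _ = _ := by
        rw [hnorm, show -2 * t = -(t + t) by ring, Real.exp_neg, Real.exp_add]
        field_simp
        ring
  · have : Tendsto (fun t : ℝ => -2 * t) atTop atBot :=
      tendsto_id.const_mul_atTop_of_neg (by norm_num)
    simpa using (Real.tendsto_exp_atBot.comp this).const_mul (4 * n * K / ‖x‖ ^ 2)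

lemma isPreconnected_ne_zero (hn : 2 ≤ n) : IsPreconnected {x : E n | x ≠ 0} := by
  refine (isConnected_compl_singleton_of_one_lt_rank ?_ 0).isPreconnected
  rw [← Module.finrank_eq_rank, finrank_euclideanSpace, Fintype.card_fin]
  exact_mod_cast hn

lemma isOpen_ne_zero : IsOpen {x : E n | x ≠ 0} := isOpen_compl_singleton

lemma exists_pressure_const (hn : 2 ≤ n) (hp : ∀ x, x ≠ 0 → ContDiffAt ℝ ∞ p x) (hK0 : 0 ≤ K)
    (hK : ∀ x, x ≠ 0 → ∀ k, |pd k p x| ≤ K / ‖x‖ ^ 3) :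
    ∃ l : ℝ, ∀ x, x ≠ 0 → |p x - l| ≤ n * K / ‖x‖ ^ 2 := by
  have hex : ∀ x : E n, ∃ l : ℝ, x ≠ 0 → Tendsto (fun t => p (Real.exp t • x)) atTop (𝓝 l) ∧
      |p x - l| ≤ n * K / ‖x‖ ^ 2 := fun x => by
    by_cases hx : x = 0
    · exact ⟨0, fun h => absurd hx h⟩
    · obtain ⟨l, hl⟩ := exists_tendsto_along_ray hp hK hx
      exact ⟨l, fun _ => hl⟩
  choose l hl using hex
  have hloc : ∀ x, x ≠ 0 → l =ᶠ[𝓝 x] fun _ => l x := fun x hx => by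
    have hr := norm_pos_iff.2 hx
    filter_upwards [closedBall_mem_nhds x (by positivity : 0 < ‖x‖ / 2)] with z hz
    have hz0 := (half_norm_lt_of_mem_closedBall hx hz).1
    have := (tendsto_sub_along_rays hp hK0 hK hx hz).add (hl x hx).1
    simp only [sub_add_cancel, zero_add] at this
    exact tendsto_nhds_unique (hl z hz0).1 this
  have hd : ∀ x, x ≠ 0 → HasFDerivAt l (0 : E n →L[ℝ] ℝ) x := fun x hx =>
    (hasFDerivAt_const (l x) x).congr_of_eventuallyEq (hloc x hx)
  obtain ⟨c, hc⟩ := isOpen_ne_zero.exists_is_const_of_fderiv_eq_zero (isPreconnected_ne_zero hn)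
    (fun x hx => (hd x hx).differentiableAt.differentiableWithinAt) fun x hx => (hd x hx).fderiv
  exact ⟨c, fun x hx => by rw [← hc x hx]; exact (hl x hx).2⟩

/-- The pressure can be normalised so as to decay quadratically. -/
lemma IsSol.exists_normalised_pressure (hn : 2 ≤ n) (h : IsSol u p {x | x ≠ 0}) (hC : 0 < C)
    (hb : ∀ x, x ≠ 0 → ∀ j, |u j x| ≤ C / ‖x‖) :
    ∃ (q : E n → ℝ) (K : ℝ), 0 ≤ K ∧ IsSol u q {x | x ≠ 0} ∧ ∀ x, x ≠ 0 → |q x| ≤ K / ‖x‖ ^ 2 := by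
  obtain ⟨K, hK0, hK⟩ := h.exists_pd_p_decay (by lia) hC hb
  obtain ⟨l, hl⟩ := exists_pressure_const hn h.smooth_p hK0 hK
  exact ⟨_, n * K, by positivity, h.sub_const l, hl⟩

end Decay

section Cutoff

/-- The two intervals in which the cutoff at scale `M` varies. -/
def transition (M : ℝ) : Set ℝ := Icc (M⁻¹ / 2) M⁻¹ ∪ Icc M (2 * M)

/-- A cutoff equal to one on `[M⁻¹, M]`, with scale invariant derivative bounds. -/
structure IsCutoff (K M : ℝ) (c : ℝ → ℝ) : Prop where
  smooth : ContDiff ℝ ∞ c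
  nonneg : ∀ q, 0 ≤ c q
  le_one : ∀ q, c q ≤ 1
  eq_one : ∀ q, M⁻¹ ≤ q → q ≤ M → c q = 1
  eq_zero_of_le : ∀ q, q ≤ M⁻¹ / 2 → c q = 0
  eq_zero_of_ge : ∀ q, 2 * M ≤ q → c q = 0
  deriv_le : ∀ q, 0 < q → |q * deriv c q| ≤ K
  deriv_deriv_le : ∀ q, 0 < q → |q ^ 2 * deriv (deriv c) q| ≤ K

lemma exists_abs_le_of_eq_zero {f : ℝ → ℝ} (hf : Continuous f) (h0 : ∀ x, x < 0 → f x = 0)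
    (h1 : ∀ x, 1 < x → f x = 0) : ∃ B : ℝ, 0 ≤ B ∧ ∀ x, |f x| ≤ B := by
  obtain ⟨B, hB⟩ := (isCompact_Icc (a := (0 : ℝ)) (b := 1)).exists_bound_of_continuousOn
    hf.continuousOn
  refine ⟨B, (norm_nonneg _).trans (hB 0 (by simp)), fun x => ?_⟩
  by_cases hx : x ∈ Icc (0 : ℝ) 1
  · exact hB x hx
  · have hB0 : 0 ≤ B := (norm_nonneg _).trans (hB 0 (by simp))
    rw [mem_Icc, not_and_or, not_le, not_le] at hx
    rcases hx with hx | hx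
    · rw [h0 x hx, abs_zero]; exact hB0
    · rw [h1 x hx, abs_zero]; exact hB0

lemma deriv_eq_zero_of_isOpen {f : ℝ → ℝ} {s : Set ℝ} (hs : IsOpen s) {a : ℝ}
    (h : ∀ x ∈ s, f x = a) : ∀ x ∈ s, deriv f x = 0 := fun x hx => by
  have : f =ᶠ[𝓝 x] fun _ => a := by filter_upwards [hs.mem_nhds hx] with y hy using h y hy
  rw [this.deriv_eq, deriv_const]

lemma deriv_comp_affine {f : ℝ → ℝ} (hf : Differentiable ℝ f) (a b x : ℝ) :
    deriv (fun q => f (a * q + b)) x = a * deriv f (a * x + b) := by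
  have h : HasDerivAt (fun q => a * q + b) a x := by
    simpa using ((hasDerivAt_id x).const_mul a).add_const b
  simpa [mul_comm, Function.comp_def] using ((hf _).hasDerivAt.comp x h).deriv

lemma deriv_deriv_comp_affine {f : ℝ → ℝ} (hf : ContDiff ℝ ∞ f) (a b x : ℝ) :
    deriv (deriv (fun q => f (a * q + b))) x = a ^ 2 * deriv (deriv f) (a * x + b) := by
  have h : deriv (fun q => f (a * q + b)) = fun q => a * deriv f (a * q + b) :=
    funext fun q => deriv_comp_affine (hf.differentiable (by simp)) a b q
  rw [h, deriv_const_mul_field, deriv_comp_affine ((contDiff_deriv hf).differentiable (by simp))]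
  ring

lemma deriv_deriv_mul {f g : ℝ → ℝ} (hf : ContDiff ℝ ∞ f) (hg : ContDiff ℝ ∞ g) (x : ℝ) :
    deriv (deriv (fun q => f q * g q)) x =
      deriv (deriv f) x * g x + 2 * (deriv f x * deriv g x) + f x * deriv (deriv g) x := by
  have hf0 := hf.differentiable (by simp)
  have hg0 := hg.differentiable (by simp)
  have hf1 := (contDiff_deriv hf).differentiable (by simp)
  have hg1 := (contDiff_deriv hg).differentiable (by simp)
  have h : deriv (fun q => f q * g q) = fun q => deriv f q * g q + f q * deriv g q :=
    funext fun q => deriv_fun_mul (hf0 q) (hg0 q)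
  rw [h, (((hf1 x).hasDerivAt.fun_mul (hg0 x).hasDerivAt).fun_add
    ((hf0 x).hasDerivAt.fun_mul (hg1 x).hasDerivAt)).deriv]
  ring

lemma exists_isCutoff : ∃ K : ℝ, 0 ≤ K ∧ ∀ M, 1 ≤ M → ∃ c, IsCutoff K M c := by
  set τ := Real.smoothTransition
  have hτ : ContDiff ℝ ∞ τ := Real.smoothTransition.contDiff
  have z0 := deriv_eq_zero_of_isOpen isOpen_Iio (f := τ) (a := 0)
    fun x (hx : x < 0) => Real.smoothTransition.zero_of_nonpos hx.le
  have z1 := deriv_eq_zero_of_isOpen isOpen_Ioi (f := τ) (a := 1)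
    fun x (hx : 1 < x) => Real.smoothTransition.one_of_one_le hx.le
  have y0 := deriv_eq_zero_of_isOpen isOpen_Iio z0
  have y1 := deriv_eq_zero_of_isOpen isOpen_Ioi z1
  obtain ⟨B₁, hB₁, h1⟩ := exists_abs_le_of_eq_zero (contDiff_deriv hτ).continuous z0 z1
  obtain ⟨B₂, hB₂, h2⟩ := exists_abs_le_of_eq_zero (contDiff_deriv (contDiff_deriv hτ)).continuous
    y0 y1
  refine ⟨4 * B₁ + 8 * B₂ + 8 * B₁ ^ 2, by positivity, fun M hM => ?_⟩
  have hM0 : 0 < M := by linarith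
  have hMi : M⁻¹ ≤ 1 := inv_le_one_of_one_le₀ hM
  set f : ℝ → ℝ := fun q => τ (2 * M * q + -1)
  set g : ℝ → ℝ := fun q => τ (-M⁻¹ * q + 2)
  have hf : ContDiff ℝ ∞ f := hτ.comp (by fun_prop)
  have hg : ContDiff ℝ ∞ g := hτ.comp (by fun_prop)
  have hf0 : ∀ q, 0 ≤ f q := fun q => Real.smoothTransition.nonneg _
  have hg0 : ∀ q, 0 ≤ g q := fun q => Real.smoothTransition.nonneg _
  have hf1 : ∀ q, f q ≤ 1 := fun q => Real.smoothTransition.le_one _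
  have hg1 : ∀ q, g q ≤ 1 := fun q => Real.smoothTransition.le_one _
  have bound : ∀ {F : ℝ → ℝ} {B a b q : ℝ} (k : ℕ), 0 ≤ B → (∀ x, |F x| ≤ B) →
      (F (a * q + b) ≠ 0 → |q * a| ≤ 2) → |q ^ k * (a ^ k * F (a * q + b))| ≤ 2 ^ k * B := by
    intro F B a b q k hB hF h
    by_cases hz : F (a * q + b) = 0
    · rw [hz]; simp; positivity
    · rw [← mul_assoc, ← mul_pow, abs_mul, abs_pow]
      gcongr
      · exact h hz
      · exact hF _
  have sf : ∀ {F : ℝ → ℝ} {q : ℝ}, (∀ x, 1 < x → F x = 0) → 0 < q →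
      F (2 * M * q + -1) ≠ 0 → |q * (2 * M)| ≤ 2 := by
    intro F q hF hq h
    rw [abs_of_pos (by positivity)]
    by_contra hc
    exact h (hF _ (by linarith))
  have sg : ∀ {F : ℝ → ℝ} {q : ℝ}, (∀ x, x < 0 → F x = 0) → 0 < q →
      F (-M⁻¹ * q + 2) ≠ 0 → |q * (-M⁻¹)| ≤ 2 := by
    intro F q hF hq h
    rw [mul_neg, abs_neg, abs_of_pos (by positivity)]
    by_contra hc
    exact h (hF _ (by linarith))
  have df : ∀ q, deriv f q = 2 * M * deriv τ (2 * M * q + -1) :=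
    deriv_comp_affine (hτ.differentiable (by simp)) _ _
  have dg : ∀ q, deriv g q = -M⁻¹ * deriv τ (-M⁻¹ * q + 2) :=
    deriv_comp_affine (hτ.differentiable (by simp)) _ _
  have ddf : ∀ q, deriv (deriv f) q = (2 * M) ^ 2 * deriv (deriv τ) (2 * M * q + -1) :=
    deriv_deriv_comp_affine hτ _ _
  have ddg : ∀ q, deriv (deriv g) q = (-M⁻¹) ^ 2 * deriv (deriv τ) (-M⁻¹ * q + 2) :=
    deriv_deriv_comp_affine hτ _ _
  have bf : ∀ q, 0 < q → |q * deriv f q| ≤ 2 * B₁ := fun q hq => by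
    simpa [df] using bound (q := q) 1 hB₁ h1 (sf z1 hq)
  have bg : ∀ q, 0 < q → |q * deriv g q| ≤ 2 * B₁ := fun q hq => by
    simpa [dg] using bound (q := q) 1 hB₁ h1 (sg z0 hq)
  have bbf : ∀ q, 0 < q → |q ^ 2 * deriv (deriv f) q| ≤ 4 * B₂ := fun q hq => by
    have := bound (q := q) 2 hB₂ h2 (sf y1 hq)
    rw [ddf]; norm_num at this ⊢; exact this
  have bbg : ∀ q, 0 < q → |q ^ 2 * deriv (deriv g) q| ≤ 4 * B₂ := fun q hq => by
    have := bound (q := q) 2 hB₂ h2 (sg y0 hq)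
    rw [ddg]; norm_num at this ⊢; exact this
  have bmul : ∀ {a b B : ℝ}, |a| ≤ B → 0 ≤ b → b ≤ 1 → |a * b| ≤ B := by
    intro a b B ha hb hb1
    rw [abs_mul, abs_of_nonneg hb]
    nlinarith [abs_nonneg a]
  refine ⟨fun q => f q * g q, hf.mul hg, fun q => mul_nonneg (hf0 q) (hg0 q),
    fun q => mul_le_one₀ (hf1 q) (hg0 q) (hg1 q), fun q hq hq' => ?_, fun q hq => ?_,
    fun q hq => ?_, fun q hq => ?_, fun q hq => ?_⟩
  · have e1 : f q = 1 := Real.smoothTransition.one_of_one_le (by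
      have := mul_le_mul_of_nonneg_left hq hM0.le
      rw [mul_inv_cancel₀ hM0.ne'] at this; linarith)
    have e2 : g q = 1 := Real.smoothTransition.one_of_one_le (by
      have := mul_le_mul_of_nonneg_left hq' (inv_pos.2 hM0).le
      rw [inv_mul_cancel₀ hM0.ne'] at this; linarith)
    simp [e1, e2]
  · have e1 : f q = 0 := Real.smoothTransition.zero_of_nonpos (by
      have := mul_le_mul_of_nonneg_left hq hM0.le
      rw [mul_div_assoc', mul_inv_cancel₀ hM0.ne'] at this; linarith)
    simp [e1]
  · have e1 : g q = 0 := Real.smoothTransition.zero_of_nonpos (by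
      have := mul_le_mul_of_nonneg_left hq (inv_pos.2 hM0).le
      rw [mul_left_comm, inv_mul_cancel₀ hM0.ne'] at this; linarith)
    simp [e1]
  · rw [deriv_fun_mul (hf.differentiable (by simp) q) (hg.differentiable (by simp) q)]
    have a1 := bmul (bf q hq) (hg0 q) (hg1 q)
    have a2 := bmul (bg q hq) (hf0 q) (hf1 q)
    calc _ = |q * deriv f q * g q + q * deriv g q * f q| := by congr 1; ring
      _ ≤ _ := (abs_add_le _ _).trans (by nlinarith)
  · rw [deriv_deriv_mul hf hg]
    have a1 := bmul (bbf q hq) (hg0 q) (hg1 q)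
    have a2 := bmul (bbg q hq) (hf0 q) (hf1 q)
    have a3 : |q * deriv f q * (q * deriv g q)| ≤ 2 * B₁ * (2 * B₁) := by
      rw [abs_mul]; exact mul_le_mul (bf q hq) (bg q hq) (abs_nonneg _) (by positivity)
    calc _ = |q ^ 2 * deriv (deriv f) q * g q + 2 * (q * deriv f q * (q * deriv g q)) +
          q ^ 2 * deriv (deriv g) q * f q| := by congr 1; ring
      _ ≤ _ := (abs_add_three _ _ _).trans (by rw [abs_mul 2, abs_two]; nlinarith)

lemma isClosed_transition (M : ℝ) : IsClosed (transition M) := isClosed_Icc.union isClosed_Icc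

lemma IsCutoff.deriv_eq_zero {K M : ℝ} {c : ℝ → ℝ} (h : IsCutoff K M c) :
    ∀ q ∈ (transition M)ᶜ, deriv c q = 0 := fun q hq => by
  simp only [transition, mem_compl_iff, mem_union, mem_Icc, not_or, not_and_or, not_le] at hq
  obtain ⟨h1 | h1, h2⟩ := hq
  · exact deriv_eq_zero_of_isOpen isOpen_Iio (fun x hx => h.eq_zero_of_le x (mem_Iio.1 hx).le) q h1
  · rcases h2 with h2 | h2
    · exact deriv_eq_zero_of_isOpen isOpen_Ioo
        (fun x hx => h.eq_one x (mem_Ioo.1 hx).1.le (mem_Ioo.1 hx).2.le) q ⟨h1, h2⟩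
    · exact deriv_eq_zero_of_isOpen isOpen_Ioi
        (fun x hx => h.eq_zero_of_ge x (mem_Ioi.1 hx).le) q h2

lemma IsCutoff.deriv_deriv_eq_zero {K M : ℝ} {c : ℝ → ℝ} (h : IsCutoff K M c) :
    ∀ q ∈ (transition M)ᶜ, deriv (deriv c) q = 0 :=
  deriv_eq_zero_of_isOpen (isClosed_transition M).isOpen_compl h.deriv_eq_zero

end Cutoff

section Shell

/-- The set of points whose squared norm lies in `[r, R]`. -/
def shell (n : ℕ) (r R : ℝ) : Set (E n) := {x | r ≤ ‖x‖ ^ 2 ∧ ‖x‖ ^ 2 ≤ R}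

lemma isCompact_shell (n : ℕ) (r R : ℝ) : IsCompact (shell n r R) := by
  refine (isCompact_closedBall (0 : E n) (√R)).of_isClosed_subset ?_ fun x hx => ?_
  · have hc : Continuous fun x : E n => ‖x‖ ^ 2 := by fun_prop
    exact (isClosed_le continuous_const hc).inter (isClosed_le hc continuous_const)
  · rw [mem_closedBall_zero_iff]; exact Real.le_sqrt_of_sq_le hx.2

lemma ne_zero_of_mem_shell {r R : ℝ} (hr : 0 < r) {x : E n} (hx : x ∈ shell n r R) : x ≠ 0 := by
  rintro rfl
  have := hx.1
  simp at this
  linarith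

lemma setIntegral_shell_le (hn : 0 < n) {r : ℝ} (hr : 0 < r) :
    ∫ x in shell n r (2 * r), (‖x‖ ^ 2) ^ (-(n / 2 : ℝ)) ≤
      (2 : ℝ) ^ (n / 2 : ℝ) * volume.real (ball (0 : E n) 1) := by
  have : Nonempty (Fin n) := ⟨⟨0, hn⟩⟩
  have hsub : shell n r (2 * r) ⊆ closedBall 0 (√(2 * r)) := fun x hx => by
    rw [mem_closedBall_zero_iff]; exact Real.le_sqrt_of_sq_le hx.2
  have hvol : volume.real (shell n r (2 * r)) ≤
      (2 * r) ^ (n / 2 : ℝ) * volume.real (ball (0 : E n) 1) := by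
    refine (measureReal_mono hsub measure_closedBall_lt_top.ne).trans_eq ?_
    rw [Measure.real, Measure.addHaar_closedBall _ _ (Real.sqrt_nonneg _), ENNReal.toReal_mul,
      ENNReal.toReal_ofReal (by positivity), finrank_euclideanSpace, Fintype.card_fin,
      Real.sqrt_eq_rpow, ← Real.rpow_natCast, ← Real.rpow_mul (by positivity)]
    congr 2; ring
  have hle := norm_setIntegral_le_of_norm_le_const (μ := volume) (s := shell n r (2 * r))
    (f := fun x : E n => (‖x‖ ^ 2) ^ (-(n / 2 : ℝ))) (C := r ^ (-(n / 2 : ℝ)))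
    (isCompact_shell n r (2 * r)).measure_lt_top fun x hx => by
      rw [Real.norm_of_nonneg (by positivity)]
      exact Real.rpow_le_rpow_of_nonpos hr hx.1 (by simp; positivity)
  refine (le_abs_self _).trans (hle.trans ?_)
  refine (mul_le_mul_of_nonneg_left hvol (by positivity)).trans_eq ?_
  rw [Real.mul_rpow zero_le_two hr.le, Real.rpow_neg hr.le]
  have : r ^ (n / 2 : ℝ) ≠ 0 := by positivity
  field_simp

end Shell

/-- The radial component `u · x`. -/
noncomputable def radial (u : Fin n → E n → ℝ) (x : E n) : ℝ := ∑ i, u i x * x i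

/-- The squared norm of the gradient. -/
noncomputable def gradSq (u : Fin n → E n → ℝ) (x : E n) : ℝ :=
  ∑ j, ∑ i, pd i (u j) x * pd i (u j) x

lemma integrable_of_shell {f : E n → ℝ} {r R : ℝ} (hf : ContinuousOn f (shell n r R))
    (h0 : ∀ x ∉ shell n r R, f x = 0) : Integrable f :=
  (hf.integrableOn_compact (isCompact_shell n r R)).integrable_of_forall_notMem_eq_zero h0

section RadialTest

variable {u : Fin n → E n → ℝ} {p g : E n → ℝ} {b : ℝ → ℝ} {r R : ℝ}

lemma tsupport_radial_subset (hb0 : ∀ q, q ∉ Icc r R → b q = 0) :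
    tsupport (fun x : E n => b (‖x‖ ^ 2)) ⊆ shell n r R :=
  closure_minimal (fun x hx => by
    by_contra hc
    exact hx (hb0 _ hc)) (isCompact_shell n r R).isClosed

lemma hasCompactSupport_radial (hb0 : ∀ q, q ∉ Icc r R → b q = 0) :
    HasCompactSupport (fun x : E n => b (‖x‖ ^ 2)) :=
  (isCompact_shell n r R).of_isClosed_subset (isClosed_tsupport _) (tsupport_radial_subset hb0)

lemma pd_coord_mul_radial (hb : ContDiff ℝ ∞ b) (x : E n) (i j : Fin n) :
    pd i (fun y => y j * b (‖y‖ ^ 2)) x =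
      (if i = j then b (‖x‖ ^ 2) else 0) + 2 * x i * x j * deriv b (‖x‖ ^ 2) := by
  rw [pd_mul (contDiff_coord j).contDiffAt (contDiff_radial hb).contDiffAt, pd_coord,
    pd_radial hb]
  split_ifs <;> ring

lemma lap_coord_mul_radial (hb : ContDiff ℝ ∞ b) (x : E n) (j : Fin n) :
    lap (fun y => y j * b (‖y‖ ^ 2)) x =
      x j * lap (fun y => b (‖y‖ ^ 2)) x + 4 * x j * deriv b (‖x‖ ^ 2) := by
  rw [lap_mul isOpen_univ (fun y _ => (contDiff_coord j).contDiffAt)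
    (fun y _ => (contDiff_radial hb).contDiffAt) (mem_univ x)]
  have h1 : lap (fun y : E n => y j) x = 0 := by
    refine Finset.sum_eq_zero fun i _ => ?_
    have : pd i (fun y : E n => y j) = fun _ => if i = j then 1 else 0 := funext fun y => pd_coord
    rw [this, pd_const]
  simp [h1, pd_coord, pd_radial hb]
  ring

lemma integral_mul_radial_deriv (hb : ContDiff ℝ ∞ b) (hr : 0 < r)
    (hb0 : ∀ q, q ∉ Icc r R → b q = 0) (hg : ∀ x, x ≠ 0 → ContDiffAt ℝ ∞ g x) :
    ∫ x, b (‖x‖ ^ 2) * ∑ i, x i * pd i g x =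
      -∫ x, (n * b (‖x‖ ^ 2) + 2 * ‖x‖ ^ 2 * deriv b (‖x‖ ^ 2)) * g x := by
  have hs : ∀ j : Fin n, tsupport (fun x : E n => x j * b (‖x‖ ^ 2)) ⊆ shell n r R := fun j =>
    tsupport_mul_subset_right.trans (tsupport_radial_subset hb0)
  have hc : ∀ j : Fin n, HasCompactSupport (fun x : E n => x j * b (‖x‖ ^ 2)) := fun j =>
    (hasCompactSupport_radial hb0).mul_left
  have hsm : ∀ j : Fin n, ContDiff ℝ ∞ (fun x : E n => x j * b (‖x‖ ^ 2)) := fun j =>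
    (contDiff_coord j).mul (contDiff_radial hb)
  have hg' : ∀ j : Fin n, ∀ x ∈ tsupport (fun x : E n => x j * b (‖x‖ ^ 2)), ContDiffAt ℝ ∞ g x :=
    fun j x hx => hg x (ne_zero_of_mem_shell hr (hs j hx))
  have key : ∑ i, ∫ x, x i * b (‖x‖ ^ 2) * pd i g x =
      -∑ i, ∫ x, pd i (fun y => y i * b (‖y‖ ^ 2)) x * g x := by
    rw [← Finset.sum_neg_distrib]
    exact Finset.sum_congr rfl fun i _ => ibp (hsm i) (hc i) (hg' i) i
  rw [← integral_finsetSum _ fun i _ => integrable_mul_of_tsupport (hsm i).continuous (hc i)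
      fun x hx => ((hg' i x hx).pd i).continuousAt,
    ← integral_finsetSum _ fun i _ => integrable_mul_of_tsupport ((hsm i).pd i).continuous
      ((hc i).pd i) fun x hx => (hg' i x (tsupport_pd _ i hx)).continuousAt] at key
  convert key using 3 with x x
  · rw [Finset.mul_sum]
    exact Finset.sum_congr rfl fun i _ => by ring
  · ext x
    rw [← Finset.sum_mul]
    congr 1
    simp_rw [pd_coord_mul_radial hb]
    rw [Finset.sum_add_distrib, normsq_eq, Finset.mul_sum, Finset.sum_mul]
    simp [mul_assoc]

lemma IsSol.integral_mul_gradSq (h : IsSol u p {x | x ≠ 0}) (hb : ContDiff ℝ ∞ b)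
    (hr : 0 < r) (hb0 : ∀ q, q ∉ Icc r R → b q = 0) :
    ∫ x, b (‖x‖ ^ 2) * gradSq u x =
      (∫ x, (2 * n * deriv b (‖x‖ ^ 2) + 4 * ‖x‖ ^ 2 * deriv (deriv b) (‖x‖ ^ 2)) * kin u x) +
        ∫ x, 2 * deriv b (‖x‖ ^ 2) * radial u x * head u p x := by
  have hs : tsupport (fun x : E n => b (‖x‖ ^ 2)) ⊆ {x | x ≠ 0} := fun x hx =>
    ne_zero_of_mem_shell hr (tsupport_radial_subset hb0 hx)
  have hc : HasCompactSupport (fun x : E n => b (‖x‖ ^ 2)) := hasCompactSupport_radial hb0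
  have hk : ∀ x ∈ tsupport (fun x : E n => b (‖x‖ ^ 2)), ContDiffAt ℝ ∞ (kin u) x :=
    fun x hx => h.smooth_kin (hs hx)
  have hh : ∀ x ∈ tsupport (fun x : E n => b (‖x‖ ^ 2)), ContDiffAt ℝ ∞ (head u p) x :=
    fun x hx => h.smooth_head (hs hx)
  have hsm : ContDiff ℝ ∞ (fun x : E n => b (‖x‖ ^ 2)) := contDiff_radial hb
  have e1 := integral_mul_lap hsm hc hk
  have e2 := h.integral_mul_adv hsm hc hs hh
  have e3 : ∫ x, b (‖x‖ ^ 2) * gradSq u x = (∫ x, b (‖x‖ ^ 2) * lap (kin u) x) -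
      ∫ x, b (‖x‖ ^ 2) * adv u (head u p) x := by
    rw [← integral_sub (integrable_mul_of_tsupport hsm.continuous hc
        fun x hx => (hk x hx).lap.continuousAt) (integrable_mul_of_tsupport hsm.continuous hc
        fun x hx => (h.smooth_adv (hs hx) (hh x hx)).continuousAt)]
    refine integral_congr_ae (ae_of_all _ fun x => ?_)
    by_cases hx : x ∈ tsupport (fun x : E n => b (‖x‖ ^ 2))
    · simp only
      rw [h.lap_kin (hs hx), h.adv_head (hs hx)]
      unfold gradSq
      ring
    · have : b (‖x‖ ^ 2) = 0 :=
        image_eq_zero_of_notMem_tsupport (f := fun x : E n => b (‖x‖ ^ 2)) hx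
      simp [this]
  rw [e3, e1, e2, sub_neg_eq_add]
  congr 2
  · ext x; rw [lap_radial hb]
  · ext x
    unfold adv radial
    rw [Finset.mul_sum]
    congr 1
    exact Finset.sum_congr rfl fun i _ => by rw [pd_radial hb]; ring

lemma IsSol.integral_radial_eq_zero (h : IsSol u p {x | x ≠ 0}) (hb : ContDiff ℝ ∞ b)
    (hr : 0 < r) (hb0 : ∀ q, q ∉ Icc r R → b q = 0) : ∫ x, deriv b (‖x‖ ^ 2) * radial u x = 0 := by
  have hs : tsupport (fun x : E n => b (‖x‖ ^ 2)) ⊆ {x | x ≠ 0} := fun x hx =>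
    ne_zero_of_mem_shell hr (tsupport_radial_subset hb0 hx)
  have e := h.integral_mul_adv (contDiff_radial hb) (hasCompactSupport_radial hb0) hs
    (g := fun _ => 1) fun x _ => contDiffAt_const
  have e1 : ∀ x, adv u (fun _ => 1) x = 0 := fun x => by simp [adv, pd_const]
  have e2 : ∀ x, adv u (fun x : E n => b (‖x‖ ^ 2)) x = 2 * (deriv b (‖x‖ ^ 2) * radial u x) :=
    fun x => by
      unfold adv radial
      rw [Finset.mul_sum, Finset.mul_sum]
      exact Finset.sum_congr rfl fun i _ => by rw [pd_radial hb]; ring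
  simp_rw [e1, e2, mul_one, integral_const_mul] at e
  simp at e
  exact e

/-- The momentum equation tested with the radial field `x ↦ b (|x|²) x`. -/
lemma IsSol.integral_momentum_radial (h : IsSol u p {x | x ≠ 0}) (hb : ContDiff ℝ ∞ b)
    (hr : 0 < r) (hb0 : ∀ q, q ∉ Icc r R → b q = 0) :
    ∫ x, (radial u x *
        (2 * n * deriv b (‖x‖ ^ 2) + 4 * ‖x‖ ^ 2 * deriv (deriv b) (‖x‖ ^ 2)) +
      (2 * b (‖x‖ ^ 2) * kin u x + 2 * deriv b (‖x‖ ^ 2) * radial u x ^ 2) +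
      (n * b (‖x‖ ^ 2) + 2 * ‖x‖ ^ 2 * deriv b (‖x‖ ^ 2)) * p x) = 0 := by
  set f : Fin n → E n → ℝ := fun j x => x j * b (‖x‖ ^ 2)
  have hs : ∀ j, tsupport (f j) ⊆ shell n r R := fun j =>
    tsupport_mul_subset_right.trans (tsupport_radial_subset hb0)
  have hc : ∀ j, HasCompactSupport (f j) := fun j => (hasCompactSupport_radial hb0).mul_left
  have hsm : ∀ j, ContDiff ℝ ∞ (f j) := fun j => (contDiff_coord j).mul (contDiff_radial hb)
  have hs0 : ∀ j, tsupport (f j) ⊆ {x | x ≠ 0} := fun j x hx => ne_zero_of_mem_shell hr (hs j hx)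
  have hu : ∀ j, ∀ x ∈ tsupport (f j), ContDiffAt ℝ ∞ (u j) x := fun j x hx =>
    h.smooth x (hs0 j hx) j
  have hp : ∀ j, ∀ x ∈ tsupport (f j), ContDiffAt ℝ ∞ p x := fun j x hx => h.smooth_p x (hs0 j hx)
  have i1 : ∀ j, Integrable fun x => lap (f j) x * u j x := fun j =>
    integrable_mul_of_tsupport (hsm j).lap.continuous
      ((hc j).of_isClosed_subset (isClosed_tsupport _) (tsupport_lap _))
      fun x hx => (hu j x (tsupport_lap _ hx)).continuousAt
  have i2 : ∀ j, Integrable fun x => adv u (f j) x * u j x := fun j => by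
    refine integrable_of_shell (r := r) (R := R) (fun x hx => ?_) fun x hx => ?_
    · exact ((h.smooth_adv (ne_zero_of_mem_shell hr hx) (hsm j).contDiffAt).mul
        (h.smooth x (ne_zero_of_mem_shell hr hx) j)).continuousAt.continuousWithinAt
    · have : adv u (f j) x = 0 := Finset.sum_eq_zero fun i _ => by
        rw [pd_eq_zero_of_notMem i fun hx' => hx (hs j hx'), mul_zero]
      rw [this, zero_mul]
  have i3 : ∀ j, Integrable fun x => pd j (f j) x * p x := fun j =>
    integrable_mul_of_tsupport ((hsm j).pd j).continuous ((hc j).pd j)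
      fun x hx => (hp j x (tsupport_pd _ j hx)).continuousAt
  have key : ∀ j, ∫ x, (lap (f j) x * u j x + adv u (f j) x * u j x + pd j (f j) x * p x) = 0 := by
    intro j
    have e0 : ∫ x, f j x * lap (u j) x =
        (∫ x, f j x * adv u (u j) x) + ∫ x, f j x * pd j p x := by
      rw [← integral_add (integrable_mul_of_tsupport (hsm j).continuous (hc j)
        fun x hx => (h.smooth_adv (hs0 j hx) (hu j x hx)).continuousAt)
        (integrable_mul_of_tsupport (hsm j).continuous (hc j)
        fun x hx => ((hp j x hx).pd j).continuousAt)]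
      refine integral_congr_ae (ae_of_all _ fun x => ?_)
      by_cases hx : x ∈ tsupport (f j)
      · simp only
        rw [h.pd_p (hs0 j hx)]; ring
      · simp [image_eq_zero_of_notMem_tsupport hx]
    rw [integral_mul_lap (hsm j) (hc j) (hu j), h.integral_mul_adv (hsm j) (hc j) (hs0 j) (hu j),
      ibp (hsm j) (hc j) (hp j) j] at e0
    have e1 := integral_add ((i1 j).add (i2 j)) (i3 j)
    simp only [Pi.add_apply] at e1
    rw [e1, integral_add (i1 j) (i2 j)]
    linarith
  have hint : ∀ j, Integrable fun x =>
      lap (f j) x * u j x + adv u (f j) x * u j x + pd j (f j) x * p x := fun j =>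
    ((i1 j).add (i2 j)).add (i3 j)
  have hsum : ∫ x, ∑ j, (lap (f j) x * u j x + adv u (f j) x * u j x + pd j (f j) x * p x) = 0 := by
    rw [integral_finsetSum _ fun j _ => hint j]
    exact Finset.sum_eq_zero fun j _ => key j
  have hrad := h.integral_radial_eq_zero hb hr hb0
  have irad : Integrable fun x => deriv b (‖x‖ ^ 2) * radial u x := by
    refine integrable_of_shell (r := r) (R := R) (fun x hx => ?_) fun x hx => ?_
    · have h1 : ContinuousAt (radial u) x := tendsto_finsetSum _ fun i _ =>
        (h.smooth x (ne_zero_of_mem_shell hr hx) i).continuousAt.mul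
          (contDiff_coord i).continuous.continuousAt
      exact ((contDiff_radial (contDiff_deriv hb)).continuous.continuousAt.mul
        h1).continuousWithinAt
    · have : deriv b (‖x‖ ^ 2) = 0 :=
        deriv_eq_zero_of_isOpen isClosed_Icc.isOpen_compl hb0 _ hx
      rw [this, zero_mul]
  have hpt : ∀ x, ∑ j, (lap (f j) x * u j x + adv u (f j) x * u j x + pd j (f j) x * p x) -
      4 * (deriv b (‖x‖ ^ 2) * radial u x) = radial u x *
        (2 * n * deriv b (‖x‖ ^ 2) + 4 * ‖x‖ ^ 2 * deriv (deriv b) (‖x‖ ^ 2)) +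
      (2 * b (‖x‖ ^ 2) * kin u x + 2 * deriv b (‖x‖ ^ 2) * radial u x ^ 2) +
      (n * b (‖x‖ ^ 2) + 2 * ‖x‖ ^ 2 * deriv b (‖x‖ ^ 2)) * p x := by
    intro x
    have e1 : ∀ j, lap (f j) x * u j x = u j x * x j *
        (2 * n * deriv b (‖x‖ ^ 2) + 4 * ‖x‖ ^ 2 * deriv (deriv b) (‖x‖ ^ 2) +
          4 * deriv b (‖x‖ ^ 2)) := fun j => by
      rw [lap_coord_mul_radial hb, lap_radial hb]; ring
    have e2 : ∀ j, adv u (f j) x * u j x = 2 * b (‖x‖ ^ 2) * (2⁻¹ * (u j x * u j x)) +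
        2 * deriv b (‖x‖ ^ 2) * radial u x * (u j x * x j) := fun j => by
      have : adv u (f j) x = b (‖x‖ ^ 2) * u j x +
          2 * deriv b (‖x‖ ^ 2) * x j * radial u x := by
        unfold adv radial
        simp_rw [f, pd_coord_mul_radial hb, mul_add, Finset.sum_add_distrib, Finset.mul_sum]
        congr 1
        · simp [mul_comm]
        · exact Finset.sum_congr rfl fun i _ => by ring
      rw [this]; ring
    have e3 : ∀ j, pd j (f j) x * p x = b (‖x‖ ^ 2) * p x +
        2 * deriv b (‖x‖ ^ 2) * p x * (x j * x j) := fun j => by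
      simp only [f]
      rw [pd_coord_mul_radial hb, if_pos rfl]; ring
    simp_rw [e1, e2, e3, Finset.sum_add_distrib, ← Finset.mul_sum, ← Finset.sum_mul]
    rw [← normsq_eq, show ∑ i, u i x * x i = radial u x from rfl,
      show kin u x = 2⁻¹ * ∑ i, u i x * u i x from (Finset.mul_sum _ _ _).symm]
    simp
    ring
  simp_rw [← hpt]
  rw [integral_sub (integrable_finsetSum _ fun j _ => hint j) (irad.const_mul 4), hsum,
    integral_const_mul, hrad]
  simp

end RadialTest

section CutoffIntegral

variable {K M M' : ℝ} {c c' : ℝ → ℝ} {g : E n → ℝ}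

lemma IsCutoff.eq_zero_of_notMem (h : IsCutoff K M c) :
    ∀ q, q ∉ Icc (M⁻¹ / 2) (2 * M) → c q = 0 := fun q hq => by
  rw [mem_Icc, not_and_or, not_le, not_le] at hq
  exact hq.elim (fun hq => h.eq_zero_of_le q hq.le) fun hq => h.eq_zero_of_ge q hq.le

lemma IsCutoff.le_of_two_mul_le (h : IsCutoff K M c) (h' : IsCutoff K M' c') (hM : 0 < M)
    (hMM : 2 * M ≤ M') (q : ℝ) : c q ≤ c' q := by
  by_cases hq : q ∈ Icc (M⁻¹ / 2) (2 * M)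
  · rw [h'.eq_one q _ (hq.2.trans hMM)]
    · exact h.le_one q
    · refine le_trans ?_ hq.1
      have := inv_anti₀ (by positivity) hMM
      rwa [mul_inv, mul_comm] at this
  · rw [h.eq_zero_of_notMem q hq]; exact h'.nonneg q

lemma IsCutoff.continuousOn_mul (h : IsCutoff K M c) (hM : 0 < M)
    (hg : ContinuousOn g {x | x ≠ 0}) :
    Continuous fun x => c (‖x‖ ^ 2) * g x := by
  refine continuous_of_tsupport fun x hx => ?_
  have hx0 : x ≠ 0 := ne_zero_of_mem_shell (by positivity : 0 < M⁻¹ / 2)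
    (tsupport_radial_subset h.eq_zero_of_notMem (tsupport_mul_subset_left hx))
  exact (contDiff_radial h.smooth).continuous.continuousAt.mul
    (hg.continuousAt (isOpen_ne_zero.mem_nhds hx0))

lemma IsCutoff.hasCompactSupport_mul (h : IsCutoff K M c) :
    HasCompactSupport fun x => c (‖x‖ ^ 2) * g x :=
  (hasCompactSupport_radial h.eq_zero_of_notMem).mul_right

lemma IsCutoff.integrable_mul (h : IsCutoff K M c) (hM : 0 < M)
    (hg : ContinuousOn g {x | x ≠ 0}) : Integrable fun x => c (‖x‖ ^ 2) * g x :=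
  (h.continuousOn_mul hM hg).integrable_of_hasCompactSupport h.hasCompactSupport_mul

lemma mul_nonneg_of_ne_zero (h : IsCutoff K M c) (hM : 0 < M) (hg0 : ∀ x, x ≠ 0 → 0 ≤ g x)
    (x : E n) : 0 ≤ c (‖x‖ ^ 2) * g x := by
  by_cases hx : x = 0
  · rw [hx, h.eq_zero_of_le _ (by simp; positivity), zero_mul]
  · exact mul_nonneg (h.nonneg _) (hg0 x hx)

lemma IsCutoff.integral_mono (h : IsCutoff K M c) (h' : IsCutoff K M' c') (hM : 0 < M)
    (hMM : 2 * M ≤ M') (hg : ContinuousOn g {x | x ≠ 0}) (hg0 : ∀ x, x ≠ 0 → 0 ≤ g x) :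
    ∫ x, c (‖x‖ ^ 2) * g x ≤ ∫ x, c' (‖x‖ ^ 2) * g x := by
  have hM' : 0 < M' := by linarith
  refine MeasureTheory.integral_mono (h.integrable_mul hM hg) (h'.integrable_mul hM' hg) fun x => ?_
  by_cases hx : x = 0
  · simp [hx, h.eq_zero_of_le 0 (by positivity), h'.eq_zero_of_le 0 (by positivity)]
  · exact mul_le_mul_of_nonneg_right (h.le_of_two_mul_le h' hM hMM _) (hg0 x hx)

lemma monotone_integral_cutoff {c : ℕ → ℝ → ℝ} (hc : ∀ k, IsCutoff K (4 ^ k) (c k))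
    (hg : ContinuousOn g {x | x ≠ 0}) (hg0 : ∀ x, x ≠ 0 → 0 ≤ g x) :
    Monotone fun k => ∫ x, c k (‖x‖ ^ 2) * g x :=
  monotone_nat_of_le_succ fun k => (hc k).integral_mono (hc (k + 1)) (by positivity)
    (by rw [pow_succ]; nlinarith [pow_pos (by norm_num : (0 : ℝ) < 4) k]) hg hg0

/-- A nonnegative function with vanishing integrals against a sequence of cutoffs vanishes. -/
lemma eq_zero_of_tendsto_integral_cutoff {c : ℕ → ℝ → ℝ} (hc : ∀ k, IsCutoff K (4 ^ k) (c k))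
    (hg : ContinuousOn g {x | x ≠ 0}) (hg0 : ∀ x, x ≠ 0 → 0 ≤ g x)
    (hl : Tendsto (fun k => ∫ x, c k (‖x‖ ^ 2) * g x) atTop (𝓝 0)) :
    ∀ x, x ≠ 0 → g x = 0 := by
  intro x hx
  have hq : 0 < ‖x‖ ^ 2 := by have := norm_pos_iff.2 hx; positivity
  have h4 : Tendsto (fun k : ℕ => (4 : ℝ) ^ k) atTop atTop :=
    tendsto_pow_atTop_atTop_of_one_lt (by norm_num)
  obtain ⟨k, hk1, hk2⟩ := ((h4.eventually_ge_atTop (‖x‖ ^ 2)).and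
    (h4.eventually_ge_atTop (‖x‖ ^ 2)⁻¹)).exists
  have hM : (0 : ℝ) < 4 ^ k := by positivity
  have hnn := mul_nonneg_of_ne_zero (hc k) hM hg0
  have hle := (monotone_integral_cutoff hc hg hg0).ge_of_tendsto hl k
  have hz : ∫ x, c k (‖x‖ ^ 2) * g x = 0 := le_antisymm hle (integral_nonneg hnn)
  have hcont := (hc k).continuousOn_mul hM hg
  have hae := (integral_eq_zero_iff_of_nonneg hnn ((hc k).integrable_mul hM hg)).1 hz
  have h0 : c k (‖x‖ ^ 2) * g x = 0 :=
    congrFun ((hcont.ae_eq_iff_eq volume continuous_zero).1 hae) x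
  rwa [(hc k).eq_one _ (inv_le_of_inv_le₀ hq hk2) hk1, one_mul] at h0

end CutoffIntegral

section MaximumPrinciple

lemma lap_comp {F : ℝ → ℝ} (hF : ContDiff ℝ ∞ F) {f : E n → ℝ} {Ω : Set (E n)} (hΩ : IsOpen Ω)
    (hf : ∀ y ∈ Ω, ContDiffAt ℝ ∞ f y) {x : E n} (hx : x ∈ Ω) :
    lap (fun y => F (f y)) x =
      deriv F (f x) * lap f x + deriv (deriv F) (f x) * ∑ i, pd i f x * pd i f x := by
  unfold lap
  rw [Finset.mul_sum, Finset.mul_sum, ← Finset.sum_add_distrib]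
  refine Finset.sum_congr rfl fun i _ => ?_
  have h1 : pd i (fun y => F (f y)) =ᶠ[𝓝 x] fun y => deriv F (f y) * pd i f y := by
    filter_upwards [hΩ.mem_nhds hx] with y hy
      using pd_comp (hF.differentiable (by simp) _) (hf y hy)
  have hF1 := contDiff_deriv hF
  have hF2 : ContDiffAt ℝ ∞ (fun y => deriv F (f y)) x := hF1.contDiffAt.comp x (hf x hx)
  rw [pd_congr h1, pd_mul hF2 ((hf x hx).pd i),
    pd_comp (hF1.differentiable (by simp) _) (hf x hx)]
  ring

lemma exists_convex_truncation {δ : ℝ} (hδ : 0 < δ) : ∃ F : ℝ → ℝ, ContDiff ℝ ∞ F ∧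
    (∀ s, deriv F s = Real.smoothTransition (s - δ)) ∧ (∀ s, 0 ≤ deriv (deriv F) s) ∧
    (∀ s, s ≤ δ → F s = 0) ∧ ∀ s, |F s| ≤ |s| := by
  have hτ : ContDiff ℝ ∞ fun s => Real.smoothTransition (s - δ) :=
    Real.smoothTransition.contDiff.comp (by fun_prop)
  obtain ⟨F, hF, hF', hFδ⟩ := exists_antideriv hτ δ
  have hd : ∀ s, deriv F s = Real.smoothTransition (s - δ) := fun s => by rw [hF']
  have hdiff : Differentiable ℝ F := hF.differentiable (by simp)
  have hmono : Monotone F := monotone_of_deriv_nonneg hdiff fun s => by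
    rw [hd]; exact Real.smoothTransition.nonneg _
  have hmono2 : Monotone fun s => s - F s :=
    monotone_of_deriv_nonneg (differentiable_id.sub hdiff) fun s => by
      rw [deriv_fun_sub differentiableAt_fun_id (hdiff s), hd]
      simp [Real.smoothTransition.le_one]
  have hzero : ∀ s, s ≤ δ → F s = 0 := fun s hs => by
    have h1 : AntitoneOn F (Iic δ) := antitoneOn_of_deriv_nonpos (convex_Iic δ)
      hdiff.continuous.continuousOn hdiff.differentiableOn fun t ht => by
        rw [interior_Iic, mem_Iio] at ht
        rw [hd, Real.smoothTransition.zero_of_nonpos (by linarith)]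
    have h2 := h1 (mem_Iic.2 hs) (mem_Iic.2 le_rfl) hs
    have h3 := hmono hs
    rw [hFδ] at h2 h3
    linarith
  refine ⟨F, hF, hd, fun s => ?_, hzero, fun s => ?_⟩
  · have hm : Monotone (deriv F) := by
      rw [hF']
      intro a b hab
      exact Real.smoothTransition.monotone (by linarith)
    exact hm.deriv_nonneg
  · rcases le_total s δ with hs | hs
    · rw [hzero s hs]; simp
    · have h1 := hmono hs
      have h2 : δ - F δ ≤ s - F s := hmono2 hs
      rw [hFδ] at h1 h2
      rw [abs_of_nonneg h1, abs_of_nonneg (by linarith)]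
      linarith

variable {u : Fin n → E n → ℝ} {p : E n → ℝ} {C K : ℝ}

lemma abs_radial_le {x : E n} (hx : x ≠ 0) (hb : ∀ j, |u j x| ≤ C / ‖x‖) :
    |radial u x| ≤ n * C := by
  have hr := norm_pos_iff.2 hx
  unfold radial
  refine (Finset.abs_sum_le_sum_abs _ _).trans
    ((Finset.sum_le_sum (g := fun _ => C) fun i _ => ?_).trans_eq (by simp))
  rw [abs_mul]
  have h1 : |x i| ≤ ‖x‖ := PiLp.norm_apply_le x i
  calc |u i x| * |x i| ≤ C / ‖x‖ * ‖x‖ :=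
        mul_le_mul (hb i) h1 (abs_nonneg _) ((abs_nonneg _).trans (hb i))
    _ = C := by field_simp

end MaximumPrinciple

section HeadSign

variable {u : Fin n → E n → ℝ} {p : E n → ℝ} {B C K M δ : ℝ} {c F : ℝ → ℝ}

lemma inv_sq_le_of_mem_shell (hn : 4 ≤ n) {r : ℝ} (hr : 0 < r) {x : E n}
    (hx : x ∈ shell n r (2 * r)) :
    ((‖x‖ ^ 2) ^ 2)⁻¹ ≤ (2 * r) ^ (n / 2 - 2 : ℝ) * (‖x‖ ^ 2) ^ (-(n / 2 : ℝ)) := by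
  have hn' : (4 : ℝ) ≤ n := by exact_mod_cast hn
  have hq : 0 < ‖x‖ ^ 2 := hr.trans_le hx.1
  have h1 : (‖x‖ ^ 2) ^ (n / 2 - 2 : ℝ) ≤ (2 * r) ^ (n / 2 - 2 : ℝ) :=
    Real.rpow_le_rpow hq.le hx.2 (by linarith)
  have h2 : ((‖x‖ ^ 2) ^ 2)⁻¹ = (‖x‖ ^ 2) ^ (n / 2 - 2 : ℝ) * (‖x‖ ^ 2) ^ (-(n / 2 : ℝ)) := by
    rw [← Real.rpow_add hq, ← Real.rpow_natCast (‖x‖ ^ 2) 2, ← Real.rpow_neg hq.le]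
    congr 1; push_cast; ring
  rw [h2]
  exact mul_le_mul_of_nonneg_right h1 (by positivity)

lemma abs_lap_add_adv_cutoff_le (hc : IsCutoff B M c) {x : E n} (hx : x ≠ 0)
    (hC : |radial u x| ≤ C) :
    |lap (fun y => c (‖y‖ ^ 2)) x + adv u (fun y => c (‖y‖ ^ 2)) x| ≤
      (2 * n + 4 + 2 * C) * B / ‖x‖ ^ 2 := by
  have hq : 0 < ‖x‖ ^ 2 := by have := norm_pos_iff.2 hx; positivity
  have h1 := hc.deriv_le _ hq
  have h2 := hc.deriv_deriv_le _ hq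
  have e : lap (fun y => c (‖y‖ ^ 2)) x + adv u (fun y => c (‖y‖ ^ 2)) x =
      ((2 * n + 2 * radial u x) * (‖x‖ ^ 2 * deriv c (‖x‖ ^ 2)) +
        4 * ((‖x‖ ^ 2) ^ 2 * deriv (deriv c) (‖x‖ ^ 2))) / ‖x‖ ^ 2 := by
    have : adv u (fun y => c (‖y‖ ^ 2)) x = 2 * radial u x * deriv c (‖x‖ ^ 2) := by
      unfold adv radial
      rw [Finset.mul_sum, Finset.sum_mul]
      exact Finset.sum_congr rfl fun i _ => by rw [pd_radial hc.smooth]; ring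
    rw [this, lap_radial hc.smooth]
    field_simp
    ring
  rw [e, abs_div, abs_of_pos hq]
  refine div_le_div_of_nonneg_right ?_ hq.le
  refine (abs_add_le _ _).trans ?_
  rw [abs_mul (_ + _), abs_mul 4, abs_of_pos (by norm_num : (0 : ℝ) < 4)]
  have h3 : |2 * (n : ℝ) + 2 * radial u x| ≤ 2 * n + 2 * C := by
    refine (abs_add_le _ _).trans ?_
    rw [abs_mul 2 (radial u x), abs_of_nonneg (by positivity : (0 : ℝ) ≤ 2 * n), abs_two]
    linarith
  have := mul_le_mul h3 h1 (abs_nonneg _) ((abs_nonneg _).trans h3)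
  linarith

lemma IsSol.integral_cutoff_mul_truncation_le (h : IsSol u p {x | x ≠ 0})
    (hb : ∀ x, x ≠ 0 → |radial u x| ≤ C) (hH : ∀ x, x ≠ 0 → |head u p x| ≤ K / ‖x‖ ^ 2)
    (hn : 4 ≤ n) (hF : ContDiff ℝ ∞ F)
    (hF1 : ∀ s, 0 ≤ deriv F s) (hF0 : ∀ s, s ≤ δ → F s = 0) (hFs : ∀ s, |F s| ≤ |s|)
    (hc : IsCutoff B M c) (hM : 0 < M) (hδ : K / M ≤ δ) (hB : 0 ≤ B) (hK : 0 ≤ K) (hC : 0 ≤ C) :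
    ∫ x, c (‖x‖ ^ 2) * (deriv (deriv F) (head u p x) *
        ∑ i, pd i (head u p) x * pd i (head u p) x) ≤
      (2 * n + 4 + 2 * C) * B * K * (2 ^ (n / 2 : ℝ) * volume.real (ball (0 : E n) 1)) *
        M⁻¹ ^ (n / 2 - 2 : ℝ) := by
  set H := head u p
  set φ : E n → ℝ := fun x => c (‖x‖ ^ 2)
  set Φ : E n → ℝ := fun x => F (H x)
  have hM2 : 0 < M⁻¹ / 2 := by positivity
  have hHs : ∀ x, x ≠ 0 → ContDiffAt ℝ ∞ H x := fun x hx => h.smooth_head hx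
  have hΦ : ∀ x, x ≠ 0 → ContDiffAt ℝ ∞ Φ x := fun x hx => hF.contDiffAt.comp x (hHs x hx)
  have hs : tsupport φ ⊆ {x | x ≠ 0} := fun x hx =>
    ne_zero_of_mem_shell hM2 (tsupport_radial_subset hc.eq_zero_of_notMem hx)
  have hcs : HasCompactSupport φ := hasCompactSupport_radial hc.eq_zero_of_notMem
  have hφ : ContDiff ℝ ∞ φ := contDiff_radial hc.smooth
  have ilap : Integrable fun x => φ x * lap Φ x :=
    hc.integrable_mul hM fun x hx => (hΦ x hx).lap.continuousAt.continuousWithinAt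
  have iadv : Integrable fun x => φ x * adv u Φ x :=
    hc.integrable_mul hM fun x hx => (h.smooth_adv hx (hΦ x hx)).continuousAt.continuousWithinAt
  have hgrad : ContinuousOn (fun x => deriv (deriv F) (H x) * ∑ i, pd i H x * pd i H x)
      {x | x ≠ 0} := fun x hx => by
    refine ContinuousAt.continuousWithinAt (ContDiffAt.continuousAt (𝕜 := ℝ) (n := ∞) ?_)
    exact ((contDiff_deriv (contDiff_deriv hF)).contDiffAt.comp x (hHs x hx)).mul
      (ContDiffAt.sum fun i _ => ((hHs x hx).pd i).mul ((hHs x hx).pd i))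
  have step1 : ∫ x, φ x * (deriv (deriv F) (H x) * ∑ i, pd i H x * pd i H x) ≤
      ∫ x, (φ x * lap Φ x - φ x * adv u Φ x) := by
    refine integral_mono (hc.integrable_mul hM hgrad) (ilap.sub iadv) fun x => ?_
    by_cases hx : x = 0
    · have : φ x = 0 := by simp [φ, hx, hc.eq_zero_of_le 0 hM2.le]
      simp [this]
    · have e1 : lap Φ x = _ := lap_comp hF isOpen_ne_zero hHs hx
      have e2 : adv u Φ x = deriv F (H x) * adv u H x := by
        unfold adv
        rw [Finset.mul_sum]
        refine Finset.sum_congr rfl fun i _ => ?_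
        rw [show pd i Φ x = _ from pd_comp (hF.differentiable (by simp) _) (hHs x hx)]
        ring
      simp only
      rw [e1, e2, ← mul_sub]
      refine mul_le_mul_of_nonneg_left ?_ (hc.nonneg _)
      nlinarith [mul_le_mul_of_nonneg_left (h.adv_head_le_lap_head hx) (hF1 (H x))]
  have i1 : Integrable fun x => lap φ x * Φ x :=
    integrable_mul_of_tsupport hφ.lap.continuous (hcs.of_isClosed_subset (isClosed_tsupport _)
      (tsupport_lap φ)) fun x hx => (hΦ x (hs (tsupport_lap φ hx))).continuousAt
  have hΦ' : ∀ x ∈ tsupport φ, ContDiffAt ℝ ∞ Φ x := fun x hx => hΦ x (hs hx)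
  have i2 : Integrable fun x => adv u φ x * Φ x := by
    have e : (fun x => adv u φ x * Φ x) = fun x => ∑ i, pd i φ x * (u i x * Φ x) := by
      ext x
      unfold adv
      rw [Finset.sum_mul]
      exact Finset.sum_congr rfl fun i _ => by ring
    rw [e]
    exact integrable_finsetSum _ fun i _ => integrable_mul_of_tsupport (hφ.pd i).continuous
      (hcs.pd i) fun x hx => ((h.smooth x (hs (tsupport_pd φ i hx)) i).mul
        (hΦ' x (tsupport_pd φ i hx))).continuousAt
  rw [integral_sub ilap iadv, integral_mul_lap hφ hcs hΦ', h.integral_mul_adv hφ hcs hs hΦ',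
    sub_neg_eq_add, ← integral_add i1 i2] at step1
  refine step1.trans ?_
  set A := (2 * n + 4 + 2 * C) * B * K * M⁻¹ ^ (n / 2 - 2 : ℝ) with hA
  have hA0 : 0 ≤ A := by positivity
  set S := shell n (M⁻¹ / 2) (2 * (M⁻¹ / 2))
  have hS : MeasurableSet S := (isCompact_shell n _ _).isClosed.measurableSet
  have iS : IntegrableOn (fun x : E n => A * (‖x‖ ^ 2) ^ (-(n / 2 : ℝ))) S := by
    refine ContinuousOn.integrableOn_compact (isCompact_shell n _ _) fun x hx => ?_
    have hq : ‖x‖ ^ 2 ≠ 0 := (hM2.trans_le hx.1).ne'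
    have hcq : ContinuousAt (fun x : E n => ‖x‖ ^ 2) x := by fun_prop
    exact (continuousAt_const.mul (hcq.rpow_const (Or.inl hq))).continuousWithinAt
  have hpt : ∀ x, lap φ x * Φ x + adv u φ x * Φ x ≤
      S.indicator (fun x => A * (‖x‖ ^ 2) ^ (-(n / 2 : ℝ))) x := fun x => by
    rw [← add_mul]
    by_cases hx : x ∈ S
    · rw [indicator_of_mem hx]
      have hx0 : x ≠ 0 := ne_zero_of_mem_shell hM2 hx
      have hq : 0 < ‖x‖ ^ 2 := hM2.trans_le hx.1
      have h1 := abs_lap_add_adv_cutoff_le hc hx0 (hb x hx0)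
      have h2 : |Φ x| ≤ K / ‖x‖ ^ 2 := (hFs _).trans (hH x hx0)
      have h3 := mul_le_mul h1 h2 (abs_nonneg _) ((abs_nonneg _).trans h1)
      rw [← abs_mul] at h3
      have h4 : ((‖x‖ ^ 2) ^ 2)⁻¹ ≤ M⁻¹ ^ (n / 2 - 2 : ℝ) * (‖x‖ ^ 2) ^ (-(n / 2 : ℝ)) := by
        have := inv_sq_le_of_mem_shell hn hM2 hx
        rwa [mul_div_cancel₀ _ two_ne_zero] at this
      calc _ ≤ _ := le_abs_self _
        _ ≤ _ := h3
        _ = (2 * n + 4 + 2 * C) * B * K * ((‖x‖ ^ 2) ^ 2)⁻¹ := by field_simp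
        _ ≤ _ := mul_le_mul_of_nonneg_left h4 (by positivity)
        _ = _ := by rw [hA]; ring
    · rw [indicator_of_notMem hx]
      by_cases hx' : M ≤ ‖x‖ ^ 2
      · have hx0 : x ≠ 0 := by rintro rfl; simp at hx'; linarith
        have : Φ x = 0 := by
          refine hF0 _ ((le_abs_self _).trans ((hH x hx0).trans (le_trans ?_ hδ)))
          exact div_le_div_of_nonneg_left hK hM hx'
        rw [this, mul_zero]
      · have hq : ‖x‖ ^ 2 ∈ (transition M)ᶜ := by
          simp only [transition, mem_compl_iff, mem_union, mem_Icc, not_or, not_and]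
          refine ⟨fun h1 h2 => hx ⟨h1, by linarith⟩, fun h1 => absurd h1 hx'⟩
        have e1 : lap φ x = 0 := by
          rw [lap_radial hc.smooth, hc.deriv_eq_zero _ hq, hc.deriv_deriv_eq_zero _ hq]; simp
        have e2 : adv u φ x = 0 := Finset.sum_eq_zero fun i _ => by
          rw [pd_radial hc.smooth, hc.deriv_eq_zero _ hq]; simp
        rw [e1, e2]; simp
  refine (integral_mono (i1.add i2) (iS.integrable_indicator hS) hpt).trans ?_
  rw [integral_indicator hS, integral_const_mul]
  refine (mul_le_mul_of_nonneg_left (setIntegral_shell_le (by lia) hM2) hA0).trans_eq ?_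
  rw [hA]; ring

/-- In dimension at least five, the head pressure is nonpositive. -/
lemma IsSol.head_nonpos (h : IsSol u p {x | x ≠ 0})
    (hb : ∀ x, x ≠ 0 → |radial u x| ≤ C) (hH : ∀ x, x ≠ 0 → |head u p x| ≤ K / ‖x‖ ^ 2)
    (hn : 5 ≤ n) (hK : 0 ≤ K) (hC : 0 ≤ C) :
    ∀ x, x ≠ 0 → head u p x ≤ 0 := by
  intro x₀ hx₀
  refine le_of_forall_pos_le_add fun δ hδ => ?_
  rw [zero_add]
  obtain ⟨F, hF, hF', hF'', hF0, hFs⟩ := exists_convex_truncation hδ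
  obtain ⟨B, hB, hex⟩ := exists_isCutoff
  choose c hc using fun k : ℕ => hex (4 ^ k) (one_le_pow₀ (by norm_num))
  set H := head u p
  have hHs : ∀ x, x ≠ 0 → ContDiffAt ℝ ∞ H x := fun x hx => h.smooth_head hx
  have h4 : Tendsto (fun k : ℕ => (4 : ℝ) ^ k) atTop atTop :=
    tendsto_pow_atTop_atTop_of_one_lt (by norm_num)
  have hgrad : ContinuousOn (fun x => deriv (deriv F) (H x) * ∑ i, pd i H x * pd i H x)
      {x | x ≠ 0} := fun x hx => by
    refine ContinuousAt.continuousWithinAt (ContDiffAt.continuousAt (𝕜 := ℝ) (n := ∞) ?_)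
    exact ((contDiff_deriv (contDiff_deriv hF)).contDiffAt.comp x (hHs x hx)).mul
      (ContDiffAt.sum fun i _ => ((hHs x hx).pd i).mul ((hHs x hx).pd i))
  have hgrad0 : ∀ x, x ≠ 0 → 0 ≤ deriv (deriv F) (H x) * ∑ i, pd i H x * pd i H x :=
    fun x _ => mul_nonneg (hF'' _) (Finset.sum_nonneg fun i _ => mul_self_nonneg _)
  have hlim : Tendsto (fun k => ∫ x, c k (‖x‖ ^ 2) *
      (deriv (deriv F) (H x) * ∑ i, pd i H x * pd i H x)) atTop (𝓝 0) := by
    have hpos : (0 : ℝ) < n / 2 - 2 := by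
      have : (5 : ℝ) ≤ n := by exact_mod_cast hn
      linarith
    have hz : Tendsto (fun k : ℕ => ((4 : ℝ) ^ k)⁻¹ ^ (n / 2 - 2 : ℝ)) atTop (𝓝 0) := by
      have := (tendsto_inv_atTop_zero.comp h4).rpow_const (p := (n / 2 - 2 : ℝ)) (Or.inr hpos.le)
      rwa [Real.zero_rpow hpos.ne'] at this
    have hz2 := hz.const_mul ((2 * n + 4 + 2 * C) * B * K *
      (2 ^ (n / 2 : ℝ) * volume.real (ball (0 : E n) 1)))
    rw [mul_zero] at hz2
    refine tendsto_of_tendsto_of_tendsto_of_le_of_le' tendsto_const_nhds hz2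
      (Eventually.of_forall fun k => integral_nonneg
        (mul_nonneg_of_ne_zero (hc k) (by positivity) hgrad0)) ?_
    filter_upwards [h4.eventually_ge_atTop (K / δ)] with k hk
    refine h.integral_cutoff_mul_truncation_le hb hH (by lia) hF (fun s => ?_) hF0 hFs (hc k)
      (by positivity) ?_ hB hK hC
    · rw [hF']; exact Real.smoothTransition.nonneg _
    · rw [div_le_iff₀ (by positivity)]
      rwa [div_le_iff₀' hδ] at hk
  have hG := eq_zero_of_tendsto_integral_cutoff hc hgrad hgrad0 hlim
  have hdF := contDiff_deriv hF
  have hpd : ∀ x, x ≠ 0 → fderiv ℝ (fun y => deriv F (H y)) x = 0 := fun x hx => by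
    have hz : ∀ i, pd i (fun y => deriv F (H y)) x = 0 := fun i => by
      rw [pd_comp (hdF.differentiable (by simp) _) (hHs x hx)]
      rcases mul_eq_zero.1 (hG x hx) with h0 | h0
      · rw [h0, zero_mul]
      · rw [Finset.sum_eq_zero_iff_of_nonneg fun i _ => mul_self_nonneg _] at h0
        rw [mul_self_eq_zero.1 (h0 i (Finset.mem_univ i)), mul_zero]
    ext v
    simp [fderiv_eq_sum_pd, hz]
  obtain ⟨a, ha⟩ := isOpen_ne_zero.exists_is_const_of_fderiv_eq_zero (isPreconnected_ne_zero
    (by lia)) (fun x hx => (diffAt (hdF.contDiffAt.comp x (hHs x hx))).differentiableWithinAt) hpd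
  obtain ⟨k, hk⟩ := (h4.eventually_ge_atTop (K / δ)).exists
  set y : E n := EuclideanSpace.single ⟨0, by lia⟩ ((4 : ℝ) ^ k)
  have hyn : ‖y‖ = 4 ^ k := by simp [y]
  have hy0 : y ≠ 0 := norm_pos_iff.1 (by rw [hyn]; positivity)
  have hHy : H y ≤ δ := by
    refine (le_abs_self _).trans ((hH y hy0).trans ?_)
    rw [hyn, div_le_iff₀ (by positivity)]
    rw [div_le_iff₀' hδ] at hk
    have : (1 : ℝ) ≤ 4 ^ k := one_le_pow₀ (by norm_num)
    nlinarith
  have h0 : deriv F (H x₀) = 0 := by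
    have e1 := ha x₀ hx₀
    have e2 := ha y hy0
    simp only [Function.comp] at e1 e2
    rw [e1, ← e2, hF', Real.smoothTransition.zero_of_nonpos (by linarith)]
  by_contra! hlt
  rw [hF'] at h0
  exact (Real.smoothTransition.pos_of_pos (by linarith : 0 < H x₀ - δ)).ne' h0

end HeadSign

section WeightedCutoff

variable {a q B M : ℝ} {c f : ℝ → ℝ}

lemma deriv_rpow_neg_mul (hq : 0 < q) (hf : DifferentiableAt ℝ f q) :
    deriv (fun s => s ^ (-a) * f s) q =
      -a * (q ^ (-(a + 1)) * f q) + q ^ (-a) * deriv f q := by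
  have h1 : HasDerivAt (fun s : ℝ => s ^ (-a)) (-a * q ^ (-a - 1)) q :=
    Real.hasDerivAt_rpow_const (Or.inl hq.ne')
  rw [(h1.fun_mul hf.hasDerivAt).deriv, show -a - 1 = -(a + 1) by ring]
  ring

lemma rpow_neg_add_one (hq : 0 < q) : q ^ (-(a + 1)) = q ^ (-a) / q := by
  rw [show -(a + 1) = -a - 1 by ring, Real.rpow_sub_one hq.ne']

lemma deriv_rpow_neg_mul' (hq : 0 < q) (hf : ContDiff ℝ ∞ f) :
    deriv (fun s => s ^ (-a) * f s) q = q ^ (-a) / q * (q * deriv f q - a * f q) := by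
  rw [deriv_rpow_neg_mul hq (hf.differentiable (by simp) q), rpow_neg_add_one hq]
  field_simp
  ring

lemma deriv_deriv_rpow_neg_mul (hq : 0 < q) (hf : ContDiff ℝ ∞ f) :
    deriv (deriv fun s => s ^ (-a) * f s) q = q ^ (-a) / q ^ 2 *
      (q ^ 2 * deriv (deriv f) q - 2 * a * (q * deriv f q) + a * (a + 1) * f q) := by
  have hd : ∀ s : ℝ, 0 < s → ∀ (e : ℝ) {g : ℝ → ℝ}, ContDiff ℝ ∞ g →
      DifferentiableAt ℝ (fun s : ℝ => s ^ e * g s) s := fun s hs e g hg =>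
    (Real.hasDerivAt_rpow_const (Or.inl hs.ne')).differentiableAt.mul
      (hg.differentiable (by simp) s)
  have hf' := contDiff_deriv hf
  have e : (deriv fun s => s ^ (-a) * f s) =ᶠ[𝓝 q]
      fun s => -a * (s ^ (-(a + 1)) * f s) + s ^ (-a) * deriv f s := by
    filter_upwards [lt_mem_nhds hq] with s hs
      using deriv_rpow_neg_mul hs (hf.differentiable (by simp) s)
  rw [e.deriv_eq, deriv_fun_add ((hd q hq _ hf).const_mul _) (hd q hq _ hf'),
    deriv_const_mul_field, deriv_rpow_neg_mul' hq hf, deriv_rpow_neg_mul' hq hf',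
    rpow_neg_add_one hq]
  field_simp
  ring

lemma IsCutoff.contDiff_rpow_mul (h : IsCutoff B M c) (hM : 0 < M) :
    ContDiff ℝ ∞ fun s => s ^ a * c s := by
  refine contDiff_iff_contDiffAt.2 fun s => ?_
  rcases lt_or_ge s (M⁻¹ / 2) with hs | hs
  · have : (fun s => s ^ a * c s) =ᶠ[𝓝 s] fun _ => 0 := by
      filter_upwards [Iio_mem_nhds hs] with t ht
      rw [h.eq_zero_of_le t (mem_Iio.1 ht).le, mul_zero]
    exact contDiffAt_const.congr_of_eventuallyEq this
  · have : s ≠ 0 := ((by positivity : 0 < M⁻¹ / 2).trans_le hs).ne'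
    exact (Real.contDiffAt_rpow_const_of_ne this).mul h.smooth.contDiffAt

lemma IsCutoff.rpow_mul_eq_zero (h : IsCutoff B M c) :
    ∀ s, s ∉ Icc (M⁻¹ / 2) (2 * M) → s ^ a * c s = 0 := fun s hs => by
  rw [h.eq_zero_of_notMem s hs, mul_zero]

end WeightedCutoff

/-- The algebraic inequality combining the energy, virial and momentum identities. -/
lemma cutoff_inequality {α B c c₁ c₂ C G H k K Q q w ρ : ℝ} (hα : 0 ≤ α) (hq : 0 < q)
    (hw : 0 ≤ w) (hc : 0 ≤ c) (hc₁ : |c₁| ≤ B) (hc₂ : |c₂| ≤ B) (hk : 0 ≤ k) (hG : 0 ≤ G)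
    (hQ : -k - q * G / 2 ≤ Q) (hρ : ρ ^ 2 ≤ 2 * k * q) (hρC : |ρ| ≤ C) (hαH : α * H ≤ 0)
    (hH : |H| ≤ K / q) :
    c * (w / q * (k - α * H)) ≤
      w * c * G - w / q * ((8 - 4 * α) * c₁ + 4 * c₂ - 4 * α * c) * k -
        2 * (w / q * (c₁ - α * c)) * ρ * H + w / q * c * Q + w / q * (2 * c + 2 * c₁) * k -
        α * (C + 1 / 2) * (ρ * (w / q ^ 2 * (-4 * α * c₁ + 4 * c₂)) +
          (w / q * (2 * c + 2 * c₁) * (H - k) + 2 * (w / q * c) * k +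
            2 * (w / q ^ 2 * (c₁ - (α + 1) * c)) * ρ ^ 2)) +
        B * (14 + 4 * α + 2 * K + (C + 1 / 2) * (4 * α * (α + 1) + 2 + 6 * α)) *
          (w / q * (k + |ρ| / q - α * H)) := by
  set μ := C + 1 / 2 with hμ
  have hC : 0 ≤ C := (abs_nonneg _).trans hρC
  have hB : 0 ≤ B := (abs_nonneg _).trans hc₁
  have hμ0 : 0 ≤ μ := by positivity
  have hK : 0 ≤ K := by
    have := (abs_nonneg _).trans hH
    rwa [le_div_iff₀ hq, zero_mul] at this
  set y := |ρ| / q with hy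
  have hy0 : 0 ≤ y := by positivity
  have hz : ρ ^ 2 / q ≤ 2 * k := by rwa [div_le_iff₀ hq]
  have hz0 : 0 ≤ ρ ^ 2 / q := by positivity
  have main : 0 ≤ c * (q * G + 4 * α * k + 2 * α * ρ * H + Q + 2 * k - 2 * α * μ * H +
      2 * α * μ * (α + 1) * (ρ ^ 2 / q) - k + α * H) := by
    refine mul_nonneg hc ?_
    have e1 : 0 ≤ (2 * ρ - 2 * μ + 1) * (α * H) := by
      refine mul_nonneg_of_nonpos_of_nonpos ?_ hαH
      rw [hμ]
      linarith [le_abs_self ρ]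
    have e2 : 0 ≤ 2 * α * μ * (α + 1) * (ρ ^ 2 / q) := by positivity
    have e3 : 0 ≤ α * k := by positivity
    have e4 : 0 ≤ q * G := by positivity
    linarith
  have t1 : ((8 - 4 * α) * c₁ + 4 * c₂) * k ≤ (12 + 4 * α) * B * k := by
    refine mul_le_mul_of_nonneg_right ?_ hk
    have := abs_le.1 hc₁
    have := abs_le.1 hc₂
    nlinarith
  have t2 : 2 * (c₁ * (ρ * H)) ≤ 2 * (B * (K * y)) := by
    have e : |ρ * H| ≤ K * y := by
      rw [abs_mul, hy]
      calc |ρ| * |H| ≤ |ρ| * (K / q) := mul_le_mul_of_nonneg_left hH (abs_nonneg _)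
        _ = _ := by ring
    have := mul_le_mul hc₁ e (abs_nonneg _) hB
    rw [← abs_mul] at this
    linarith [le_abs_self (c₁ * (ρ * H))]
  have t3 : -(c₁ * k) ≤ B * k := by nlinarith [(abs_le.1 hc₁).1]
  have t4 : α * μ * (ρ / q * (-4 * α * c₁ + 4 * c₂)) ≤ α * μ * (y * (4 * (α + 1) * B)) := by
    refine mul_le_mul_of_nonneg_left ?_ (by positivity)
    have e : |-4 * α * c₁ + 4 * c₂| ≤ 4 * (α + 1) * B := by
      have := abs_le.1 hc₁
      have := abs_le.1 hc₂
      rw [abs_le]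
      constructor <;> nlinarith
    have := mul_le_mul_of_nonneg_left e hy0
    have hyq : |ρ / q| = y := by rw [abs_div, abs_of_pos hq]
    rw [← hyq, ← abs_mul] at this
    exact hyq ▸ (le_abs_self _).trans this
  have t5 : μ * (c₁ * (α * H - α * k)) ≤ μ * (B * (α * k - α * H)) := by
    refine mul_le_mul_of_nonneg_left ?_ hμ0
    have : 0 ≤ α * k := by positivity
    nlinarith [(abs_le.1 hc₁).1]
  have t6 : α * μ * (c₁ * (ρ ^ 2 / q)) ≤ α * μ * (B * (2 * k)) := by
    refine mul_le_mul_of_nonneg_left ?_ (by positivity)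
    exact (mul_le_mul_of_nonneg_right (le_of_abs_le hc₁) hz0).trans
      (mul_le_mul_of_nonneg_left hz hB)
  have s2 : 0 ≤ B * (-(α * H)) * (14 + 4 * α + 2 * K + μ * (4 * α * (α + 1) + 6 * α)) :=
    mul_nonneg (mul_nonneg hB (by linarith)) (by positivity)
  have s3 : 0 ≤ B * y * (14 + 4 * α + μ * (2 + 6 * α)) := by positivity
  have s4 : 0 ≤ B * k * (2 * K + μ * (4 * α * (α + 1) + 2)) := by positivity
  have key : 0 ≤ w / q * (c * (q * G + 4 * α * k + 2 * α * ρ * H + Q + 2 * k - 2 * α * μ * H +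
      2 * α * μ * (α + 1) * (ρ ^ 2 / q) - k + α * H) - ((8 - 4 * α) * c₁ + 4 * c₂) * k -
      2 * (c₁ * (ρ * H)) + 2 * (c₁ * k) - α * μ * (ρ / q * (-4 * α * c₁ + 4 * c₂)) -
      2 * (μ * (c₁ * (α * H - α * k))) - 2 * (α * μ * (c₁ * (ρ ^ 2 / q))) +
      B * (14 + 4 * α + 2 * K + μ * (4 * α * (α + 1) + 2 + 6 * α)) * (k + y - α * H)) := by
    refine mul_nonneg (by positivity) ?_
    linarith
  refine sub_nonneg.1 (key.trans_eq ?_)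
  field_simp
  ring

section EnergyInequality

variable {u : Fin n → E n → ℝ} {p : E n → ℝ} {B C K M α : ℝ} {b c : ℝ → ℝ}

lemma kin_nonneg (u : Fin n → E n → ℝ) (x : E n) : 0 ≤ kin u x :=
  Finset.sum_nonneg fun j _ => mul_nonneg (by norm_num) (mul_self_nonneg _)

lemma gradSq_nonneg (u : Fin n → E n → ℝ) (x : E n) : 0 ≤ gradSq u x :=
  Finset.sum_nonneg fun _ _ => Finset.sum_nonneg fun _ _ => mul_self_nonneg _

lemma radial_sq_le (u : Fin n → E n → ℝ) (x : E n) :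
    radial u x ^ 2 ≤ 2 * kin u x * ‖x‖ ^ 2 := by
  have e : 2 * kin u x = ∑ j, u j x ^ 2 := by
    rw [kin, Finset.mul_sum]
    exact Finset.sum_congr rfl fun j _ => by ring
  rw [e, EuclideanSpace.real_norm_sq_eq]
  exact Finset.sum_mul_sq_le_sq_mul_sq _ _ _

lemma IsSol.smooth_radial {Ω : Set (E n)} (h : IsSol u p Ω) {x : E n} (hx : x ∈ Ω) :
    ContDiffAt ℝ ∞ (radial u) x := by
  unfold radial
  exact ContDiffAt.sum fun i _ => (h.smooth x hx i).mul (contDiff_coord i).contDiffAt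

lemma IsSol.smooth_gradSq {Ω : Set (E n)} (h : IsSol u p Ω) {x : E n} (hx : x ∈ Ω) :
    ContDiffAt ℝ ∞ (gradSq u) x := by
  unfold gradSq
  exact ContDiffAt.sum fun j _ => ContDiffAt.sum fun i _ =>
    ((h.smooth x hx j).pd i).mul ((h.smooth x hx j).pd i)

lemma IsSol.le_radial_deriv_kin {Ω : Set (E n)} (h : IsSol u p Ω) {x : E n} (hx : x ∈ Ω) :
    -kin u x - ‖x‖ ^ 2 * gradSq u x / 2 ≤ ∑ i, x i * pd i (kin u) x := by
  have e : ∑ i, x i * pd i (kin u) x = ∑ j, u j x * ∑ i, x i * pd i (u j) x := by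
    simp_rw [h.pd_kin hx, Finset.mul_sum]
    rw [Finset.sum_comm]
    exact Finset.sum_congr rfl fun j _ => Finset.sum_congr rfl fun i _ => by ring
  rw [e, kin, gradSq, Finset.mul_sum, Finset.sum_div, ← Finset.sum_neg_distrib,
    ← Finset.sum_sub_distrib]
  refine Finset.sum_le_sum fun j _ => ?_
  have h1 : (∑ i, x i * pd i (u j) x) ^ 2 ≤ ‖x‖ ^ 2 * ∑ i, pd i (u j) x * pd i (u j) x := by
    refine (Finset.sum_mul_sq_le_sq_mul_sq _ _ _).trans_eq ?_
    rw [EuclideanSpace.real_norm_sq_eq]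
    congr 1
    exact Finset.sum_congr rfl fun j _ => by ring
  nlinarith [sq_nonneg (u j x + ∑ i, x i * pd i (u j) x)]

/-- The union of the two shells in which the radial cutoff at scale `M` varies. -/
def annuli (n : ℕ) (M : ℝ) : Set (E n) :=
  shell n (M⁻¹ / 2) (2 * (M⁻¹ / 2)) ∪ shell n M (2 * M)

lemma isCompact_annuli (n : ℕ) (M : ℝ) : IsCompact (annuli n M) :=
  (isCompact_shell n _ _).union (isCompact_shell n _ _)

lemma measurableSet_annuli (n : ℕ) (M : ℝ) : MeasurableSet (annuli n M) :=
  (isCompact_annuli n M).isClosed.measurableSet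

lemma mem_annuli_iff {x : E n} : x ∈ annuli n M ↔ ‖x‖ ^ 2 ∈ transition M := by
  simp only [annuli, transition, shell, mem_union, mem_ofPred_eq, mem_Icc]
  rw [mul_div_cancel₀ _ two_ne_zero]

lemma ne_zero_of_mem_annuli (hM : 0 < M) {x : E n} (hx : x ∈ annuli n M) : x ≠ 0 :=
  hx.elim (ne_zero_of_mem_shell (by positivity)) (ne_zero_of_mem_shell hM)

lemma continuousOn_annuli (hM : 0 < M) {f : E n → ℝ} (hf : ContinuousOn f {x | x ≠ 0}) :
    ContinuousOn f (annuli n M) :=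
  hf.mono fun _ hx => ne_zero_of_mem_annuli hM hx

lemma integrable_radial_mul {r R : ℝ} (hr : 0 < r) (hb : Continuous b)
    (hb0 : ∀ q, q ∉ Icc r R → b q = 0) {f : E n → ℝ} (hf : ContinuousOn f {x | x ≠ 0}) :
    Integrable fun x => b (‖x‖ ^ 2) * f x := by
  refine integrable_of_shell (r := r) (R := R) ?_ fun x hx => ?_
  · refine ContinuousOn.mul ?_ (hf.mono fun x hx => ne_zero_of_mem_shell hr hx)
    exact (hb.comp (by fun_prop : Continuous fun x : E n => ‖x‖ ^ 2)).continuousOn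
  · rw [hb0 _ hx, zero_mul]

lemma continuousOn_weight (a : ℝ) :
    ContinuousOn (fun x : E n => (‖x‖ ^ 2) ^ a / ‖x‖ ^ 2) {x | x ≠ 0} := fun x hx => by
  have hq : ‖x‖ ^ 2 ≠ 0 := pow_ne_zero 2 (norm_ne_zero_iff.2 hx)
  have hc : ContinuousAt (fun x : E n => ‖x‖ ^ 2) x := by fun_prop
  exact ((hc.rpow_const (Or.inl hq)).div hc hq).continuousWithinAt

lemma IsSol.integral_cutoff_mul_le (h : IsSol u p {x | x ≠ 0})
    (hb : ∀ x, x ≠ 0 → |radial u x| ≤ C)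
    (hH : ∀ x, x ≠ 0 → |head u p x| ≤ K / ‖x‖ ^ 2) (hα : 0 ≤ α) (hn : (n : ℝ) = 2 * α + 4)
    (hs : ∀ x, x ≠ 0 → α * head u p x ≤ 0) (hc : IsCutoff B M c) (hM : 0 < M) :
    ∫ x, c (‖x‖ ^ 2) * ((‖x‖ ^ 2) ^ (-α) / ‖x‖ ^ 2 * (kin u x - α * head u p x)) ≤
      B * (14 + 4 * α + 2 * K + (C + 1 / 2) * (4 * α * (α + 1) + 2 + 6 * α)) *
        ∫ x in annuli n M, (‖x‖ ^ 2) ^ (-α) / ‖x‖ ^ 2 *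
          (kin u x + |radial u x| / ‖x‖ ^ 2 - α * head u p x) := by
  set A := B * (14 + 4 * α + 2 * K + (C + 1 / 2) * (4 * α * (α + 1) + 2 + 6 * α))
  set b : ℝ → ℝ := fun s => s ^ (-α) * c s with hbd
  set d : ℝ → ℝ := fun s => s ^ (-(α + 1)) * c s with hdd
  have hr : 0 < M⁻¹ / 2 := by positivity
  have hbs : ContDiff ℝ ∞ b := hc.contDiff_rpow_mul hM
  have hds : ContDiff ℝ ∞ d := hc.contDiff_rpow_mul hM
  have hb0 : ∀ s, s ∉ Icc (M⁻¹ / 2) (2 * M) → b s = 0 := hc.rpow_mul_eq_zero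
  have hd0 : ∀ s, s ∉ Icc (M⁻¹ / 2) (2 * M) → d s = 0 := hc.rpow_mul_eq_zero
  have hop : IsOpen (Icc (M⁻¹ / 2) (2 * M))ᶜ := isClosed_Icc.isOpen_compl
  have hb1 := deriv_eq_zero_of_isOpen hop hb0
  have hb2 := deriv_eq_zero_of_isOpen hop hb1
  have hd1 := deriv_eq_zero_of_isOpen hop hd0
  have hd2 := deriv_eq_zero_of_isOpen hop hd1
  have cb1 := (contDiff_deriv hbs).continuous
  have cb2 := (contDiff_deriv (contDiff_deriv hbs)).continuous
  have cd1 := (contDiff_deriv hds).continuous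
  have cd2 := (contDiff_deriv (contDiff_deriv hds)).continuous
  have ck : ContinuousOn (kin u) {x | x ≠ 0} :=
    fun x hx => (h.smooth_kin hx).continuousAt.continuousWithinAt
  have cH : ContinuousOn (head u p) {x | x ≠ 0} :=
    fun x hx => (h.smooth_head hx).continuousAt.continuousWithinAt
  have cp : ContinuousOn p {x | x ≠ 0} :=
    fun x hx => (h.smooth_p x hx).continuousAt.continuousWithinAt
  have cρ : ContinuousOn (radial u) {x | x ≠ 0} :=
    fun x hx => (h.smooth_radial hx).continuousAt.continuousWithinAt
  have cG : ContinuousOn (gradSq u) {x | x ≠ 0} :=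
    fun x hx => (h.smooth_gradSq hx).continuousAt.continuousWithinAt
  have cQ : ContinuousOn (fun x => ∑ i, x i * pd i (kin u) x) {x | x ≠ 0} := fun x hx =>
    (ContDiffAt.sum fun i _ => (contDiff_coord i).contDiffAt.mul
      ((h.smooth_kin hx).pd i)).continuousAt.continuousWithinAt
  have i1 : Integrable fun x => b (‖x‖ ^ 2) * gradSq u x :=
    integrable_radial_mul hr hbs.continuous hb0 cG
  have i2 : Integrable fun x : E n =>
      (2 * n * deriv b (‖x‖ ^ 2) + 4 * ‖x‖ ^ 2 * deriv (deriv b) (‖x‖ ^ 2)) * kin u x :=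
    integrable_radial_mul hr (b := fun s => 2 * n * deriv b s + 4 * s * deriv (deriv b) s)
      (by fun_prop) (fun q hq => by rw [hb1 q hq, hb2 q hq]; simp) ck
  have i3 : Integrable fun x => 2 * deriv b (‖x‖ ^ 2) * radial u x * head u p x := by
    have := integrable_radial_mul hr (b := fun s => 2 * deriv b s)
      (by fun_prop) (fun q hq => by rw [hb1 q hq]; simp) (cρ.mul cH)
    simpa only [Pi.mul_apply, mul_assoc] using this
  have i4 : Integrable fun x => d (‖x‖ ^ 2) * ∑ i, x i * pd i (kin u) x :=
    integrable_radial_mul hr hds.continuous hd0 cQ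
  have i5 : Integrable fun x : E n =>
      (n * d (‖x‖ ^ 2) + 2 * ‖x‖ ^ 2 * deriv d (‖x‖ ^ 2)) * kin u x :=
    integrable_radial_mul hr (b := fun s => n * d s + 2 * s * deriv d s)
      (by have := hds.continuous; fun_prop) (fun q hq => by rw [hd0 q hq, hd1 q hq]; simp) ck
  have i6 : Integrable fun x : E n => radial u x *
        (2 * n * deriv d (‖x‖ ^ 2) + 4 * ‖x‖ ^ 2 * deriv (deriv d) (‖x‖ ^ 2)) +
      (2 * d (‖x‖ ^ 2) * kin u x + 2 * deriv d (‖x‖ ^ 2) * radial u x ^ 2) +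
      (n * d (‖x‖ ^ 2) + 2 * ‖x‖ ^ 2 * deriv d (‖x‖ ^ 2)) * p x := by
    refine ((Integrable.add ?_ (Integrable.add ?_ ?_)).add ?_)
    · have := integrable_radial_mul hr
        (b := fun s => 2 * n * deriv d s + 4 * s * deriv (deriv d) s)
        (by fun_prop) (fun q hq => by rw [hd1 q hq, hd2 q hq]; simp) cρ
      simpa only [mul_comm (radial u _)] using this
    · exact integrable_radial_mul hr (b := fun s => 2 * d s)
        (by have := hds.continuous; fun_prop) (fun q hq => by rw [hd0 q hq]; simp) ck
    · exact integrable_radial_mul hr (b := fun s => 2 * deriv d s)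
        (by fun_prop) (fun q hq => by rw [hd1 q hq]; simp) (cρ.pow 2)
    · exact integrable_radial_mul hr (b := fun s => n * d s + 2 * s * deriv d s)
        (by have := hds.continuous; fun_prop) (fun q hq => by rw [hd0 q hq, hd1 q hq]; simp) cp
  have e1 := h.integral_mul_gradSq hbs hr hb0
  have e2 := integral_mul_radial_deriv hds hr hd0 fun x hx => h.smooth_kin hx
  have e3 := h.integral_momentum_radial hds hr hd0
  have cw := continuousOn_weight (n := n) (-α)
  have cL : ContinuousOn (fun x => (‖x‖ ^ 2) ^ (-α) / ‖x‖ ^ 2 *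
      (kin u x + |radial u x| / ‖x‖ ^ 2 - α * head u p x)) {x | x ≠ 0} := by
    refine cw.mul ((ck.add (cρ.abs.div ?_ fun x hx => ?_)).sub (continuousOn_const.mul cH))
    · fun_prop
    · exact pow_ne_zero 2 (norm_ne_zero_iff.2 hx)
  have iL := (continuousOn_annuli hM cL).integrableOn_compact (μ := volume) (isCompact_annuli n M)
  have iLi := iL.integrable_indicator (measurableSet_annuli n M)
  have iD := hc.integrable_mul hM
    (cw.mul (ck.sub (continuousOn_const.mul cH : ContinuousOn (fun x => α * head u p x) _)))
  have iZ := ((((i1.sub i2).sub i3).add i4).add i5).sub (i6.const_mul (α * (C + 1 / 2)))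
  have hint := integral_mono iD (iZ.add (iLi.const_mul A)) fun x => ?_
  · refine hint.trans_eq ?_
    rw [integral_add' iZ (iLi.const_mul A), integral_const_mul,
      integral_indicator (measurableSet_annuli n M),
      integral_sub' ((((i1.sub i2).sub i3).add i4).add i5) (i6.const_mul (α * (C + 1 / 2))),
      integral_add' (((i1.sub i2).sub i3).add i4) i5, integral_add' ((i1.sub i2).sub i3) i4,
      integral_sub' (i1.sub i2) i3, integral_sub' i1 i2, integral_const_mul, e1, e2, e3]
    ring
  · by_cases hx : x = 0
    · have hz : ‖x‖ ^ 2 ∉ Icc (M⁻¹ / 2) (2 * M) := by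
        simp [hx, hr.not_ge]
      have hz' : x ∉ annuli n M := fun hx' => ne_zero_of_mem_annuli hM hx' hx
      simp only [Pi.add_apply, Pi.sub_apply, indicator_of_notMem hz', hb0 _ hz, hb1 _ hz,
        hb2 _ hz, hd0 _ hz, hd1 _ hz, hd2 _ hz, hc.eq_zero_of_notMem _ hz]
      simp
    · have hq : 0 < ‖x‖ ^ 2 := by have := norm_pos_iff.2 hx; positivity
      have hw : 0 ≤ (‖x‖ ^ 2) ^ (-α) := by positivity
      have key := fun b₀ h1 h2 => cutoff_inequality (B := b₀) (c₁ := ‖x‖ ^ 2 * deriv c (‖x‖ ^ 2))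
        (c₂ := (‖x‖ ^ 2) ^ 2 * deriv (deriv c) (‖x‖ ^ 2)) hα hq hw (hc.nonneg (‖x‖ ^ 2)) h1 h2
        (kin_nonneg u x) (gradSq_nonneg u x) (h.le_radial_deriv_kin hx) (radial_sq_le u x)
        (hb x hx) (hs x hx) (hH x hx)
      have vb : b (‖x‖ ^ 2) = (‖x‖ ^ 2) ^ (-α) * c (‖x‖ ^ 2) := rfl
      have vb1 : deriv b (‖x‖ ^ 2) = _ := deriv_rpow_neg_mul' hq hc.smooth
      have vb2 : deriv (deriv b) (‖x‖ ^ 2) = _ := deriv_deriv_rpow_neg_mul hq hc.smooth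
      have vd : d (‖x‖ ^ 2) = (‖x‖ ^ 2) ^ (-(α + 1)) * c (‖x‖ ^ 2) := rfl
      have vd1 : deriv d (‖x‖ ^ 2) = _ := deriv_rpow_neg_mul' hq hc.smooth
      have vd2 : deriv (deriv d) (‖x‖ ^ 2) = _ := deriv_deriv_rpow_neg_mul hq hc.smooth
      rw [rpow_neg_add_one hq] at vd vd1 vd2
      have vp : p x = head u p x - kin u x := by unfold head; ring
      obtain ⟨b₀, h1, h2, hind⟩ : ∃ b₀, |‖x‖ ^ 2 * deriv c (‖x‖ ^ 2)| ≤ b₀ ∧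
          |(‖x‖ ^ 2) ^ 2 * deriv (deriv c) (‖x‖ ^ 2)| ≤ b₀ ∧
          A * (annuli n M).indicator (fun x => (‖x‖ ^ 2) ^ (-α) / ‖x‖ ^ 2 *
            (kin u x + |radial u x| / ‖x‖ ^ 2 - α * head u p x)) x =
          b₀ * (14 + 4 * α + 2 * K + (C + 1 / 2) * (4 * α * (α + 1) + 2 + 6 * α)) *
            ((‖x‖ ^ 2) ^ (-α) / ‖x‖ ^ 2 *
              (kin u x + |radial u x| / ‖x‖ ^ 2 - α * head u p x)) := by
        by_cases hx' : x ∈ annuli n M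
        · exact ⟨B, hc.deriv_le _ hq, hc.deriv_deriv_le _ hq, by rw [indicator_of_mem hx']⟩
        · have hx'' := hx'
          rw [mem_annuli_iff] at hx''
          refine ⟨0, ?_, ?_, by rw [indicator_of_notMem hx']; ring⟩
          · rw [hc.deriv_eq_zero _ hx'']; simp
          · rw [hc.deriv_deriv_eq_zero _ hx'']; simp
      simp only [Pi.add_apply, Pi.sub_apply, Pi.mul_apply]
      rw [hind]
      refine (key b₀ h1 h2).trans_eq (congrArg (· + _) ?_)
      rw [vb, vb1, vb2, vd, vd1, vd2, vp, hn]
      generalize (‖x‖ ^ 2) ^ (-α) = w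
      generalize ‖x‖ ^ 2 = q at hq
      field_simp
      ring

end EnergyInequality

section Absorption

lemma setIntegral_annuli_le (hn : 0 < n) {M : ℝ} (hM : 0 < M) :
    ∫ x in annuli n M, (‖x‖ ^ 2) ^ (-(n / 2 : ℝ)) ≤
      2 * ((2 : ℝ) ^ (n / 2 : ℝ) * volume.real (ball (0 : E n) 1)) := by
  have hr : 0 < M⁻¹ / 2 := by positivity
  have hcont : ContinuousOn (fun x : E n => (‖x‖ ^ 2) ^ (-(n / 2 : ℝ))) {x | x ≠ 0} :=
    fun x hx => by
      have hc : ContinuousAt (fun x : E n => ‖x‖ ^ 2) x := by fun_prop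
      exact (hc.rpow_const (Or.inl (pow_ne_zero 2 (norm_ne_zero_iff.2 hx)))).continuousWithinAt
  have hms : ∀ r R, MeasurableSet (shell n r R) :=
    fun r R => (isCompact_shell n r R).isClosed.measurableSet
  have hi : ∀ r R, 0 < r → Integrable
      ((shell n r R).indicator fun x : E n => (‖x‖ ^ 2) ^ (-(n / 2 : ℝ))) := fun r R hr =>
    ((hcont.mono fun x hx => ne_zero_of_mem_shell hr hx).integrableOn_compact
      (isCompact_shell n r R)).integrable_indicator (hms r R)
  have h1 := setIntegral_shell_le hn hr
  have h2 := setIntegral_shell_le hn hM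
  rw [← integral_indicator (hms _ _)] at h1 h2
  rw [← integral_indicator (measurableSet_annuli n M)]
  refine le_trans ?_ ((add_le_add h1 h2).trans_eq (two_mul _).symm)
  rw [← integral_add (hi _ _ hr) (hi _ _ hM)]
  refine integral_mono_of_nonneg
    (ae_of_all _ fun x => indicator_nonneg (fun x _ => by positivity) x)
    ((hi _ _ hr).add (hi _ _ hM)) (ae_of_all _ fun x => ?_)
  have hW : 0 ≤ (‖x‖ ^ 2) ^ (-(n / 2 : ℝ)) := by positivity
  have key : ∀ S T : Set (E n), (S ∪ T).indicator (fun x => (‖x‖ ^ 2) ^ (-(n / 2 : ℝ))) x ≤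
      S.indicator (fun x => (‖x‖ ^ 2) ^ (-(n / 2 : ℝ))) x +
        T.indicator (fun x => (‖x‖ ^ 2) ^ (-(n / 2 : ℝ))) x := fun S T => by
    by_cases h1 : x ∈ S <;> by_cases h2 : x ∈ T <;> simp [h1, h2, hW]
  exact key _ _

/-- Energy absorption: an integral controlled on the annuli by arbitrarily small multiples of the
scale invariant weight, up to the integral itself, vanishes. -/
lemma eq_zero_of_integral_cutoff_le (hn : 0 < n) {B A R : ℝ} {c : ℕ → ℝ → ℝ}
    (hc : ∀ k, IsCutoff B (4 ^ k) (c k)) {D L : E n → ℝ} (hD : ContinuousOn D {x | x ≠ 0})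
    (hL : ContinuousOn L {x | x ≠ 0}) (hD0 : ∀ x, x ≠ 0 → 0 ≤ D x)
    (hA : 0 ≤ A) (hR : 0 ≤ R) (hLA : ∀ x, x ≠ 0 → L x ≤ A * (‖x‖ ^ 2) ^ (-(n / 2 : ℝ)))
    (hLt : ∀ t, 0 < t → ∀ x, x ≠ 0 →
      L x ≤ t * (‖x‖ ^ 2) ^ (-(n / 2 : ℝ)) + (1 + 1 / (2 * t)) * D x)
    (hle : ∀ k, ∫ x, c k (‖x‖ ^ 2) * D x ≤ R * ∫ x in annuli n (4 ^ k), L x) :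
    ∀ x, x ≠ 0 → D x = 0 := by
  refine eq_zero_of_tendsto_integral_cutoff hc hD hD0 ?_
  set I : ℕ → ℝ := fun k => ∫ x, c k (‖x‖ ^ 2) * D x with hI
  set V := 2 * ((2 : ℝ) ^ (n / 2 : ℝ) * volume.real (ball (0 : E n) 1))
  have hV0 : 0 ≤ V := by positivity
  have h4 : ∀ k, (0 : ℝ) < 4 ^ k := fun k => by positivity
  have hcont : ContinuousOn (fun x : E n => (‖x‖ ^ 2) ^ (-(n / 2 : ℝ))) {x | x ≠ 0} :=
    fun x hx => by
      have hc : ContinuousAt (fun x : E n => ‖x‖ ^ 2) x := by fun_prop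
      exact (hc.rpow_const (Or.inl (pow_ne_zero 2 (norm_ne_zero_iff.2 hx)))).continuousWithinAt
  have hint : ∀ {f : E n → ℝ} k, ContinuousOn f {x | x ≠ 0} →
      IntegrableOn f (annuli n (4 ^ k)) := fun k hf =>
    (continuousOn_annuli (h4 k) hf).integrableOn_compact (isCompact_annuli n _)
  have hne : ∀ {k} {x : E n}, x ∈ annuli n (4 ^ k) → x ≠ 0 :=
    fun hx => ne_zero_of_mem_annuli (h4 _) hx
  have hmono : Monotone I := monotone_integral_cutoff hc hD hD0
  have hI0 : ∀ k, 0 ≤ I k := fun k => integral_nonneg (mul_nonneg_of_ne_zero (hc k) (h4 k) hD0)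
  have hbdd : BddAbove (range I) := by
    refine ⟨R * (A * V), ?_⟩
    rintro _ ⟨k, rfl⟩
    refine (hle k).trans (mul_le_mul_of_nonneg_left ?_ hR)
    refine (setIntegral_mono_on (hint k hL) ((hint k hcont).const_mul A)
      (measurableSet_annuli n _) fun x hx => hLA x (hne hx)).trans ?_
    rw [integral_const_mul]
    exact mul_le_mul_of_nonneg_left (setIntegral_annuli_le hn (h4 k)) hA
  have hlim := tendsto_atTop_ciSup hmono hbdd
  set l := ⨆ k, I k
  have hJ : ∀ k, ∫ x in annuli n (4 ^ (k + 1)), D x ≤ I (k + 2) - I k := fun k => by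
    rw [← integral_indicator (measurableSet_annuli n _), hI]
    simp only
    rw [← integral_sub ((hc _).integrable_mul (h4 _) hD) ((hc _).integrable_mul (h4 _) hD)]
    refine integral_mono ((hint _ hD).integrable_indicator (measurableSet_annuli n _))
      (((hc _).integrable_mul (h4 _) hD).sub ((hc _).integrable_mul (h4 _) hD)) fun x => ?_
    simp only
    by_cases hx : x ∈ annuli n (4 ^ (k + 1))
    · have hq := hx
      rw [mem_annuli_iff] at hq
      have hk := h4 k
      have e1 : (4 : ℝ) ^ (k + 1) = 4 * 4 ^ k := by ring
      have e2 : (4 : ℝ) ^ (k + 2) = 16 * 4 ^ k := by ring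
      have hk' : 0 < ((4 : ℝ) ^ k)⁻¹ := by positivity
      rw [e1, transition, mul_inv] at hq
      rw [indicator_of_mem hx, (hc (k + 2)).eq_one, one_mul]
      · have : c k (‖x‖ ^ 2) = 0 := by
          rcases hq with hq | hq
          · exact (hc k).eq_zero_of_le _ (hq.2.trans (by linarith))
          · exact (hc k).eq_zero_of_ge _ (le_trans (by linarith) hq.1)
        rw [this]; simp
      · rw [e2, mul_inv]
        rcases hq with hq | hq
        · exact le_trans (by linarith) hq.1
        · refine le_trans ?_ hq.1
          have : ((4 : ℝ) ^ k)⁻¹ ≤ 1 := inv_le_one_of_one_le₀ (one_le_pow₀ (by norm_num))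
          have : (1 : ℝ) ≤ 4 ^ k := one_le_pow₀ (by norm_num)
          linarith
      · rw [e2]
        rcases hq with hq | hq
        · have : ((4 : ℝ) ^ k)⁻¹ ≤ 1 := inv_le_one_of_one_le₀ (one_le_pow₀ (by norm_num))
          have : (1 : ℝ) ≤ 4 ^ k := one_le_pow₀ (by norm_num)
          exact hq.2.trans (by linarith)
        · exact hq.2.trans (by linarith)
    · rw [indicator_of_notMem hx, ← sub_mul]
      by_cases hx0 : x = 0
      · rw [(hc _).eq_zero_of_le _ (by simp [hx0]; positivity),
          (hc _).eq_zero_of_le _ (by simp [hx0]; positivity)]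
        simp
      · refine mul_nonneg (sub_nonneg.2 ?_) (hD0 x hx0)
        exact (hc k).le_of_two_mul_le (hc (k + 2)) (h4 k)
          (by rw [pow_add]; linarith [h4 k]) _
  have hlt : ∀ t, 0 < t → l ≤ R * (t * V) := fun t ht => by
    have hb : ∀ k, I (k + 1) ≤ R * (t * V + (1 + 1 / (2 * t)) * (I (k + 2) - I k)) := fun k => by
      refine (hle (k + 1)).trans (mul_le_mul_of_nonneg_left ?_ hR)
      refine (setIntegral_mono_on (hint _ hL) (((hint _ hcont).const_mul t).add
        ((hint _ hD).const_mul (1 + 1 / (2 * t)))) (measurableSet_annuli n _)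
        fun x hx => hLt t ht x (hne hx)).trans ?_
      rw [integral_add' ((hint _ hcont).const_mul t) ((hint _ hD).const_mul _),
        integral_const_mul, integral_const_mul]
      exact add_le_add (mul_le_mul_of_nonneg_left (setIntegral_annuli_le hn (h4 _)) ht.le)
        (mul_le_mul_of_nonneg_left (hJ k) (by positivity))
    have hl1 := hlim.comp (tendsto_add_atTop_nat 1)
    have hl2 := hlim.comp (tendsto_add_atTop_nat 2)
    have := le_of_tendsto_of_tendsto' hl1
      ((((hl2.sub hlim).const_mul (1 + 1 / (2 * t))).const_add (t * V)).const_mul R) hb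
    simpa using this
  have hl0 : l = 0 := by
    refine le_antisymm (le_of_forall_pos_le_add fun ε hε => ?_) (ge_of_tendsto' hlim hI0)
    refine (hlt (ε / (R * V + 1)) (by positivity)).trans ?_
    rw [zero_add, div_mul_eq_mul_div, mul_div_assoc', div_le_iff₀ (by positivity)]
    nlinarith
  rwa [hl0] at hlim

end Absorption

section Rigidity

variable {u : Fin n → E n → ℝ} {p : E n → ℝ} {C K : ℝ}

lemma kin_le {x : E n} (hb : ∀ j, |u j x| ≤ C / ‖x‖) : kin u x ≤ n * C ^ 2 / ‖x‖ ^ 2 := by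
  unfold kin
  refine (Finset.sum_le_sum (g := fun _ => C ^ 2 / ‖x‖ ^ 2) fun j _ => ?_).trans_eq (by
    simp [mul_div_assoc])
  have := sq_le_sq' (abs_le.1 (hb j)).1 (abs_le.1 (hb j)).2
  rw [div_pow] at this
  nlinarith [mul_self_nonneg (u j x)]

lemma eq_zero_of_kin_eq_zero {x : E n} (h : kin u x = 0) (j : Fin n) : u j x = 0 := by
  have := (Finset.sum_eq_zero_iff_of_nonneg
    fun j _ => mul_nonneg (by norm_num) (mul_self_nonneg (u j x))).1 h j (Finset.mem_univ j)
  simpa using this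

theorem IsSol.eq_zero (hn : 4 ≤ n) (h : IsSol u p {x | x ≠ 0}) (hC : 0 < C)
    (hb : ∀ x, x ≠ 0 → ∀ j, |u j x| ≤ C / ‖x‖) : ∀ x, x ≠ 0 → ∀ j, u j x = 0 := by
  obtain ⟨p, K, hK, h, hp⟩ := h.exists_normalised_pressure (by lia) hC hb
  have hρ : ∀ x, x ≠ 0 → |radial u x| ≤ n * C := fun x hx => abs_radial_le hx (hb x hx)
  set N := n * C ^ 2 + K
  have hN : 0 ≤ N := by positivity
  have hH : ∀ x, x ≠ 0 → |head u p x| ≤ N / ‖x‖ ^ 2 := fun x hx => by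
    refine (abs_add_le _ _).trans ?_
    rw [abs_of_nonneg (kin_nonneg u x), add_div]
    exact add_le_add (kin_le (hb x hx)) (hp x hx)
  obtain ⟨B, hB, hex⟩ := exists_isCutoff
  choose c hc using fun k : ℕ => hex (4 ^ k) (one_le_pow₀ (by norm_num))
  set α : ℝ := n / 2 - 2 with hαd
  have hα : 0 ≤ α := by
    have : (4 : ℝ) ≤ n := by exact_mod_cast hn
    rw [hαd]; linarith
  have hnα : (n : ℝ) = 2 * α + 4 := by rw [hαd]; ring
  have hs : ∀ x, x ≠ 0 → α * head u p x ≤ 0 := fun x hx => by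
    rcases hn.eq_or_lt with rfl | hn5
    · rw [hαd]; norm_num
    · exact mul_nonpos_of_nonneg_of_nonpos hα
        (h.head_nonpos hρ hH hn5 hN (by positivity) x hx)
  set w : E n → ℝ := fun x => (‖x‖ ^ 2) ^ (-α) / ‖x‖ ^ 2
  have hw0 : ∀ x, 0 ≤ w x := fun x => by positivity
  have hwq : ∀ x, x ≠ 0 → w x / ‖x‖ ^ 2 = (‖x‖ ^ 2) ^ (-(n / 2 : ℝ)) := fun x hx => by
    have hq : 0 < ‖x‖ ^ 2 := by have := norm_pos_iff.2 hx; positivity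
    simp only [w]
    rw [← rpow_neg_add_one hq, ← rpow_neg_add_one hq]
    congr 2
    rw [hαd]; ring
  have cw : ContinuousOn w {x | x ≠ 0} := continuousOn_weight (-α)
  have ck : ContinuousOn (kin u) {x | x ≠ 0} :=
    fun x hx => (h.smooth_kin hx).continuousAt.continuousWithinAt
  have cH : ContinuousOn (fun x => α * head u p x) {x | x ≠ 0} :=
    continuousOn_const.mul fun x hx => (h.smooth_head hx).continuousAt.continuousWithinAt
  have cρ : ContinuousOn (fun x => |radial u x| / ‖x‖ ^ 2) {x | x ≠ 0} :=
    ContinuousOn.div (ContinuousOn.abs fun x hx =>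
      (h.smooth_radial hx).continuousAt.continuousWithinAt) (by fun_prop)
      fun x hx => pow_ne_zero 2 (norm_ne_zero_iff.2 hx)
  have hzero := eq_zero_of_integral_cutoff_le (by lia) hc
    (D := fun x => w x * (kin u x - α * head u p x))
    (L := fun x => w x * (kin u x + |radial u x| / ‖x‖ ^ 2 - α * head u p x))
    (A := n * C ^ 2 + n * C + α * N)
    (R := B * (14 + 4 * α + 2 * N + (n * C + 1 / 2) * (4 * α * (α + 1) + 2 + 6 * α)))
    (cw.mul (ck.sub cH)) (cw.mul ((ck.add cρ).sub cH))
    (fun x hx => mul_nonneg (hw0 x) (by linarith [kin_nonneg u x, hs x hx]))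
    (by positivity) (by positivity) (fun x hx => ?_) (fun t ht x hx => ?_)
    fun k => h.integral_cutoff_mul_le hρ hH hα hnα hs (hc k) (by positivity)
  · intro x hx
    have hw : 0 < w x := by have := norm_pos_iff.2 hx; positivity
    have := (mul_eq_zero.1 (hzero x hx)).resolve_left hw.ne'
    exact eq_zero_of_kin_eq_zero (le_antisymm (by linarith [hs x hx]) (kin_nonneg u x))
  · have hq : 0 < ‖x‖ ^ 2 := by have := norm_pos_iff.2 hx; positivity
    rw [← hwq x hx, mul_div_assoc', mul_comm _ (w x), mul_div_assoc]
    refine mul_le_mul_of_nonneg_left ?_ (hw0 x)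
    have h1 := kin_le (hb x hx)
    have h2 := div_le_div_of_nonneg_right (hρ x hx) hq.le
    have h3 := mul_le_mul_of_nonneg_left (neg_le_of_abs_le (hH x hx)) hα
    rw [add_div, add_div, mul_div_assoc α]
    linarith
  · have hq : 0 < ‖x‖ ^ 2 := by have := norm_pos_iff.2 hx; positivity
    have e : |radial u x| / ‖x‖ ^ 2 ≤ t / ‖x‖ ^ 2 + kin u x / (2 * t) := by
      have h1 := radial_sq_le u x
      rw [div_add_div _ _ hq.ne' (by positivity), div_le_div_iff₀ hq (by positivity)]
      have h2 : 2 * (|radial u x| * t) ≤ 2 * t ^ 2 + ‖x‖ ^ 2 * kin u x := by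
        nlinarith [sq_nonneg (|radial u x| - 2 * t), sq_abs (radial u x)]
      nlinarith [mul_le_mul_of_nonneg_left h2 hq.le]
    have e' : 0 ≤ 1 / (2 * t) * -(α * head u p x) :=
      mul_nonneg (by positivity) (by linarith [hs x hx])
    rw [← hwq x hx]
    have := mul_le_mul_of_nonneg_left (show kin u x + |radial u x| / ‖x‖ ^ 2 - α * head u p x ≤
      t / ‖x‖ ^ 2 + (1 + 1 / (2 * t)) * (kin u x - α * head u p x) by
        rw [div_eq_mul_one_div (kin u x)] at e; linarith) (hw0 x)
    refine this.trans_eq ?_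
    ring

end Rigidity

end SteadyNS

/-- **Rigidity of steady Navier-Stokes solutions in ℝⁿ \ {0}, n ≥ 4.**
If `(u, p)` is a smooth solution of the steady Navier-Stokes equations
`-Δu + (u·∇)u + ∇p = 0`, `div u = 0` on `ℝⁿ \ {0}` with `n ≥ 4`, and
`|u(x)| ≤ C/|x|` there, then `u ≡ 0` on `ℝⁿ \ {0}`. -/
theorem rigidity_steady_NS_whole_space {n : ℕ} (hn : 4 ≤ n)
    (u : EuclideanSpace ℝ (Fin n) → EuclideanSpace ℝ (Fin n))
    (p : EuclideanSpace ℝ (Fin n) → ℝ)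
    (hu : ContDiffOn ℝ (⊤ : ℕ∞) u {x : EuclideanSpace ℝ (Fin n) | x ≠ 0})
    (hp : ContDiffOn ℝ (⊤ : ℕ∞) p {x : EuclideanSpace ℝ (Fin n) | x ≠ 0})
    (hNS : ∀ x : EuclideanSpace ℝ (Fin n), x ≠ 0 → ∀ j : Fin n,
      -(∑ i : Fin n, fderiv ℝ (fun y => fderiv ℝ (fun z => u z j) y
            (EuclideanSpace.single i 1)) x (EuclideanSpace.single i 1)) +
        (∑ i : Fin n, u x i * fderiv ℝ (fun z => u z j) x (EuclideanSpace.single i 1)) +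
        fderiv ℝ p x (EuclideanSpace.single j 1) = 0)
    (hdiv : ∀ x : EuclideanSpace ℝ (Fin n), x ≠ 0 →
      ∑ i : Fin n, fderiv ℝ (fun z => u z i) x (EuclideanSpace.single i 1) = 0)
    (C : ℝ) (hC : 0 < C)
    (hbound : ∀ x : EuclideanSpace ℝ (Fin n), x ≠ 0 → ‖u x‖ ≤ C / ‖x‖) :
    ∀ x : EuclideanSpace ℝ (Fin n), x ≠ 0 → u x = 0 := by
  have h : SteadyNS.IsSol (fun j x => u x j) p {x | x ≠ 0} :=
    { isOpen := isOpen_compl_singleton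
      smooth := fun x hx j =>
        (SteadyNS.contDiff_coord j).contDiffAt.comp x
          (hu.contDiffAt (isOpen_compl_singleton.mem_nhds hx))
      smooth_p := fun x hx => hp.contDiffAt (isOpen_compl_singleton.mem_nhds hx)
      momentum := hNS
      div := hdiv }
  intro x hx
  ext j
  exact h.eq_zero hn hC
    (fun y hy j => (PiLp.norm_apply_le (u y) j).trans (hbound y hy)) x hx j
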